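/- Let K be a convex body in ℝ^n whose Löwner ellipsoid is B^n ⊇ K, and suppose W(K) ≤ (1+ε)W(Δ_n) for some ε > 0. Then there exists an orthogonal transformation T ∈ O(n) such that δ_H(K, TΔ_n) ≤ n^{29}·ε^{1/(4n)}. -/

import Mathlib

open MeasureTheory Metric Set
open scoped RealInnerProductSpace ENNReal

noncomputable section

/-- The standard Gaussian measure `γ_n` on `ℝ^n`. -/
def gaussianM (n : ℕ) : Measure (EuclideanSpace ℝ (Fin n)) :=
  volume.withDensity fun x =>
    ENNReal.ofReal ((2 * Real.pi) ^ (-(n : ℝ) / 2) * Real.exp (-‖x‖ ^ 2 / 2))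

/-- The ℓ-norm of a convex body: `ℓ(K) = ∫ ‖x‖_K dγ_n(x)`, where `‖·‖_K` is the gauge of `K`. -/
def ellNorm (n : ℕ) (K : Set (EuclideanSpace ℝ (Fin n))) : ℝ :=
  ∫ x, gauge K x ∂(gaussianM n)

/-- The support function `h_K`. -/
def suppFn {n : ℕ} (K : Set (EuclideanSpace ℝ (Fin n))) (u : EuclideanSpace ℝ (Fin n)) : ℝ :=
  sSup ((fun y => ⟪u, y⟫) '' K)

/-- The mean width `W(K) = (1/(n κ_n)) ∫_{S^{n-1}} (h_K(u) + h_K(-u)) du`, the integration over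
the unit sphere being with respect to the (n-1)-dimensional Hausdorff measure. -/
def meanWidth (n : ℕ) (K : Set (EuclideanSpace ℝ (Fin n))) : ℝ :=
  (1 / (n * (volume (closedBall (0 : EuclideanSpace ℝ (Fin n)) 1)).toReal)) *
    ∫ u in sphere (0 : EuclideanSpace ℝ (Fin n)) 1,
      (suppFn K u + suppFn K (-u)) ∂(μH[(n : ℝ) - 1])

/-- The polar set `K° = {x : ⟨x,y⟩ ≤ 1 for all y ∈ K}`. -/
def polarSet {n : ℕ} (K : Set (EuclideanSpace ℝ (Fin n))) : Set (EuclideanSpace ℝ (Fin n)) :=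
  {x | ∀ y ∈ K, ⟪x, y⟫ ≤ 1}

/-- `w` lists the vertices of a regular simplex inscribed in the unit ball: `n+1` unit vectors
with pairwise inner products `-1/n`. -/
def IsRegVerts {n : ℕ} (w : Fin (n + 1) → EuclideanSpace ℝ (Fin n)) : Prop :=
  (∀ i, ‖w i‖ = 1) ∧ ∀ i j, i ≠ j → ⟪w i, w j⟫ = -1 / n

/-- An ellipsoid: an image of the closed Euclidean unit ball under an invertible affine map. -/
def IsEllipsoid {n : ℕ} (D : Set (EuclideanSpace ℝ (Fin n))) : Prop :=
  ∃ f : EuclideanSpace ℝ (Fin n) ≃ᵃ[ℝ] EuclideanSpace ℝ (Fin n),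
    D = f '' closedBall 0 1

/-- `D` is the Löwner ellipsoid (minimal volume ellipsoid containing) of `K`. -/
def IsLoewnerEllipsoid {n : ℕ} (D K : Set (EuclideanSpace ℝ (Fin n))) : Prop :=
  IsEllipsoid D ∧ K ⊆ D ∧ ∀ D', IsEllipsoid D' → K ⊆ D' → volume D ≤ volume D'

/-- `D` is the John ellipsoid (maximal volume ellipsoid contained in) of `K`. -/
def IsJohnEllipsoid {n : ℕ} (D K : Set (EuclideanSpace ℝ (Fin n))) : Prop :=
  IsEllipsoid D ∧ D ⊆ K ∧ ∀ D', IsEllipsoid D' → D' ⊆ K → volume D' ≤ volume D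

section Part1

lemma lms_log_bound {t l B : ℝ} (ht : 0 < t) (hl : 0 < l) (htB : t ≤ B) (hlB : l ≤ B) :
    Real.log t ≤ Real.log l + (t - l) / l - (t - l) ^ 2 / (4 * B ^ 2) := by
  have hB : 0 < B := lt_of_lt_of_le ht htB
  set a := Real.sqrt t with ha
  set b := Real.sqrt l with hb
  have ha0 : 0 < a := Real.sqrt_pos.2 ht
  have hb0 : 0 < b := Real.sqrt_pos.2 hl
  have hta : t = a ^ 2 := (Real.sq_sqrt ht.le).symm
  have hlb : l = b ^ 2 := (Real.sq_sqrt hl.le).symm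
  have h1 : Real.log (a / b) ≤ a / b - 1 := Real.log_le_sub_one_of_pos (by positivity)
  rw [Real.log_div ha0.ne' hb0.ne'] at h1
  have h2 : Real.log t = 2 * Real.log a := by rw [hta, Real.log_pow]; norm_num
  have h3 : Real.log l = 2 * Real.log b := by rw [hlb, Real.log_pow]; norm_num
  have h4 : (t - l) / l - 2 * (a / b - 1) = (a - b) ^ 2 / l := by
    rw [hta, hlb]; field_simp; ring
  have h5 : (t - l) ^ 2 / (4 * B ^ 2) ≤ (a - b) ^ 2 / l := by
    rw [div_le_div_iff₀ (by positivity) hl]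
    have h6 : (a + b) ^ 2 ≤ 4 * B := by nlinarith [sq_nonneg (a - b)]
    have h7 : (t - l) ^ 2 = (a - b) ^ 2 * (a + b) ^ 2 := by rw [hta, hlb]; ring
    rw [h7, mul_assoc]
    apply mul_le_mul_of_nonneg_left _ (sq_nonneg _)
    calc (a + b) ^ 2 * l ≤ (4 * B) * B := by gcongr
      _ = 4 * B ^ 2 := by ring
  linarith

section frame
variable {E : Type*} [NormedAddCommGroup E] [InnerProductSpace ℝ E]
variable {ι : Type*} [Fintype ι]

lemma lms_frame_polar {v : ι → E} {c : ι → ℝ} (hF : ∀ x, ∑ i, c i * ⟪v i, x⟫ ^ 2 = ‖x‖ ^ 2)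
    (x y : E) : ∑ i, c i * (⟪v i, x⟫ * ⟪v i, y⟫) = ⟪x, y⟫ := by
  have h1 := hF (x + y)
  have h2 := hF x
  have h3 := hF y
  rw [norm_add_sq_real, ← h2, ← h3] at h1
  have h4 : ∑ i, c i * ⟪v i, x + y⟫ ^ 2 = ∑ i, c i * ⟪v i, x⟫ ^ 2 + ∑ i, c i * ⟪v i, y⟫ ^ 2
      + 2 * ∑ i, c i * (⟪v i, x⟫ * ⟪v i, y⟫) := by
    rw [Finset.mul_sum, ← Finset.sum_add_distrib, ← Finset.sum_add_distrib]
    refine Finset.sum_congr rfl fun i _ => ?_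
    rw [inner_add_right]; ring
  linarith

lemma lms_frame_sum {v : ι → E} {c : ι → ℝ} (hF : ∀ x, ∑ i, c i * ⟪v i, x⟫ ^ 2 = ‖x‖ ^ 2)
    (x : E) : ∑ i, (c i * ⟪v i, x⟫) • v i = x := by
  apply ext_inner_right ℝ
  intro y
  rw [sum_inner, ← lms_frame_polar hF x y]
  refine Finset.sum_congr rfl fun i _ => ?_
  rw [real_inner_smul_left]; ring

/-- Bessel type inequality for frames -/
lemma lms_frame_bessel {v : ι → E} {c : ι → ℝ} (hc : ∀ i, 0 ≤ c i)
    (hF : ∀ x, ∑ i, c i * ⟪v i, x⟫ ^ 2 = ‖x‖ ^ 2)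
    (a : ι → ℝ) : ‖∑ i, (c i * a i) • v i‖ ^ 2 ≤ ∑ i, c i * a i ^ 2 := by
  set S := ∑ i, (c i * a i) • v i with hS
  have h1 : 0 ≤ ∑ i, c i * (a i - ⟪v i, S⟫) ^ 2 :=
    Finset.sum_nonneg fun i _ => mul_nonneg (hc i) (sq_nonneg _)
  have h2 : ∑ i, c i * (a i - ⟪v i, S⟫) ^ 2
      = ∑ i, c i * a i ^ 2 + ∑ i, c i * ⟪v i, S⟫ ^ 2 - 2 * ∑ i, (c i * a i) * ⟪v i, S⟫ := by
    rw [Finset.mul_sum, ← Finset.sum_add_distrib, ← Finset.sum_sub_distrib]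
    refine Finset.sum_congr rfl fun i _ => ?_
    ring
  have h3 : ∑ i, (c i * a i) * ⟪v i, S⟫ = ‖S‖ ^ 2 := by
    rw [← real_inner_self_eq_norm_sq]
    conv_rhs => rw [hS, sum_inner]
    refine Finset.sum_congr rfl fun i _ => ?_
    rw [real_inner_smul_left]
  rw [h2, h3, hF] at h1
  linarith

variable [FiniteDimensional ℝ E]

lemma lms_frame_trace {v : ι → E} {c : ι → ℝ} (hv : ∀ i, ‖v i‖ = 1)
    (hF : ∀ x, ∑ i, c i * ⟪v i, x⟫ ^ 2 = ‖x‖ ^ 2) :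
    ∑ i, c i = Module.finrank ℝ E := by
  have hb := stdOrthonormalBasis ℝ E
  have h1 : ∀ i, c i = ∑ k, c i * ⟪v i, stdOrthonormalBasis ℝ E k⟫ ^ 2 := by
    intro i
    rw [← Finset.mul_sum, OrthonormalBasis.sum_sq_inner_left, hv]; simp
  rw [Finset.sum_congr rfl fun i _ => h1 i, Finset.sum_comm]
  simp [hF]

lemma lms_det_ineq {v : ι → E} {c : ι → ℝ} (hc : ∀ i, 0 ≤ c i) (hv : ∀ i, ‖v i‖ = 1)
    (hF : ∀ x, ∑ i, c i * ⟪v i, x⟫ ^ 2 = ‖x‖ ^ 2) (t : ι → ℝ) (B : ℝ)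
    (ht : ∀ i, 0 < t i) (htB : ∀ i, t i ≤ B) (A : E →ₗ[ℝ] E)
    (hA : ∀ x, A x = ∑ i, (c i * t i * ⟪v i, x⟫) • v i) :
    0 < LinearMap.det A ∧ ∑ i, c i * Real.log (t i) +
      (1 / (8 * B ^ 2)) * ∑ i, ∑ j, c i * c j * ⟪v i, v j⟫ ^ 2 * (t i - t j) ^ 2
        ≤ Real.log (LinearMap.det A) := by
  have hAi : ∀ x y, ⟪A x, y⟫ = ∑ i, c i * t i * (⟪v i, x⟫ * ⟪v i, y⟫) := by
    intro x y
    rw [hA, sum_inner]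
    refine Finset.sum_congr rfl fun i _ => ?_
    rw [real_inner_smul_left]; ring
  have hsym : A.IsSymmetric := by
    intro x y
    rw [real_inner_comm (A y) x, hAi, hAi]
    refine Finset.sum_congr rfl fun i _ => ?_
    ring
  set e := hsym.eigenvectorBasis rfl with he
  set l := hsym.eigenvalues rfl with hl
  have hAe : ∀ k, A (e k) = l k • e k := fun k => by
    exact hsym.apply_eigenvectorBasis rfl k
  have hek : ∀ k, ‖e k‖ = 1 := fun k => e.orthonormal.1 k
  set p : ι → Fin (Module.finrank ℝ E) → ℝ := fun i k => c i * ⟪v i, e k⟫ ^ 2 with hp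
  have hp0 : ∀ i k, 0 ≤ p i k := fun i k => mul_nonneg (hc i) (sq_nonneg _)
  have hpi : ∀ k, ∑ i, p i k = 1 := fun k => by simp [hp, hF, hek]
  have hpk : ∀ i, ∑ k, p i k = c i := fun i => by
    simp only [hp]
    rw [← Finset.mul_sum, OrthonormalBasis.sum_sq_inner_left, hv]; simp
  have hlk : ∀ k, l k = ∑ i, p i k * t i := by
    intro k
    have : ⟪A (e k), e k⟫ = l k := by
      rw [hAe, real_inner_smul_left, real_inner_self_eq_norm_sq, hek]; simp
    rw [← this, hAi]
    refine Finset.sum_congr rfl fun i _ => ?_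
    simp only [hp]; ring
  have hlpos : ∀ k, 0 < l k := by
    intro k
    rw [hlk]
    have hne : ∃ i, p i k ≠ 0 := by
      by_contra hcon
      push Not at hcon
      have := hpi k
      simp [hcon] at this
    obtain ⟨i, hi⟩ := hne
    refine Finset.sum_pos' (fun i _ => mul_nonneg (hp0 i k) (ht i).le) ⟨i, Finset.mem_univ _, ?_⟩
    exact mul_pos (lt_of_le_of_ne (hp0 i k) (Ne.symm hi)) (ht i)
  have hlB : ∀ k, l k ≤ B := by
    intro k
    rw [hlk]
    calc ∑ i, p i k * t i ≤ ∑ i, p i k * B :=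
          Finset.sum_le_sum fun i _ => mul_le_mul_of_nonneg_left (htB i) (hp0 i k)
      _ = B := by rw [← Finset.sum_mul, hpi, one_mul]
  have hdet : LinearMap.det A = ∏ k, l k := by
    simpa using hsym.det_eq_prod_eigenvalues rfl
  have hlogdet : Real.log (LinearMap.det A) = ∑ k, Real.log (l k) := by
    rw [hdet, Real.log_prod (fun k _ => (hlpos k).ne')]
  refine ⟨by rw [hdet]; exact Finset.prod_pos fun k _ => hlpos k, ?_⟩
  -- main inequality
  have key : ∀ k, ∑ i, p i k * Real.log (t i) ≤
      Real.log (l k) - (1 / (4 * B ^ 2)) * ∑ i, p i k * (t i - l k) ^ 2 := by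
    intro k
    calc ∑ i, p i k * Real.log (t i)
        ≤ ∑ i, p i k * (Real.log (l k) + (t i - l k) / l k - (t i - l k) ^ 2 / (4 * B ^ 2)) :=
          Finset.sum_le_sum fun i _ => mul_le_mul_of_nonneg_left
            (lms_log_bound (ht i) (hlpos k) (htB i) (hlB k)) (hp0 i k)
      _ = (∑ i, p i k) * Real.log (l k) + (∑ i, p i k * t i - (∑ i, p i k) * l k) / l k
            - (1 / (4 * B ^ 2)) * ∑ i, p i k * (t i - l k) ^ 2 := by
          rw [Finset.sum_mul, Finset.sum_mul, ← Finset.sum_sub_distrib, Finset.sum_div,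
            Finset.mul_sum, ← Finset.sum_add_distrib, ← Finset.sum_sub_distrib]
          refine Finset.sum_congr rfl fun i _ => ?_
          ring
      _ = _ := by rw [hpi, ← hlk]; simp
  have key2 : ∑ k, ∑ i, p i k * (t i - l k) ^ 2 = ∑ i, c i * t i ^ 2 - ∑ k, l k ^ 2 := by
    have h1 : ∀ k, ∑ i, p i k * (t i - l k) ^ 2 = ∑ i, p i k * t i ^ 2 - l k ^ 2 := by
      intro k
      have : ∑ i, p i k * (t i - l k) ^ 2 = ∑ i, p i k * t i ^ 2
          - 2 * l k * (∑ i, p i k * t i) + (∑ i, p i k) * l k ^ 2 := by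
        rw [Finset.mul_sum, Finset.sum_mul, ← Finset.sum_sub_distrib, ← Finset.sum_add_distrib]
        refine Finset.sum_congr rfl fun i _ => ?_
        ring
      rw [this, ← hlk, hpi]; ring
    rw [Finset.sum_congr rfl fun k _ => h1 k, Finset.sum_sub_distrib, Finset.sum_comm]
    congr 1
    refine Finset.sum_congr rfl fun i _ => ?_
    rw [← Finset.sum_mul, hpk]
  have key3 : ∑ k, l k ^ 2 = ∑ i, ∑ j, c i * c j * ⟪v i, v j⟫ ^ 2 * (t i * t j) := by
    have h1 : ∀ k, l k ^ 2 = ∑ i, ∑ j, c i * c j * (t i * t j) * ⟪v i, v j⟫ *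
        (⟪v i, e k⟫ * ⟪e k, v j⟫) := by
      intro k
      have : ⟪A (e k), A (e k)⟫ = l k ^ 2 := by
        rw [hAe, real_inner_smul_left, real_inner_smul_right, real_inner_self_eq_norm_sq, hek]
        ring
      rw [← this, hAi]
      refine Finset.sum_congr rfl fun i _ => ?_
      rw [hA, inner_sum, Finset.mul_sum, Finset.mul_sum]
      refine Finset.sum_congr rfl fun j _ => ?_
      rw [real_inner_smul_right, real_inner_comm (e k) (v j)]
      ring_nf
    rw [Finset.sum_congr rfl fun k _ => h1 k, Finset.sum_comm]
    refine Finset.sum_congr rfl fun i _ => ?_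
    rw [Finset.sum_comm]
    refine Finset.sum_congr rfl fun j _ => ?_
    rw [← Finset.mul_sum, e.sum_inner_mul_inner]
    ring
  have key4 : ∑ i, ∑ j, c i * c j * ⟪v i, v j⟫ ^ 2 * (t i - t j) ^ 2
      = 2 * (∑ i, c i * t i ^ 2 - ∑ k, l k ^ 2) := by
    have h1 : ∀ i, ∑ j, c i * c j * ⟪v i, v j⟫ ^ 2 * t i ^ 2 = c i * t i ^ 2 := by
      intro i
      have := hF (v i)
      rw [hv] at this
      calc _ = c i * t i ^ 2 * ∑ j, c j * ⟪v j, v i⟫ ^ 2 := by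
            rw [Finset.mul_sum]
            refine Finset.sum_congr rfl fun j _ => ?_
            rw [real_inner_comm]; ring
        _ = _ := by rw [this]; ring
    have h2 : ∑ i, ∑ j, c i * c j * ⟪v i, v j⟫ ^ 2 * t j ^ 2 = ∑ i, c i * t i ^ 2 := by
      rw [Finset.sum_comm, ← Finset.sum_congr rfl fun i _ => h1 i]
      refine Finset.sum_congr rfl fun i _ => Finset.sum_congr rfl fun j _ => ?_
      rw [real_inner_comm]; ring
    rw [key3]
    have : ∑ i, ∑ j, c i * c j * ⟪v i, v j⟫ ^ 2 * (t i - t j) ^ 2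
      = ∑ i, ∑ j, c i * c j * ⟪v i, v j⟫ ^ 2 * t i ^ 2
        + ∑ i, ∑ j, c i * c j * ⟪v i, v j⟫ ^ 2 * t j ^ 2
        - 2 * ∑ i, ∑ j, c i * c j * ⟪v i, v j⟫ ^ 2 * (t i * t j) := by
      simp only [Finset.mul_sum, ← Finset.sum_add_distrib, ← Finset.sum_sub_distrib]
      refine Finset.sum_congr rfl fun i _ => Finset.sum_congr rfl fun j _ => ?_
      ring
    rw [this, h2, Finset.sum_congr rfl fun i _ => h1 i]; ring
  have hsum := Finset.sum_le_sum fun k (_ : k ∈ Finset.univ) => key k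
  rw [Finset.sum_sub_distrib, ← Finset.mul_sum, key2, ← hlogdet, Finset.sum_comm] at hsum
  have h5 : ∑ i, ∑ k, p i k * Real.log (t i) = ∑ i, c i * Real.log (t i) :=
    Finset.sum_congr rfl fun i _ => by rw [← Finset.sum_mul, hpk]
  rw [h5] at hsum
  rw [key4]
  have h6 : 1 / (8 * B ^ 2) * (2 * (∑ i, c i * t i ^ 2 - ∑ k, l k ^ 2))
     = 1 / (4 * B ^ 2) * (∑ i, c i * t i ^ 2 - ∑ k, l k ^ 2) := by
    by_cases hB : B = 0
    · simp [hB]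
    · field_simp; ring
  rw [h6]; linarith

end frame

end Part1

section Part2

/-- one dimensional Gaussian density -/
def gphi (y : ℝ) : ℝ := (Real.sqrt (2 * Real.pi))⁻¹ * Real.exp (-y ^ 2 / 2)

/-- one dimensional Gaussian distribution function -/
def gPhi (y : ℝ) : ℝ := ∫ x in Iic y, gphi x

lemma gphi_eq (y : ℝ) : gphi y = ProbabilityTheory.gaussianPDFReal 0 1 y := by
  simp [gphi, ProbabilityTheory.gaussianPDFReal]

lemma gphi_pos (y : ℝ) : 0 < gphi y := by unfold gphi; positivity

lemma gphi_cont : Continuous gphi := by unfold gphi; fun_prop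

lemma gphi_int : Integrable gphi := by
  have := ProbabilityTheory.integrable_gaussianPDFReal 0 1
  exact this.congr (Filter.Eventually.of_forall fun y => (gphi_eq y).symm)

lemma gphi_integral : ∫ x, gphi x = 1 := by
  simp_rw [gphi_eq]
  exact ProbabilityTheory.integral_gaussianPDFReal_eq_one 0 one_ne_zero

lemma gphi_neg (y : ℝ) : gphi (-y) = gphi y := by simp [gphi]

lemma gphi_anti {x y : ℝ} (hx : 0 ≤ x) (hxy : x ≤ y) : gphi y ≤ gphi x := by
  unfold gphi
  have : x ^ 2 ≤ y ^ 2 := by gcongr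
  gcongr

lemma gPhi_sub (a b : ℝ) : gPhi b - gPhi a = ∫ x in a..b, gphi x :=
  intervalIntegral.integral_Iic_sub_Iic gphi_int.integrableOn gphi_int.integrableOn

lemma gPhi_hasDerivAt (y : ℝ) : HasDerivAt gPhi (gphi y) y := by
  have h : gPhi = fun y => gPhi 0 + ∫ x in (0:ℝ)..y, gphi x := by
    ext z; rw [← gPhi_sub]; ring
  rw [h]
  exact (intervalIntegral.integral_hasDerivAt_right (gphi_cont.intervalIntegrable _ _)
    (gphi_cont.stronglyMeasurableAtFilter _ _) gphi_cont.continuousAt).const_add _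

lemma gPhi_cont : Continuous gPhi :=
  continuous_iff_continuousAt.2 fun y => (gPhi_hasDerivAt y).continuousAt

lemma gPhi_strictMono : StrictMono gPhi :=
  strictMono_of_hasDerivAt_pos (fun y => gPhi_hasDerivAt y) (fun y => gphi_pos y)

lemma gPhi_nonneg (y : ℝ) : 0 ≤ gPhi y :=
  integral_nonneg fun x => (gphi_pos x).le

lemma gPhi_pos (y : ℝ) : 0 < gPhi y :=
  lt_of_le_of_lt (gPhi_nonneg (y - 1)) (gPhi_strictMono (by linarith))

lemma gPhi_add_neg (y : ℝ) : gPhi y + gPhi (-y) = 1 := by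
  have h1 : gPhi (-y) = ∫ x in Ioi y, gphi x := by
    unfold gPhi
    have := integral_comp_neg_Iic (-y) gphi
    simp only [gphi_neg, neg_neg] at this
    exact this
  rw [h1, ← gphi_integral]
  have := integral_add_compl (μ := volume) (measurableSet_Iic (a := y)) gphi_int
  rw [compl_Iic] at this
  exact this

lemma gPhi_lt_one (y : ℝ) : gPhi y < 1 := by
  have := gPhi_add_neg y
  have := gPhi_pos (-y)
  linarith

lemma gPhi_zero : gPhi 0 = 1 / 2 := by
  have := gPhi_add_neg 0
  simp only [neg_zero] at this
  linarith

lemma gPhi_surj {p : ℝ} (hp0 : 0 < p) (hp1 : p < 1) : ∃ z, gPhi z = p := by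
  have h1 : Filter.Tendsto gPhi Filter.atTop (nhds 1) := by
    have := (aecover_Iic (μ := (volume : Measure ℝ))
      (Filter.tendsto_id (α := ℝ) (x := Filter.atTop))).integral_tendsto_of_countably_generated gphi_int
    rw [gphi_integral] at this
    exact this
  have h0 : Filter.Tendsto gPhi Filter.atBot (nhds 0) := by
    have h2 : gPhi = fun y => 1 - gPhi (-y) := by
      ext y; have := gPhi_add_neg y; linarith
    rw [h2]
    have := (h1.comp Filter.tendsto_neg_atBot_atTop).const_sub 1
    simpa using this
  have ha : ∃ a, gPhi a < p := (h0.eventually (gt_mem_nhds hp0)).exists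
  have hb : ∃ b, p < gPhi b := (h1.eventually (lt_mem_nhds hp1)).exists
  obtain ⟨a, ha⟩ := ha
  obtain ⟨b, hb⟩ := hb
  exact mem_range_of_exists_le_of_exists_ge gPhi_cont ⟨a, ha.le⟩ ⟨b, hb.le⟩

lemma gPhi_measure (y : ℝ) : ProbabilityTheory.gaussianReal 0 1 (Iio y) = ENNReal.ofReal (gPhi y) := by
  rw [ProbabilityTheory.gaussianReal_apply_eq_integral 0 one_ne_zero]
  congr 1
  rw [← integral_Iic_eq_integral_Iio]
  unfold gPhi
  simp_rw [gphi_eq]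

/-- inverse of the distribution function -/
def ginv (p : ℝ) : ℝ := Function.invFun gPhi p

lemma gPhi_ginv {p : ℝ} (hp0 : 0 < p) (hp1 : p < 1) : gPhi (ginv p) = p :=
  Function.invFun_eq (gPhi_surj hp0 hp1)

lemma ginv_gPhi (z : ℝ) : ginv (gPhi z) = z :=
  Function.leftInverse_invFun gPhi_strictMono.injective z

lemma ginv_contAt {p : ℝ} (hp0 : 0 < p) (hp1 : p < 1) : ContinuousAt ginv p := by
  have hm : StrictMonoOn ginv (Ioo 0 1) := by
    intro a ha b hb hab
    rw [← gPhi_strictMono.lt_iff_lt, gPhi_ginv ha.1 ha.2, gPhi_ginv hb.1 hb.2]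
    exact hab
  apply hm.continuousAt_of_image_mem_nhds (Ioo_mem_nhds hp0 hp1)
  have : ginv '' Ioo 0 1 = univ := by
    ext z
    simp only [mem_image, mem_univ, iff_true]
    exact ⟨gPhi z, ⟨gPhi_pos z, gPhi_lt_one z⟩, ginv_gPhi z⟩
  rw [this]; exact Filter.univ_mem

lemma ginv_hasDerivAt {p : ℝ} (hp0 : 0 < p) (hp1 : p < 1) :
    HasDerivAt ginv (gphi (ginv p))⁻¹ p := by
  apply HasDerivAt.of_local_left_inverse (ginv_contAt hp0 hp1) (gPhi_hasDerivAt _) (gphi_pos _).ne'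
  filter_upwards [Ioo_mem_nhds hp0 hp1] with q hq
  exact gPhi_ginv hq.1 hq.2

/-- the monotone transport map from the truncated Gaussian to the Gaussian -/
def gT (t y : ℝ) : ℝ := ginv (gPhi y / gPhi t)

/-- its derivative -/
def gT' (t y : ℝ) : ℝ := gphi y / (gPhi t * gphi (gT t y))

lemma gT_ratio {t y : ℝ} (h : y < t) : 0 < gPhi y / gPhi t ∧ gPhi y / gPhi t < 1 :=
  ⟨div_pos (gPhi_pos y) (gPhi_pos t), (div_lt_one (gPhi_pos t)).2 (gPhi_strictMono h)⟩

lemma gPhi_gT {t y : ℝ} (h : y < t) : gPhi (gT t y) = gPhi y / gPhi t :=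
  gPhi_ginv (gT_ratio h).1 (gT_ratio h).2

lemma gT'_pos (t y : ℝ) : 0 < gT' t y := by
  have := gphi_pos y
  have := gphi_pos (gT t y)
  have := gPhi_pos t
  unfold gT'; positivity

lemma gT_hasDerivAt {t y : ℝ} (h : y < t) : HasDerivAt (gT t) (gT' t y) y := by
  have h1 := (gPhi_hasDerivAt y).div_const (gPhi t)
  have h2 := (ginv_hasDerivAt (gT_ratio h).1 (gT_ratio h).2).comp y h1
  have h3 : gT' t y = (gphi (ginv (gPhi y / gPhi t)))⁻¹ * (gphi y / gPhi t) := by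
    change gphi y / (gPhi t * gphi (ginv (gPhi y / gPhi t))) = _
    have := gphi_pos (ginv (gPhi y / gPhi t))
    have := gPhi_pos t
    field_simp
  rw [h3]
  exact h2

lemma gT_log (t y : ℝ) : -y ^ 2 / 2 = Real.log (gPhi t) - gT t y ^ 2 / 2 + Real.log (gT' t y) := by
  have h1 := gphi_pos y
  have h2 := gphi_pos (gT t y)
  have h3 := gPhi_pos t
  unfold gT'
  rw [Real.log_div h1.ne' (by positivity), Real.log_mul h3.ne' h2.ne']
  unfold gphi
  rw [Real.log_mul (by positivity) (by positivity), Real.log_mul (by positivity) (by positivity),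
    Real.log_exp, Real.log_exp]
  ring

lemma gT_strictMono {t y z : ℝ} (hy : y < t) (hz : z < t) (h : y < z) : gT t y < gT t z := by
  rw [← gPhi_strictMono.lt_iff_lt, gPhi_gT hy, gPhi_gT hz]
  exact div_lt_div_of_pos_right (gPhi_strictMono h) (gPhi_pos t)

-- numerics
lemma gphi_le (y : ℝ) : gphi y ≤ 2 / 5 := by
  have h1 : (5:ℝ)/2 ≤ Real.sqrt (2 * Real.pi) := by
    apply Real.le_sqrt_of_sq_le; have := Real.pi_gt_d2; norm_num; linarith
  have h2 : Real.exp (-y ^ 2 / 2) ≤ 1 := Real.exp_le_one_iff.2 (by nlinarith [sq_nonneg y])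
  unfold gphi
  calc _ ≤ ((5:ℝ)/2)⁻¹ * 1 := by gcongr
    _ = 2 / 5 := by norm_num

lemma gPhi_lip {a b : ℝ} (h : a ≤ b) : gPhi b - gPhi a ≤ 2 / 5 * (b - a) := by
  rw [gPhi_sub]
  calc ∫ x in a..b, gphi x ≤ ∫ x in a..b, (2 / 5 : ℝ) := by
        apply intervalIntegral.integral_mono_on h (gphi_cont.intervalIntegrable _ _)
          (by simp) (fun x _ => gphi_le x)
    _ = _ := by simp; ring

lemma gPhi_lower {a b : ℝ} (ha : 0 ≤ a) (h : a ≤ b) : gphi b * (b - a) ≤ gPhi b - gPhi a := by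
  rw [gPhi_sub]
  calc gphi b * (b - a) = ∫ x in a..b, gphi b := by simp; ring
    _ ≤ ∫ x in a..b, gphi x := by
        apply intervalIntegral.integral_mono_on h (by simp) (gphi_cont.intervalIntegrable _ _)
          (fun x hx => gphi_anti (ha.trans hx.1) hx.2)

lemma sqrt_two_pi_le : Real.sqrt (2 * Real.pi) ≤ 2.51 := by
  apply Real.sqrt_le_iff.2; have := Real.pi_lt_d2; constructor <;> norm_num; linarith

lemma gPhi_one_ge : 73 / 100 ≤ gPhi 1 := by
  have h := gPhi_lower le_rfl (zero_le_one (α := ℝ))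
  rw [gPhi_zero] at h
  have h1 : Real.exp (1/2) ≤ 1.66 := by
    have h2 : Real.exp (1/2) ^ 2 = Real.exp 1 := by rw [← Real.exp_nat_mul]; norm_num
    have h3 := Real.exp_one_lt_d9
    nlinarith [Real.exp_pos (1/2)]
  have h4 : (23 / 100 : ℝ) ≤ gphi 1 := by
    unfold gphi
    have h5 : Real.exp (-1 ^ 2 / 2) = (Real.exp (1/2))⁻¹ := by rw [← Real.exp_neg]; norm_num
    rw [h5, ← mul_inv]
    calc (23 / 100 : ℝ) ≤ (2.51 * 1.66)⁻¹ := by norm_num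
      _ ≤ _ := by gcongr; exact sqrt_two_pi_le
  linarith

lemma gPhi_two_le : gPhi 2 ≤ 1 - 1 / 250 := by
  have h := gPhi_lower (zero_le_two (α := ℝ)) (show (2:ℝ) ≤ 3 by norm_num)
  have h0 := gPhi_lt_one 3
  have h1 : Real.exp (9/2) ≤ 91 := by
    have h2 : Real.exp (9/2) ^ 2 = Real.exp 1 ^ 9 := by
      rw [← Real.exp_nat_mul, ← Real.exp_nat_mul]; norm_num
    have h3 := Real.exp_one_lt_d9
    have h4 : Real.exp 1 ^ 9 ≤ 2.7182818286 ^ 9 := by gcongr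
    have h5 : (2.7182818286 : ℝ) ^ 9 ≤ 91 ^ 2 := by norm_num
    nlinarith [Real.exp_pos (9/2)]
  have h4 : (1 / 250 : ℝ) ≤ gphi 3 := by
    unfold gphi
    have h5 : Real.exp (-3 ^ 2 / 2) = (Real.exp (9/2))⁻¹ := by rw [← Real.exp_neg]; norm_num
    rw [h5, ← mul_inv]
    calc (1 / 250 : ℝ) ≤ (2.51 * 91)⁻¹ := by norm_num
      _ ≤ _ := by gcongr; exact sqrt_two_pi_le
  linarith


lemma gT_region {t : ℝ} (ht1 : 1 ≤ t) (ht2 : t ≤ 2) {y : ℝ} (hy : |y| ≤ 1 / 1000) :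
    0 ≤ gT t y ∧ gT t y ≤ 1 ∧ 1 / 250 ≤ gT t y - y ∧ 1 ≤ gT' t y ∧ gT' t y ≤ 4 := by
  obtain ⟨hy1, hy2⟩ := abs_le.1 hy
  have hyt : y < t := by linarith
  have hP1 : 73 / 100 ≤ gPhi t := gPhi_one_ge.trans (gPhi_strictMono.monotone ht1)
  have hP2 : gPhi t ≤ 1 - 1 / 250 := (gPhi_strictMono.monotone ht2).trans gPhi_two_le
  have hP0 := gPhi_pos t
  have hyu : gPhi y ≤ 1 / 2 + 1 / 2500 := by
    have h1 := gPhi_lip (show (0:ℝ) ≤ 1 / 1000 by norm_num)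
    rw [gPhi_zero] at h1
    have := gPhi_strictMono.monotone hy2
    linarith
  have hyl : 1 / 2 - 1 / 2500 ≤ gPhi y := by
    have h1 := gPhi_lip (show (-(1 / 1000) : ℝ) ≤ 0 by norm_num)
    rw [gPhi_zero] at h1
    have := gPhi_strictMono.monotone hy1
    linarith
  have hT := gPhi_gT hyt
  have hT0 : 0 ≤ gT t y := by
    rw [← gPhi_strictMono.le_iff_le, gPhi_zero, hT, le_div_iff₀ hP0]
    linarith
  have hT1 : gT t y ≤ 1 := by
    rw [← gPhi_strictMono.le_iff_le, hT, div_le_iff₀ hP0]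
    nlinarith [gPhi_one_ge]
  have hTy : 1 / 250 ≤ gT t y - y := by
    have h1 : gPhi y * (1 / 250) ≤ gPhi (gT t y) - gPhi y := by
      rw [hT]
      have : gPhi y * (1 + 1 / 250) ≤ gPhi y / gPhi t := by
        rw [le_div_iff₀ hP0, mul_assoc]
        have : (1 + 1 / 250) * gPhi t ≤ 1 := by nlinarith
        nlinarith [gPhi_pos y]
      linarith
    have hle : y ≤ gT t y := by
      rw [← gPhi_strictMono.le_iff_le]
      nlinarith [gPhi_pos y]
    have h2 := gPhi_lip hle
    linarith
  have hform : gT' t y = Real.exp ((gT t y ^ 2 - y ^ 2) / 2) / gPhi t := by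
    unfold gT' gphi
    rw [show (gT t y ^ 2 - y ^ 2) / 2 = -y ^ 2 / 2 - (-gT t y ^ 2 / 2) by ring, Real.exp_sub]
    field_simp
  refine ⟨hT0, hT1, hTy, ?_, ?_⟩
  · rw [hform, le_div_iff₀ hP0, one_mul]
    have := Real.add_one_le_exp ((gT t y ^ 2 - y ^ 2) / 2)
    have h3 : y ^ 2 ≤ (1/1000) ^ 2 := by rw [← sq_abs]; gcongr
    have h4 : 0 ≤ gT t y ^ 2 := sq_nonneg _
    linarith
  · rw [hform, div_le_iff₀ hP0]
    have h1 : (gT t y ^ 2 - y ^ 2) / 2 ≤ 1 := by nlinarith [sq_nonneg y]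
    have h2 := Real.exp_le_exp.2 h1
    have h3 := Real.exp_one_lt_d9
    linarith

lemma gT'_sep_aux {t : ℝ} (ht1 : 1 ≤ t) (ht2 : t ≤ 2) {y z : ℝ} (hy : |y| ≤ 1 / 1000) (hz : |z| ≤ 1 / 1000) (hyz : y ≤ z) :
    (z - y) / 250 ≤ gT' t z - gT' t y := by
  obtain ⟨a0, a1, a2, a3, a4⟩ := gT_region ht1 ht2 hy
  obtain ⟨b0, b1, b2, b3, b4⟩ := gT_region ht1 ht2 hz
  obtain ⟨hy1, hy2⟩ := abs_le.1 hy
  obtain ⟨hz1, hz2⟩ := abs_le.1 hz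
  have hexp : z - y ≤ gT t z - gT t y := by
    have h1 : ∀ x ∈ Icc (-(1/1000) : ℝ) (1/1000), HasDerivAt (gT t) (gT' t x) x :=
      fun x hx => gT_hasDerivAt (by have := hx.2; linarith)
    have h2 : interior (Icc (-(1/1000) : ℝ) (1/1000)) ⊆ Icc (-(1/1000) : ℝ) (1/1000) := interior_subset
    have := Convex.mul_sub_le_image_sub_of_le_deriv (f := gT t) (convex_Icc (-(1/1000) : ℝ) (1/1000))
      (fun x hx => (h1 x hx).continuousAt.continuousWithinAt)
      (fun x hx => (h1 x (interior_subset hx)).differentiableAt.differentiableWithinAt) (C := 1)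
      (fun x hx => by
        rw [(h1 x (interior_subset hx)).deriv]
        exact (gT_region ht1 ht2 (abs_le.2 (h2 hx))).2.2.2.1)
      y ⟨hy1, hy2⟩ z ⟨hz1, hz2⟩ hyz
    linarith
  have e1 := gT_log t y
  have e2 := gT_log t z
  have hL : (z - y) / 250 ≤ Real.log (gT' t z) - Real.log (gT' t y) := by
    have : Real.log (gT' t z) - Real.log (gT' t y)
      = (gT t z - gT t y) * (gT t z + gT t y) / 2 - (z - y) * (z + y) / 2 := by
      linarith [e1, e2]
    rw [this]
    have h2 : (z - y) * (gT t z + gT t y) ≤ (gT t z - gT t y) * (gT t z + gT t y) := by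
      gcongr
    nlinarith
  have h0 : 0 ≤ Real.log (gT' t z) - Real.log (gT' t y) := le_trans (by linarith) hL
  have h3 : Real.log (gT' t z / gT' t y) ≤ gT' t z / gT' t y - 1 :=
    Real.log_le_sub_one_of_pos (div_pos (gT'_pos _ _) (gT'_pos _ _))
  rw [Real.log_div (gT'_pos _ _).ne' (gT'_pos _ _).ne'] at h3
  have h4 : gT' t z / gT' t y - 1 ≤ gT' t z - gT' t y := by
    have hp := gT'_pos t y
    have : 1 ≤ gT' t z / gT' t y := by linarith
    rw [le_div_iff₀ hp] at this
    rw [div_sub_one hp.ne', div_le_iff₀ hp]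
    nlinarith
  linarith

lemma gT'_sep {t : ℝ} (ht1 : 1 ≤ t) (ht2 : t ≤ 2) {y z : ℝ} (hy : |y| ≤ 1 / 1000) (hz : |z| ≤ 1 / 1000) :
    (y - z) ^ 2 / 62500 ≤ (gT' t y - gT' t z) ^ 2 := by
  rcases le_total y z with h | h
  · have := gT'_sep_aux ht1 ht2 hy hz h
    nlinarith [mul_self_le_mul_self (by linarith) this]
  · have := gT'_sep_aux ht1 ht2 hz hy h
    nlinarith [mul_self_le_mul_self (by linarith) this]

end Part2

section Part3

set_option linter.unusedSectionVars false

section BL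
variable {E : Type*} [NormedAddCommGroup E] [InnerProductSpace ℝ E] [FiniteDimensional ℝ E]
  [MeasurableSpace E] [BorelSpace E]

/-- the Gaussian density on a Euclidean space -/
def gd (x : E) : ℝ := (2 * Real.pi) ^ (-(Module.finrank ℝ E : ℝ) / 2) * Real.exp (-‖x‖ ^ 2 / 2)

lemma gd_pos (x : E) : 0 < gd x := by unfold gd; positivity

lemma gd_cont : Continuous (gd : E → ℝ) := by unfold gd; fun_prop

lemma gd_charInt (t : E) : ∫ x : E, (gd x : ℂ) * Complex.exp (⟪x, t⟫ * Complex.I)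
    = Complex.exp (-‖t‖ ^ 2 / 2) := by
  have h := GaussianFourier.integral_cexp_neg_mul_sq_norm_add (V := E) (b := 1 / 2) (by norm_num)
    Complex.I t
  have h1 : ∀ x : E, (gd x : ℂ) * Complex.exp (⟪x, t⟫ * Complex.I)
      = ((2 * Real.pi) ^ (-(Module.finrank ℝ E : ℝ) / 2) : ℝ) *
        Complex.exp (-(1 / 2) * ‖x‖ ^ 2 + Complex.I * ⟪t, x⟫) := by
    intro x
    unfold gd
    push_cast
    rw [mul_assoc, ← Complex.exp_add, real_inner_comm]
    congr 2
    ring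
  simp_rw [h1]
  rw [integral_const_mul, h, ← mul_assoc]
  have h2 : (((2 * Real.pi) ^ (-(Module.finrank ℝ E : ℝ) / 2) : ℝ) : ℂ) *
      (Real.pi / (1 / 2) : ℂ) ^ (Module.finrank ℝ E / 2 : ℂ) = 1 := by
    have : (Real.pi / (1 / 2) : ℂ) ^ (Module.finrank ℝ E / 2 : ℂ)
        = (((2 * Real.pi) ^ ((Module.finrank ℝ E : ℝ) / 2) : ℝ) : ℂ) := by
      rw [Complex.ofReal_cpow (by positivity)]
      push_cast
      congr 1
      ring
    rw [this, ← Complex.ofReal_mul, ← Real.rpow_add (by positivity)]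
    simp [neg_div]
  rw [h2, one_mul]
  congr 1
  simp
  ring

lemma gd_integrable : Integrable (gd : E → ℝ) := by
  have h := GaussianFourier.integrable_cexp_neg_mul_sq_norm_add (V := E) (b := 1 / 2) (by norm_num)
    0 0
  have h2 := h.norm.const_mul ((2 * Real.pi) ^ (-(Module.finrank ℝ E : ℝ) / 2))
  refine h2.congr (Filter.Eventually.of_forall fun x => ?_)
  simp only [gd, Complex.norm_exp]
  congr 2
  have h3 : (-(1 / 2) * (‖x‖ : ℂ) ^ 2 + 0 * ((⟪(0 : E), x⟫ : ℝ) : ℂ))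
      = ((-‖x‖ ^ 2 / 2 : ℝ) : ℂ) := by
    push_cast
    ring
  rw [h3, Complex.ofReal_re]

lemma gd_integral : ∫ x : E, gd x = 1 := by
  have := gd_charInt (0 : E)
  simp only [inner_zero_right, Complex.ofReal_zero, zero_mul, Complex.exp_zero, mul_one] at this
  rw [integral_complex_ofReal] at this
  simpa using this

lemma stdGaussian_eq_gd : ProbabilityTheory.stdGaussian E
    = volume.withDensity fun x : E => ENNReal.ofReal (gd x) := by
  have hfin : IsFiniteMeasure (volume.withDensity fun x : E => ENNReal.ofReal (gd x)) :=
    isFiniteMeasure_withDensity_ofReal gd_integrable.2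
  apply Measure.ext_of_charFun
  ext t
  rw [ProbabilityTheory.charFun_stdGaussian, charFun_apply,
    integral_withDensity_eq_integral_toReal_smul (by
      exact (gd_cont.measurable).ennreal_ofReal) (by simp), ← gd_charInt]
  refine integral_congr_ae (Filter.Eventually.of_forall fun x => ?_)
  simp only
  rw [ENNReal.toReal_ofReal (gd_pos x).le, Complex.real_smul]

lemma stdGaussian_real_apply {s : Set E} (hs : MeasurableSet s) :
    (ProbabilityTheory.stdGaussian E).real s = ∫ x in s, gd x := by
  rw [stdGaussian_eq_gd, measureReal_def, withDensity_apply _ hs,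
    ← ofReal_integral_eq_lintegral_ofReal gd_integrable.integrableOn
      (Filter.Eventually.of_forall fun x => (gd_pos x).le),
    ENNReal.toReal_ofReal (integral_nonneg fun x => (gd_pos x).le)]

variable {ι : Type*} [Fintype ι]

/-- the transport map -/
def lS (v : ι → E) (c : ι → ℝ) (t : ℝ) (x : E) : E := ∑ i, (c i * gT t ⟪v i, x⟫) • v i

/-- its derivative -/
def lS' (v : ι → E) (c : ι → ℝ) (t : ℝ) (x : E) : E →L[ℝ] E :=
  ∑ i, (c i * gT' t ⟪v i, x⟫) • (innerSL ℝ (v i)).smulRight (v i)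

/-- the polyhedral set -/
def lC (v : ι → E) (t : ℝ) : Set E := {x | ∀ i, ⟪v i, x⟫ < t}

lemma lC_meas (v : ι → E) (t : ℝ) : MeasurableSet (lC v t) := by
  have : lC v t = ⋂ i, {x | ⟪v i, x⟫ < t} := by ext; simp [lC]
  rw [this]
  exact MeasurableSet.iInter fun i => (isOpen_lt (by fun_prop) (by fun_prop)).measurableSet

lemma lS_hasFDerivAt (v : ι → E) (c : ι → ℝ) (t : ℝ) {x : E} (hx : x ∈ lC v t) :
    HasFDerivAt (lS v c t) (lS' v c t x) x := by
  unfold lS lS'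
  apply HasFDerivAt.fun_sum
  intro i _
  have h1 : HasFDerivAt (fun x : E => ⟪v i, x⟫) (innerSL ℝ (v i)) x :=
    (innerSL ℝ (v i)).hasFDerivAt
  have h2 := ((gT_hasDerivAt (hx i)).comp_hasFDerivAt x h1).const_mul (c i)
  have h3 := h2.smul_const (v i)
  have h4 : (c i * gT' t ⟪v i, x⟫) • (innerSL ℝ (v i)).smulRight (v i)
      = (c i • gT' t ⟪v i, x⟫ • innerSL ℝ (v i)).smulRight (v i) :=
    ContinuousLinearMap.ext fun y => by simp [smul_smul, mul_assoc]
  rw [h4]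
  exact h3

lemma lS_injOn {v : ι → E} {c : ι → ℝ} (hc : ∀ i, 0 ≤ c i)
    (hF : ∀ x, ∑ i, c i * ⟪v i, x⟫ ^ 2 = ‖x‖ ^ 2) (t : ℝ) : InjOn (lS v c t) (lC v t) := by
  intro x hx y hy hxy
  have h0 : ∑ i, c i * ((gT t ⟪v i, x⟫ - gT t ⟪v i, y⟫) * (⟪v i, x⟫ - ⟪v i, y⟫)) = 0 := by
    have h1 : ⟪lS v c t x - lS v c t y, x - y⟫ = 0 := by rw [hxy, sub_self, inner_zero_left]
    rw [← h1]
    unfold lS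
    rw [← Finset.sum_sub_distrib, sum_inner]
    refine Finset.sum_congr rfl fun i _ => ?_
    rw [← sub_smul, real_inner_smul_left, inner_sub_right]; ring
  have hpos : ∀ i, ⟪v i, x⟫ ≠ ⟪v i, y⟫ →
      0 < (gT t ⟪v i, x⟫ - gT t ⟪v i, y⟫) * (⟪v i, x⟫ - ⟪v i, y⟫) := by
    intro i hne
    rcases lt_or_gt_of_ne hne with h | h
    · have := gT_strictMono (hx i) (hy i) h
      exact mul_pos_of_neg_of_neg (by linarith) (by linarith)
    · have := gT_strictMono (hy i) (hx i) h
      exact mul_pos (by linarith) (by linarith)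
  have hnn : ∀ i ∈ Finset.univ,
      0 ≤ c i * ((gT t ⟪v i, x⟫ - gT t ⟪v i, y⟫) * (⟪v i, x⟫ - ⟪v i, y⟫)) := by
    intro i _
    apply mul_nonneg (hc i)
    by_cases h : ⟪v i, x⟫ = ⟪v i, y⟫
    · simp [h]
    · exact (hpos i h).le
  rw [Finset.sum_eq_zero_iff_of_nonneg hnn] at h0
  have h2 : ‖x - y‖ ^ 2 = 0 := by
    rw [← hF]
    refine Finset.sum_eq_zero fun i hi => ?_
    rcases mul_eq_zero.1 (h0 i hi) with h | h
    · simp [h]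
    · have : ⟪v i, x⟫ = ⟪v i, y⟫ := by
        by_contra hne
        exact (hpos i hne).ne' h
      rw [inner_sub_right, this]; simp
  rw [sq_eq_zero_iff, norm_eq_zero, sub_eq_zero] at h2
  exact h2

/-- the weight -/
def lW (v : ι → E) (c : ι → ℝ) (t : ℝ) (x : E) : ℝ := |(lS' v c t x).det| * gd (lS v c t x)

lemma lW_int {v : ι → E} {c : ι → ℝ} (hc : ∀ i, 0 ≤ c i)
    (hF : ∀ x, ∑ i, c i * ⟪v i, x⟫ ^ 2 = ‖x‖ ^ 2) (t : ℝ) :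
    IntegrableOn (lW v c t) (lC v t) ∧ ∫ x in lC v t, lW v c t x ≤ 1 := by
  have hd : ∀ x ∈ lC v t, HasFDerivWithinAt (lS v c t) (lS' v c t x) (lC v t) x :=
    fun x hx => (lS_hasFDerivAt v c t hx).hasFDerivWithinAt
  constructor
  · have := (integrableOn_image_iff_integrableOn_abs_det_fderiv_smul volume (lC_meas v t) hd
      (lS_injOn hc hF t) gd).1 gd_integrable.integrableOn
    exact this
  · have := integral_image_eq_integral_abs_det_fderiv_smul volume (lC_meas v t) hd
      (lS_injOn hc hF t) gd
    simp only [smul_eq_mul] at this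
    change ∫ x in lC v t, |(lS' v c t x).det| * gd (lS v c t x) ≤ 1
    rw [← this, ← gd_integral (E := E)]
    exact setIntegral_le_integral gd_integrable
      (Filter.Eventually.of_forall fun x => (gd_pos x).le)

lemma lW_pointwise {v : ι → E} {c : ι → ℝ} (hc : ∀ i, 0 ≤ c i) (hv : ∀ i, ‖v i‖ = 1)
    (hF : ∀ x, ∑ i, c i * ⟪v i, x⟫ ^ 2 = ‖x‖ ^ 2) (t : ℝ) (x : E) (B : ℝ)
    (hB : ∀ i, gT' t ⟪v i, x⟫ ≤ B) :
    (gd x ≤ gPhi t ^ (Module.finrank ℝ E) * lW v c t x * Real.exp (-((1 / (8 * B ^ 2)) *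
      ∑ i, ∑ j, c i * c j * ⟪v i, v j⟫ ^ 2 * (gT' t ⟪v i, x⟫ - gT' t ⟪v j, x⟫) ^ 2))) ∧
    (∑ i, c i * Real.log (gT' t ⟪v i, x⟫) ≤ Real.log |(lS' v c t x).det|) ∧
      0 < |(lS' v c t x).det| := by
  have hdet := lms_det_ineq hc hv hF (fun i => gT' t ⟪v i, x⟫) B (fun i => gT'_pos _ _) hB
    (lS' v c t x : E →ₗ[ℝ] E) (by
      intro y
      simp [lS', smul_smul])
  obtain ⟨hpos, hlog⟩ := hdet
  change 0 < (lS' v c t x).det at hpos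
  change _ ≤ Real.log ((lS' v c t x).det) at hlog
  have habs : |(lS' v c t x).det| = (lS' v c t x).det := abs_of_pos hpos
  set q := (1 / (8 * B ^ 2)) *
      ∑ i, ∑ j, c i * c j * ⟪v i, v j⟫ ^ 2 * (gT' t ⟪v i, x⟫ - gT' t ⟪v j, x⟫) ^ 2 with hq
  have hq0 : 0 ≤ q := by
    apply mul_nonneg (by positivity)
    refine Finset.sum_nonneg fun i _ => Finset.sum_nonneg fun j _ => ?_
    have := hc i
    have := hc j
    positivity
  refine ⟨?_, by rw [habs]; linarith, by rw [habs]; exact hpos⟩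
  have hbes := lms_frame_bessel hc hF (fun i => gT t ⟪v i, x⟫)
  change ‖lS v c t x‖ ^ 2 ≤ _ at hbes
  have hx : -‖x‖ ^ 2 / 2 = (Module.finrank ℝ E) * Real.log (gPhi t)
      - (∑ i, c i * gT t ⟪v i, x⟫ ^ 2) / 2 + ∑ i, c i * Real.log (gT' t ⟪v i, x⟫) := by
    rw [← hF x, ← lms_frame_trace hv hF, Finset.sum_mul, Finset.sum_div, ← Finset.sum_sub_distrib,
      ← Finset.sum_add_distrib, ← Finset.sum_neg_distrib, Finset.sum_div]
    refine Finset.sum_congr rfl fun i _ => ?_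
    have := gT_log t ⟪v i, x⟫
    have h2 : -(c i * ⟪v i, x⟫ ^ 2) / 2 = c i * (-⟪v i, x⟫ ^ 2 / 2) := by ring
    rw [h2, this]; ring
  unfold lW
  rw [habs]
  unfold gd
  have hle : -‖x‖ ^ 2 / 2 ≤ (Module.finrank ℝ E) * Real.log (gPhi t)
      + Real.log ((lS' v c t x).det) + (-‖lS v c t x‖ ^ 2 / 2) + (-q) := by
    rw [hx]; linarith
  have hexp := Real.exp_le_exp.2 hle
  rw [Real.exp_add, Real.exp_add, Real.exp_add, Real.exp_log hpos, mul_comm (Module.finrank ℝ E : ℝ),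
    ← Real.rpow_def_of_pos (gPhi_pos t), Real.rpow_natCast] at hexp
  have h2p : 0 < (2 * Real.pi) ^ (-(Module.finrank ℝ E : ℝ) / 2) := by positivity
  calc _ ≤ (2 * Real.pi) ^ (-(Module.finrank ℝ E : ℝ) / 2) * _ :=
        mul_le_mul_of_nonneg_left hexp h2p.le
    _ = _ := by ring

/-- Brascamp-Lieb for half-lines -/
lemma lBL {v : ι → E} {c : ι → ℝ} (hc : ∀ i, 0 ≤ c i) (hv : ∀ i, ‖v i‖ = 1)
    (hF : ∀ x, ∑ i, c i * ⟪v i, x⟫ ^ 2 = ‖x‖ ^ 2) (t : ℝ) :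
    (ProbabilityTheory.stdGaussian E).real (lC v t) ≤ gPhi t ^ (Module.finrank ℝ E) := by
  rw [stdGaussian_real_apply (lC_meas v t)]
  obtain ⟨h1, h2⟩ := lW_int hc hF t
  have hP : 0 ≤ gPhi t ^ (Module.finrank ℝ E) := pow_nonneg (gPhi_pos t).le _
  calc ∫ x in lC v t, gd x ≤ ∫ x in lC v t, gPhi t ^ (Module.finrank ℝ E) * lW v c t x := by
        apply setIntegral_mono_on gd_integrable.integrableOn (h1.const_mul _) (lC_meas v t)
        intro x hx
        have h3 := (lW_pointwise hc hv hF t x (∑ i, gT' t ⟪v i, x⟫) (fun i =>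
          Finset.single_le_sum (f := fun i => gT' t ⟪v i, x⟫) (fun i _ => (gT'_pos _ _).le)
            (Finset.mem_univ i))).1
        refine h3.trans ?_
        have hW : 0 ≤ lW v c t x := mul_nonneg (abs_nonneg _) (gd_pos _).le
        apply mul_le_of_le_one_right (mul_nonneg hP hW)
        rw [Real.exp_le_one_iff, neg_nonpos]
        apply mul_nonneg (by positivity)
        refine Finset.sum_nonneg fun i _ => Finset.sum_nonneg fun j _ => ?_
        have := hc i
        have := hc j
        positivity
    _ = gPhi t ^ (Module.finrank ℝ E) * ∫ x in lC v t, lW v c t x := integral_const_mul _ _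
    _ ≤ _ := mul_le_of_le_one_right hP h2

lemma l_ball_sq (a : E) {r : ℝ} (hr : 0 < r) :
    (r * ‖a‖ / 4) ^ 2 * volume.real (ball (0 : E) (r / 4)) ≤ ∫ x in ball (0 : E) r, ⟪a, x⟫ ^ 2 := by
  by_cases ha : a = 0
  · simp [ha]
  have hna : 0 < ‖a‖ := norm_pos_iff.2 ha
  set p : E := (r / 2) • (‖a‖⁻¹ • a) with hp
  have hpn : ‖p‖ = r / 2 := by
    rw [hp, norm_smul, norm_smul, norm_inv, norm_norm, inv_mul_cancel₀ hna.ne', mul_one,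
      Real.norm_of_nonneg (by positivity)]
  have hpa : ⟪a, p⟫ = r / 2 * ‖a‖ := by
    rw [hp, real_inner_smul_right, real_inner_smul_right, real_inner_self_eq_norm_sq]
    field_simp
  have hsub : ball p (r / 4) ⊆ ball (0 : E) r := by
    apply ball_subset_ball'
    rw [dist_zero_right, hpn]; linarith
  have hIntgr : IntegrableOn (fun x : E => ⟪a, x⟫ ^ 2) (ball (0 : E) r) := by
    have : Continuous (fun x : E => ⟪a, x⟫ ^ 2) := by fun_prop
    exact (this.continuousOn.integrableOn_compact (isCompact_closedBall 0 r)).mono_set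
      ball_subset_closedBall
  calc (r * ‖a‖ / 4) ^ 2 * volume.real (ball (0 : E) (r / 4))
      = ∫ x in ball p (r / 4), (r * ‖a‖ / 4) ^ 2 := by
        rw [setIntegral_const, smul_eq_mul, mul_comm]
        congr 1
        rw [measureReal_def, measureReal_def, Measure.addHaar_ball_center volume p (r / 4)]
    _ ≤ ∫ x in ball p (r / 4), ⟪a, x⟫ ^ 2 := by
        apply setIntegral_mono_on (by simp [integrableOn_const_iff, measure_ball_lt_top])
          (hIntgr.mono_set hsub) measurableSet_ball
        intro x hx
        have h1 : |⟪a, x - p⟫| ≤ ‖a‖ * (r / 4) := by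
          refine (abs_real_inner_le_norm a (x - p)).trans ?_
          gcongr
          rw [mem_ball, dist_eq_norm] at hx
          exact hx.le
        have h2 : ⟪a, x⟫ = ⟪a, x - p⟫ + r / 2 * ‖a‖ := by rw [← hpa, inner_sub_right]; ring
        have h3 := (abs_le.1 h1).1
        have h4 : r * ‖a‖ / 4 ≤ ⟪a, x⟫ := by rw [h2]; linarith
        gcongr
    _ ≤ _ := setIntegral_mono_set hIntgr (Filter.Eventually.of_forall fun x => sq_nonneg _)
        (LE.le.eventuallyLE hsub)

/-- the deficit constant -/
def ldelta (m : ℕ) (V : ℝ) : ℝ :=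
  ((2 * Real.pi) ^ (-(m : ℝ) / 2) * Real.exp (-(m : ℝ) / 2)) *
    (1 / (8000000 * (1 + (m : ℝ))) * ((1 / 1000) / 4) ^ 2 * V)

lemma lBL_stab {v : ι → E} {c : ι → ℝ} (hc : ∀ i, 0 ≤ c i) (hv : ∀ i, ‖v i‖ = 1)
    (hF : ∀ x, ∑ i, c i * ⟪v i, x⟫ ^ 2 = ‖x‖ ^ 2) {t : ℝ} (ht1 : 1 ≤ t) (ht2 : t ≤ 2) :
    (ProbabilityTheory.stdGaussian E).real (lC v t) ≤ gPhi t ^ (Module.finrank ℝ E) *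
      (1 - ldelta (Module.finrank ℝ E) (volume.real (ball (0 : E) ((1 / 1000) / 4))) *
        ∑ i, ∑ j, c i * c j * ⟪v i, v j⟫ ^ 2 * ‖v i - v j‖ ^ 2) := by
  set m := Module.finrank ℝ E with hm
  set R := ball (0 : E) (1 / 1000) with hR
  set w0 := ((2 * Real.pi) ^ (-(m : ℝ) / 2) * Real.exp (-(m : ℝ) / 2)) with hw0
  have hw0p : 0 < w0 := by positivity
  have hP : 0 ≤ gPhi t ^ m := pow_nonneg (gPhi_pos t).le _
  set Q : E → ℝ := fun x => 1 / 8000000 *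
    ∑ i, ∑ j, c i * c j * ⟪v i, v j⟫ ^ 2 * ⟪v i - v j, x⟫ ^ 2 with hQ
  have hQc : Continuous Q := by rw [hQ]; fun_prop
  have hQ0 : ∀ x, 0 ≤ Q x := fun x => by
    apply mul_nonneg (by norm_num)
    refine Finset.sum_nonneg fun i _ => Finset.sum_nonneg fun j _ => ?_
    have := hc i
    have := hc j
    positivity
  have hccθ : ∑ i, ∑ j, c i * c j * ⟪v i, v j⟫ ^ 2 = m := by
    rw [hm, ← lms_frame_trace hv hF]
    refine Finset.sum_congr rfl fun i _ => ?_
    have := hF (v i)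
    rw [hv] at this
    calc _ = c i * ∑ j, c j * ⟪v j, v i⟫ ^ 2 := by
          rw [Finset.mul_sum]
          refine Finset.sum_congr rfl fun j _ => ?_
          rw [real_inner_comm]; ring
      _ = _ := by rw [this]; ring
  have hRy : ∀ x ∈ R, ∀ i, |⟪v i, x⟫| ≤ 1 / 1000 := by
    intro x hx i
    rw [hR, mem_ball_zero_iff] at hx
    have := abs_real_inner_le_norm (v i) x
    rw [hv] at this
    linarith
  have hQm : ∀ x ∈ R, Q x ≤ m := by
    intro x hx
    have h1 : ∑ i, ∑ j, c i * c j * ⟪v i, v j⟫ ^ 2 * ⟪v i - v j, x⟫ ^ 2 ≤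
        ∑ i, ∑ j, c i * c j * ⟪v i, v j⟫ ^ 2 * 1 := by
      refine Finset.sum_le_sum fun i _ => Finset.sum_le_sum fun j _ => ?_
      have := hc i
      have := hc j
      apply mul_le_mul_of_nonneg_left _ (by positivity)
      have h1 := abs_le.1 (hRy x hx i)
      have h2 := abs_le.1 (hRy x hx j)
      rw [inner_sub_left, sq_le_one_iff_abs_le_one, abs_le]
      constructor <;> linarith [h1.1, h1.2, h2.1, h2.2]
    simp only [mul_one, hccθ] at h1
    simp only [hQ]
    have : (0:ℝ) ≤ m := Nat.cast_nonneg m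
    linarith
  have hRC : R ⊆ lC v t := fun x hx i => by
    have := abs_le.1 (hRy x hx i); linarith [this.2]
  obtain ⟨hWi, hW1⟩ := lW_int hc hF t
  -- pointwise on R
  have hptR : ∀ x ∈ R, gd x ≤ gPhi t ^ m * (lW v c t x - w0 / (1 + m) * Q x) := by
    intro x hx
    have hreg := fun i => gT_region ht1 ht2 (hRy x hx i)
    obtain ⟨h1, h2, h3⟩ := lW_pointwise hc hv hF t x 4 (fun i => (hreg i).2.2.2.2)
    have hWw : w0 ≤ lW v c t x := by
      have hdet1 : 1 ≤ |(lS' v c t x).det| := by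
        rw [← Real.log_nonneg_iff h3]
        refine le_trans ?_ h2
        exact Finset.sum_nonneg fun i _ => mul_nonneg (hc i) (Real.log_nonneg (hreg i).2.2.2.1)
      have hbes := lms_frame_bessel hc hF (fun i => gT t ⟪v i, x⟫)
      change ‖lS v c t x‖ ^ 2 ≤ _ at hbes
      have hSm : ‖lS v c t x‖ ^ 2 ≤ m := by
        refine hbes.trans ?_
        rw [hm, ← lms_frame_trace hv hF]
        refine Finset.sum_le_sum fun i _ => ?_
        apply mul_le_of_le_one_right (hc i)
        exact pow_le_one₀ (hreg i).1 (hreg i).2.1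
      have : w0 ≤ gd (lS v c t x) := by
        unfold gd
        rw [hw0, ← hm]
        gcongr
      unfold lW
      nlinarith [gd_pos (lS v c t x)]
    have hqQ : Q x ≤ (1 / (8 * (4:ℝ) ^ 2)) *
      ∑ i, ∑ j, c i * c j * ⟪v i, v j⟫ ^ 2 * (gT' t ⟪v i, x⟫ - gT' t ⟪v j, x⟫) ^ 2 := by
      simp only [hQ]
      rw [show (1 / 8000000 : ℝ) = (1 / (8 * (4:ℝ) ^ 2)) * (1 / 62500) by norm_num, mul_assoc]
      apply mul_le_mul_of_nonneg_left _ (by norm_num)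
      rw [Finset.mul_sum]
      refine Finset.sum_le_sum fun i _ => ?_
      rw [Finset.mul_sum]
      refine Finset.sum_le_sum fun j _ => ?_
      have := hc i
      have := hc j
      have hs := gT'_sep ht1 ht2 (hRy x hx i) (hRy x hx j)
      rw [inner_sub_left]
      calc _ = c i * c j * ⟪v i, v j⟫ ^ 2 * ((⟪v i, x⟫ - ⟪v j, x⟫) ^ 2 / 62500) := by ring
        _ ≤ _ := mul_le_mul_of_nonneg_left hs (by positivity)
    have hexp : Real.exp (-((1 / (8 * (4:ℝ) ^ 2)) *
      ∑ i, ∑ j, c i * c j * ⟪v i, v j⟫ ^ 2 * (gT' t ⟪v i, x⟫ - gT' t ⟪v j, x⟫) ^ 2))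
        ≤ 1 - Q x / (1 + m) := by
      refine (Real.exp_le_exp.2 (neg_le_neg hqQ)).trans ?_
      have h5 : Real.exp (-Q x) ≤ (1 + Q x)⁻¹ := by
        rw [Real.exp_neg]
        gcongr
        · linarith [hQ0 x]
        · linarith [Real.add_one_le_exp (Q x)]
      refine h5.trans ?_
      have hq := hQ0 x
      have h6 : Q x / (1 + m) ≤ Q x / (1 + Q x) := by
        gcongr
        exact hQm x hx
      have h7 : (1 + Q x)⁻¹ = 1 - Q x / (1 + Q x) := by field_simp; ring
      rw [h7]; linarith
    have hW0 : 0 ≤ lW v c t x := hw0p.le.trans hWw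
    calc gd x ≤ gPhi t ^ m * lW v c t x * (1 - Q x / (1 + m)) :=
          h1.trans (mul_le_mul_of_nonneg_left hexp (mul_nonneg hP hW0))
      _ = gPhi t ^ m * (lW v c t x - lW v c t x * (Q x / (1 + m))) := by ring
      _ ≤ gPhi t ^ m * (lW v c t x - w0 * (Q x / (1 + m))) := by
          have := hQ0 x
          gcongr
      _ = _ := by ring
  have hptC : ∀ x ∈ lC v t, gd x ≤ gPhi t ^ m *
      (lW v c t x - R.indicator (fun x => w0 / (1 + m) * Q x) x) := by
    intro x hx
    by_cases hxR : x ∈ R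
    · rw [indicator_of_mem hxR]; exact hptR x hxR
    · rw [indicator_of_notMem hxR, sub_zero]
      have h3 := (lW_pointwise hc hv hF t x (∑ i, gT' t ⟪v i, x⟫) (fun i =>
          Finset.single_le_sum (f := fun i => gT' t ⟪v i, x⟫) (fun i _ => (gT'_pos _ _).le)
            (Finset.mem_univ i))).1
      refine h3.trans ?_
      have hW : 0 ≤ lW v c t x := mul_nonneg (abs_nonneg _) (gd_pos _).le
      apply mul_le_of_le_one_right (mul_nonneg hP hW)
      rw [Real.exp_le_one_iff, neg_nonpos]
      apply mul_nonneg (by positivity)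
      refine Finset.sum_nonneg fun i _ => Finset.sum_nonneg fun j _ => ?_
      have := hc i
      have := hc j
      positivity
  have hQR : IntegrableOn (fun x => w0 / (1 + m) * Q x) R :=
    ((continuous_const.mul hQc).continuousOn.integrableOn_compact
      (isCompact_closedBall 0 (1/1000))).mono_set ball_subset_closedBall
  have hind : Integrable (R.indicator (fun x => w0 / (1 + m) * Q x)) :=
    (integrable_indicator_iff measurableSet_ball).2 hQR
  have hIntgr : ∫ x in lC v t, R.indicator (fun x => w0 / (1 + m) * Q x) x
      = w0 / (1 + m) * ∫ x in R, Q x := by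
    rw [setIntegral_indicator measurableSet_ball, inter_eq_self_of_subset_right hRC,
      integral_const_mul]
  have hmain : ∫ x in R, Q x ≥ 1 / 8000000 * ∑ i, ∑ j, c i * c j * ⟪v i, v j⟫ ^ 2 *
      ((1 / 1000 * ‖v i - v j‖ / 4) ^ 2 * volume.real (ball (0 : E) ((1/1000) / 4))) := by
    simp only [hQ]
    have hI : ∀ i j, IntegrableOn (fun x => c i * c j * ⟪v i, v j⟫ ^ 2 * ⟪v i - v j, x⟫ ^ 2) R :=
      fun i j => ((show Continuous (fun x => c i * c j * ⟪v i, v j⟫ ^ 2 * ⟪v i - v j, x⟫ ^ 2) by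
        fun_prop).continuousOn.integrableOn_compact
        (isCompact_closedBall 0 (1/1000))).mono_set ball_subset_closedBall
    rw [integral_const_mul, integral_finsetSum _ (fun i _ => integrable_finsetSum _ fun j _ => hI i j)]
    apply mul_le_mul_of_nonneg_left _ (by norm_num)
    refine Finset.sum_le_sum fun i _ => ?_
    rw [integral_finsetSum _ (fun j _ => hI i j)]
    refine Finset.sum_le_sum fun j _ => ?_
    rw [integral_const_mul]
    have := hc i
    have := hc j
    exact mul_le_mul_of_nonneg_left (l_ball_sq (v i - v j) (by norm_num)) (by positivity)
  rw [stdGaussian_real_apply (lC_meas v t)]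
  calc ∫ x in lC v t, gd x
      ≤ ∫ x in lC v t, gPhi t ^ m *
        (lW v c t x - R.indicator (fun x => w0 / (1 + m) * Q x) x) := by
        exact setIntegral_mono_on gd_integrable.integrableOn
          ((hWi.sub hind.integrableOn).const_mul _) (lC_meas v t) hptC
    _ = gPhi t ^ m * ((∫ x in lC v t, lW v c t x) - w0 / (1 + m) * ∫ x in R, Q x) := by
        rw [integral_const_mul, integral_sub hWi hind.integrableOn, hIntgr]
    _ ≤ gPhi t ^ m * (1 - w0 / (1 + m) * (1 / 8000000 * ∑ i, ∑ j, c i * c j * ⟪v i, v j⟫ ^ 2 *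
      ((1 / 1000 * ‖v i - v j‖ / 4) ^ 2 * volume.real (ball (0 : E) ((1/1000) / 4))))) := by
        gcongr
    _ = _ := by
        congr 2
        unfold ldelta
        simp only [Finset.mul_sum, ← hw0]
        refine Finset.sum_congr rfl fun i _ => Finset.sum_congr rfl fun j _ => ?_
        field_simp

end BL

end Part3

section Part4

lemma lms_convexHull_compact {V : Type*} [NormedAddCommGroup V] [NormedSpace ℝ V]
    [FiniteDimensional ℝ V] {S : Set V} (hS : IsCompact S) : IsCompact (convexHull ℝ S) := by
  rcases S.eq_empty_or_nonempty with rfl | ⟨s0, hs0⟩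
  · simp
  set d := Module.finrank ℝ V
  let F : (Fin (d + 1) → ℝ) × (Fin (d + 1) → V) → V := fun q => ∑ i, q.1 i • q.2 i
  have hF : Continuous F := by fun_prop
  have hc : IsCompact (stdSimplex ℝ (Fin (d + 1)) ×ˢ Set.pi univ (fun _ : Fin (d + 1) => S)) :=
    (isCompact_stdSimplex ℝ _).prod (isCompact_univ_pi fun _ => hS)
  have himg : convexHull ℝ S = F '' (stdSimplex ℝ (Fin (d + 1)) ×ˢ
      Set.pi univ (fun _ : Fin (d + 1) => S)) := by
    apply Subset.antisymm
    · intro x hx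
      obtain ⟨ι, hι, z, w, hz, haff, hw, hw1, hx⟩ := eq_pos_convex_span_of_mem_convexHull hx
      have hcard : Fintype.card ι ≤ Fintype.card (Fin (d + 1)) := by
        rw [Fintype.card_fin]
        exact haff.card_le_finrank_succ.trans (Nat.succ_le_succ (Submodule.finrank_le _))
      obtain ⟨e⟩ := Function.Embedding.nonempty_of_card_le hcard
      refine ⟨(fun k => ∑ i, if e i = k then w i else 0,
        fun k => if h : ∃ i, e i = k then z h.choose else s0), ⟨⟨?_, ?_⟩, ?_⟩, ?_⟩
      · intro k
        exact Finset.sum_nonneg fun i _ => by split_ifs; exacts [(hw i).le, le_rfl]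
      · simp only
        rw [Finset.sum_comm]
        simpa using hw1
      · intro k _
        simp only
        split_ifs with h
        · exact hz (mem_range_self _)
        · exact hs0
      · simp only [F, Finset.sum_smul]
        rw [Finset.sum_comm, ← hx]
        refine Finset.sum_congr rfl fun i _ => ?_
        rw [Finset.sum_eq_single (e i)]
        · have h : ∃ j, e j = e i := ⟨i, rfl⟩
          rw [if_pos rfl, dif_pos h, e.injective h.choose_spec]
        · intro k _ hk
          rw [if_neg (Ne.symm hk), zero_smul]
        · simp
    · rintro _ ⟨q, ⟨⟨h1, h2⟩, h3⟩, rfl⟩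
      exact mem_convexHull_of_exists_fintype q.1 q.2 h1 h2 (fun i => h3 i (mem_univ i)) rfl
  rw [himg]
  exact hc.image hF

lemma lms_det_gt {n : ℕ} (C : EuclideanSpace ℝ (Fin n) →ₗ[ℝ] EuclideanSpace ℝ (Fin n))
    (hC : 0 < LinearMap.trace ℝ _ C) :
    ∀ᶠ s in nhdsWithin (0:ℝ) (Ioi 0), 1 < LinearMap.det (1 + s • C) := by
  set b := (EuclideanSpace.basisFun (Fin n) ℝ).toBasis
  set M := LinearMap.toMatrix b b C with hM
  have hdet : ∀ s : ℝ, LinearMap.det (1 + s • C) = (1 + s • M).det := by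
    intro s
    rw [← LinearMap.det_toMatrix b, map_add, map_smul, LinearMap.toMatrix_one]
  have htr : LinearMap.trace ℝ _ C = M.trace := LinearMap.trace_eq_matrix_trace ℝ b C
  rw [htr] at hC
  set q := (Matrix.det (1 + (Polynomial.X : Polynomial ℝ) • M.map Polynomial.C)).divX.divX
  have hcont : Filter.Tendsto (fun s : ℝ => M.trace + q.eval s * s) (nhdsWithin 0 (Ioi 0))
      (nhds M.trace) := by
    have : Continuous (fun s : ℝ => M.trace + q.eval s * s) := by fun_prop
    have h := this.tendsto 0
    simp only [mul_zero, add_zero] at h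
    exact h.mono_left nhdsWithin_le_nhds
  filter_upwards [hcont.eventually (lt_mem_nhds hC), self_mem_nhdsWithin] with s hs hs0
  have hs0' : 0 < s := hs0
  rw [hdet, Matrix.det_one_add_smul]
  change 1 < 1 + M.trace * s + q.eval s * s ^ 2
  nlinarith [mul_pos hs hs0']

lemma lms_john_step {n : ℕ} (K : Set (EuclideanSpace ℝ (Fin n))) (hK : IsCompact K)
    (hL : IsLoewnerEllipsoid (closedBall (0 : EuclideanSpace ℝ (Fin n)) 1) K)
    (hne : K.Nonempty)
    (C : EuclideanSpace ℝ (Fin n) →ₗ[ℝ] EuclideanSpace ℝ (Fin n)) (a : EuclideanSpace ℝ (Fin n))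
    (hC : 0 < LinearMap.trace ℝ _ C) :
    ∃ u ∈ K, ‖u‖ = 1 ∧ 0 ≤ ⟪u, C u + a⟫ := by
  by_contra hcon
  push Not at hcon
  have hKB : ∀ x ∈ K, ‖x‖ ≤ 1 := fun x hx => by simpa using hL.2.1 hx
  have hCc : Continuous C := C.continuous_of_finiteDimensional
  have hG : Continuous fun x => max (1 - ‖x‖ ^ 2) (-⟪x, C x + a⟫) := by fun_prop
  obtain ⟨x0, hx0, hmin⟩ := hK.exists_isMinOn hne hG.continuousOn
  set δ := max (1 - ‖x0‖ ^ 2) (-⟪x0, C x0 + a⟫) with hδ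
  have hδ0 : 0 < δ := by
    rcases (hKB x0 hx0).lt_or_eq with h | h
    · apply lt_max_of_lt_left
      nlinarith [norm_nonneg x0]
    · apply lt_max_of_lt_right
      linarith [hcon x0 hx0 h]
  obtain ⟨x1, hx1, hmax⟩ := hK.exists_isMaxOn hne
    (show Continuous fun x => ‖C x + a‖ by fun_prop).continuousOn
  set L := ‖C x1 + a‖
  have hL0 : 0 ≤ L := norm_nonneg _
  have h1 : ∀ᶠ s in nhdsWithin (0:ℝ) (Ioi 0), 2 * s * L + s ^ 2 * L ^ 2 < δ := by
    have h := (show Continuous fun s : ℝ => 2 * s * L + s ^ 2 * L ^ 2 by fun_prop).tendsto 0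
    simp only [mul_zero, zero_mul, add_zero, ne_eq, OfNat.ofNat_ne_zero, not_false_eq_true,
      zero_pow] at h
    exact (h.mono_left nhdsWithin_le_nhds).eventually (gt_mem_nhds hδ0)
  have h2 : ∀ᶠ s in nhdsWithin (0:ℝ) (Ioi 0), s * L ^ 2 < 2 * δ := by
    have h := (show Continuous fun s : ℝ => s * L ^ 2 by fun_prop).tendsto 0
    simp only [zero_mul] at h
    exact (h.mono_left nhdsWithin_le_nhds).eventually (gt_mem_nhds (by linarith))
  obtain ⟨s, h1, h2, h3, hs0⟩ :=
    (h1.and (h2.and ((lms_det_gt C hC).and self_mem_nhdsWithin))).exists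
  have hs0 : 0 < s := hs0
  set g := (1 + s • C) with hg
  have hdet : LinearMap.det g ≠ 0 := by linarith
  have hin : ∀ x ∈ K, ‖g x + s • a‖ ≤ 1 := by
    intro x hx
    have e : g x + s • a = x + s • (C x + a) := by simp [hg, add_assoc]
    rw [e, ← sq_le_one_iff₀ (norm_nonneg _), norm_add_sq_real, real_inner_smul_right, norm_smul,
      Real.norm_of_nonneg hs0.le]
    have hLx : ‖C x + a‖ ≤ L := hmax hx
    have hin : ⟪x, C x + a⟫ ≤ L := by
      refine (real_inner_le_norm _ _).trans ?_
      nlinarith [hKB x hx, norm_nonneg x, norm_nonneg (C x + a)]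
    have hsq : (s * ‖C x + a‖) ^ 2 ≤ s ^ 2 * L ^ 2 := by
      rw [mul_pow]; gcongr
    have hx1 : ‖x‖ ^ 2 ≤ 1 := by nlinarith [hKB x hx, norm_nonneg x]
    rcases le_max_iff.1 (show δ ≤ max (1 - ‖x‖ ^ 2) (-⟪x, C x + a⟫) from hmin hx) with h | h
    · nlinarith
    · nlinarith
  set A : EuclideanSpace ℝ (Fin n) ≃ᵃ[ℝ] EuclideanSpace ℝ (Fin n) :=
    (g.equivOfDetNeZero hdet).toAffineEquiv.trans (AffineEquiv.constVAdd ℝ _ (s • a)) with hA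
  have hAx : ∀ x, A x = g x + s • a := by
    intro x
    simp [hA, add_comm]
  have hpre : A.symm '' closedBall 0 1 = g ⁻¹' closedBall (-(s • a)) 1 := by
    ext x
    constructor
    · rintro ⟨y, hy, rfl⟩
      have := hAx (A.symm y)
      rw [AffineEquiv.apply_symm_apply] at this
      rw [mem_preimage, mem_closedBall, dist_eq_norm, sub_neg_eq_add, ← this]
      simpa using hy
    · intro hx
      refine ⟨A x, ?_, by simp⟩
      rw [mem_preimage, mem_closedBall, dist_eq_norm, sub_neg_eq_add, ← hAx] at hx
      simpa using hx
  have hv := hL.2.2 (A.symm '' closedBall 0 1) ⟨A.symm, rfl⟩ (by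
    rw [hpre]
    intro x hx
    rw [mem_preimage, mem_closedBall, dist_eq_norm, sub_neg_eq_add]
    exact hin x hx)
  rw [hpre, Measure.addHaar_preimage_linearMap _ hdet,
    Measure.addHaar_closedBall_center volume (-(s • a)) 1] at hv
  have hpos : volume (closedBall (0 : EuclideanSpace ℝ (Fin n)) 1) ≠ 0 :=
    (measure_closedBall_pos _ _ one_pos).ne'
  have hfin : volume (closedBall (0 : EuclideanSpace ℝ (Fin n)) 1) ≠ ⊤ :=
    measure_closedBall_lt_top.ne
  have hlt : ENNReal.ofReal |(LinearMap.det g)⁻¹| < 1 := by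
    rw [ENNReal.ofReal_lt_one, abs_of_pos (by positivity)]
    exact inv_lt_one_of_one_lt₀ h3
  have := ENNReal.mul_lt_mul_left hpos hfin hlt
  rw [one_mul] at this
  exact absurd hv (not_le.2 this)

lemma lms_john {n : ℕ} (hn : 1 ≤ n) (K : Set (EuclideanSpace ℝ (Fin n))) (hK : IsCompact K)
    (hL : IsLoewnerEllipsoid (closedBall (0 : EuclideanSpace ℝ (Fin n)) 1) K)
    (hne : K.Nonempty) :
    ∃ (ι : Type) (_ : Fintype ι) (u : ι → EuclideanSpace ℝ (Fin n)) (p : ι → ℝ),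
      (∀ i, u i ∈ K) ∧ (∀ i, ‖u i‖ = 1) ∧ (∀ i, 0 ≤ p i) ∧ ∑ i, p i = 1 ∧
      (∀ x, ∑ i, p i * ⟪u i, x⟫ ^ 2 = ‖x‖ ^ 2 / n) ∧ ∑ i, p i • u i = 0 := by
  let V := (EuclideanSpace ℝ (Fin n) →L[ℝ] EuclideanSpace ℝ (Fin n)) × EuclideanSpace ℝ (Fin n)
  let Ψ : EuclideanSpace ℝ (Fin n) → V := fun u => ((innerSL ℝ u).smulRight u, u)
  have hΨ : Continuous Ψ := by
    refine Continuous.prodMk ?_ continuous_id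
    have h1 : Continuous fun u : EuclideanSpace ℝ (Fin n) => innerSL ℝ u := (innerSL ℝ).continuous
    exact ((ContinuousLinearMap.smulRightL ℝ (EuclideanSpace ℝ (Fin n))
      (EuclideanSpace ℝ (Fin n))).continuous.comp h1).clm_apply continuous_id
  set S := K ∩ sphere 0 1 with hS
  have hSc : IsCompact S := hK.inter_right isClosed_sphere
  have hHc := lms_convexHull_compact (hSc.image hΨ)
  have hn0 : (n : ℝ) ≠ 0 := by positivity
  by_cases hmem : (((n : ℝ)⁻¹ • ContinuousLinearMap.id ℝ _, 0) : V) ∈ convexHull ℝ (Ψ '' S)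
  · obtain ⟨ι, hι, p, z, hp, hp1, hz, hsum⟩ := mem_convexHull_iff_exists_fintype.1 hmem
    choose u hu huz using hz
    refine ⟨ι, hι, u, p, fun i => (hu i).1, fun i => by simpa using (hu i).2, hp, hp1, ?_, ?_⟩
    · intro x
      have h1 := congrArg (fun q : V => ⟪q.1 x, x⟫) hsum
      simp only [← huz, Ψ, Prod.fst_sum, Prod.smul_fst, sum_apply,
        smul_apply, ContinuousLinearMap.smulRight_apply, sum_inner,
        real_inner_smul_left, innerSL_apply_apply, ContinuousLinearMap.id_apply,
        real_inner_self_eq_norm_sq] at h1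
      rw [div_eq_inv_mul, ← h1]
      exact Finset.sum_congr rfl fun i _ => by ring
    · have h1 := congrArg (fun q : V => q.2) hsum
      simpa only [← huz, Ψ, Prod.snd_sum, Prod.smul_snd] using h1
  · exfalso
    obtain ⟨f, s0, hf1, hf2⟩ := geometric_hahn_banach_closed_point (convex_convexHull ℝ _)
      hHc.isClosed hmem
    let e := EuclideanSpace.basisFun (Fin n) ℝ
    let f1 : (EuclideanSpace ℝ (Fin n) →L[ℝ] EuclideanSpace ℝ (Fin n)) →L[ℝ] ℝ :=
      f.comp (ContinuousLinearMap.inl ℝ _ _)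
    let f2 : EuclideanSpace ℝ (Fin n) →L[ℝ] ℝ := f.comp (ContinuousLinearMap.inr ℝ _ _)
    have hf : ∀ A x, f (A, x) = f1 A + f2 x := fun A x => by
      have h : ((A, x) : V) = (A, 0) + (0, x) := by simp
      rw [h, map_add]
      rfl
    let C0 : EuclideanSpace ℝ (Fin n) →ₗ[ℝ] EuclideanSpace ℝ (Fin n) :=
      { toFun := fun x => ∑ j, f1 ((innerSL ℝ x).smulRight (e j)) • e j
        map_add' := by
          intro x y
          rw [← Finset.sum_add_distrib]
          refine Finset.sum_congr rfl fun j _ => ?_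
          rw [← add_smul, ← map_add]
          congr 2
          ext1 z
          simp [inner_add_left, add_smul]
        map_smul' := by
          intro r x
          rw [Finset.smul_sum]
          refine Finset.sum_congr rfl fun j _ => ?_
          rw [RingHom.id_apply, smul_smul, ← smul_eq_mul, ← map_smul f1]
          congr 2
          refine ContinuousLinearMap.ext fun z => ?_
          simp [real_inner_smul_left, smul_smul] }
    have hC0 : ∀ x y, ⟪y, C0 x⟫ = f1 ((innerSL ℝ x).smulRight y) := by
      intro x y
      simp only [C0, LinearMap.coe_mk, AddHom.coe_mk, inner_sum, real_inner_smul_right]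
      have : (innerSL ℝ x).smulRight y = ∑ j, ⟪y, e j⟫ • (innerSL ℝ x).smulRight (e j) := by
        ext1 z
        simp only [ContinuousLinearMap.smulRight_apply, sum_apply,
          smul_apply]
        conv_lhs => rw [← e.sum_repr' y, Finset.smul_sum]
        refine Finset.sum_congr rfl fun j _ => ?_
        rw [smul_smul, smul_smul, real_inner_comm, mul_comm]
      rw [this, map_sum]
      refine Finset.sum_congr rfl fun j _ => ?_
      rw [map_smul, smul_eq_mul, mul_comm]
    have htr : LinearMap.trace ℝ _ C0 = f1 (ContinuousLinearMap.id ℝ _) := by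
      rw [LinearMap.trace_eq_sum_inner C0 e]
      simp_rw [hC0]
      rw [← map_sum]
      congr 1
      ext1 z
      simp only [sum_apply, ContinuousLinearMap.smulRight_apply,
        innerSL_apply_apply, ContinuousLinearMap.id_apply]
      exact e.sum_repr' z
    obtain ⟨a, ha⟩ : ∃ a, ∀ x, f2 x = ⟪a, x⟫ :=
      ⟨(InnerProductSpace.toDual ℝ _).symm f2, fun x => by
        rw [InnerProductSpace.toDual_symm_apply]⟩
    obtain ⟨u, huK, hu1, hu2⟩ := lms_john_step K hK hL hne (C0 - s0 • 1) a (by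
      rw [map_sub, map_smul, htr, LinearMap.trace_one, finrank_euclideanSpace_fin, smul_eq_mul]
      rw [hf, map_smul, map_zero, add_zero, smul_eq_mul] at hf2
      have hnp : (0:ℝ) < n := by positivity
      have := mul_lt_mul_of_pos_right hf2 hnp
      rw [mul_comm ((n:ℝ)⁻¹), mul_assoc, inv_mul_cancel₀ hn0, mul_one] at this
      linarith)
    have h3 := hf1 (Ψ u) (subset_convexHull ℝ _ ⟨u, ⟨huK, by simpa using hu1⟩, rfl⟩)
    simp only [Ψ] at h3
    rw [hf, ← hC0, ha] at h3
    simp only [LinearMap.sub_apply, LinearMap.smul_apply, Module.End.one_apply, inner_add_right,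
      inner_sub_right, real_inner_smul_right, real_inner_self_eq_norm_sq, hu1] at hu2
    rw [real_inner_comm u a] at h3
    linarith

end Part4

section Part5

lemma lms_meas_le_int {Ω : Type*} [MeasurableSpace Ω] {μ : Measure Ω} [IsProbabilityMeasure μ]
    {Z : Ω → ℝ} (hZ : Integrable Z μ) (h0 : ∀ ω, 0 ≤ Z ω) :
    IntegrableOn (fun t => μ.real {ω | t ≤ Z ω}) (Ioi 0) := by
  have hanti : Antitone (fun t => μ.real {ω | t ≤ Z ω}) := fun s t hst =>
    measureReal_mono (fun ω (h : t ≤ Z ω) => hst.trans h)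
  refine ⟨hanti.measurable.aestronglyMeasurable, ?_⟩
  rw [hasFiniteIntegral_iff_ofReal (Filter.Eventually.of_forall fun t => measureReal_nonneg)]
  have key := lintegral_eq_lintegral_meas_le μ (Filter.Eventually.of_forall h0) hZ.aemeasurable
  have hr : ∀ t, ENNReal.ofReal (μ.real {ω | t ≤ Z ω}) = μ {ω | t ≤ Z ω} := fun t => by
    rw [measureReal_def, ENNReal.ofReal_toReal (measure_ne_top _ _)]
  simp_rw [hr]
  rw [← key]
  exact hZ.lintegral_lt_top

lemma lms_meas_lt_int {Ω : Type*} [MeasurableSpace Ω] {μ : Measure Ω} [IsProbabilityMeasure μ]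
    {Z : Ω → ℝ} (hZ : Integrable Z μ) (h0 : ∀ ω, 0 ≤ Z ω) :
    IntegrableOn (fun t => μ.real {ω | t < Z ω}) (Ioi 0) := by
  have hanti : Antitone (fun t => μ.real {ω | t < Z ω}) := fun s t hst =>
    measureReal_mono (fun ω (h : t < Z ω) => hst.trans_lt h)
  refine ⟨hanti.measurable.aestronglyMeasurable, ?_⟩
  rw [hasFiniteIntegral_iff_ofReal (Filter.Eventually.of_forall fun t => measureReal_nonneg)]
  have key := lintegral_eq_lintegral_meas_lt μ (Filter.Eventually.of_forall h0) hZ.aemeasurable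
  have hr : ∀ t, ENNReal.ofReal (μ.real {ω | t < Z ω}) = μ {ω | t < Z ω} := fun t => by
    rw [measureReal_def, ENNReal.ofReal_toReal (measure_ne_top _ _)]
  simp_rw [hr]
  rw [← key]
  exact hZ.lintegral_lt_top

lemma lms_layer {Ω Ω' : Type*} [MeasurableSpace Ω] {μ : Measure Ω} [IsProbabilityMeasure μ]
    [MeasurableSpace Ω'] {ν : Measure Ω'} [IsProbabilityMeasure ν]
    {X : Ω → ℝ} {Y : Ω' → ℝ} (hXm : Measurable X) (hYm : Measurable Y)
    (hX : Integrable X μ) (hY : Integrable Y ν)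
    (h1 : ∀ t, μ.real {ω | X ω < t} ≤ ν.real {ω | Y ω < t}) (δ : ℝ)
    (h2 : ∀ t ∈ Icc (1:ℝ) 2, μ.real {ω | X ω < t} + δ ≤ ν.real {ω | Y ω < t}) :
    ∫ ω, Y ω ∂ν + δ ≤ ∫ ω, X ω ∂μ := by
  have hXp := hX.pos_part
  have hXn := hX.neg_part
  have hYp := hY.pos_part
  have hYn := hY.neg_part
  have cX : ∀ t, μ.real {ω | t ≤ X ω} = 1 - μ.real {ω | X ω < t} := fun t => by
    have : {ω | t ≤ X ω} = {ω | X ω < t}ᶜ := by ext; simp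
    rw [this, probReal_compl_eq_one_sub (measurableSet_lt hXm measurable_const)]
  have cY : ∀ t, ν.real {ω | t ≤ Y ω} = 1 - ν.real {ω | Y ω < t} := fun t => by
    have : {ω | t ≤ Y ω} = {ω | Y ω < t}ᶜ := by ext; simp
    rw [this, probReal_compl_eq_one_sub (measurableSet_lt hYm measurable_const)]
  have eX : ∀ t ∈ Ioi (0:ℝ), μ.real {ω | t ≤ max (X ω) 0} = 1 - μ.real {ω | X ω < t} :=
    fun t ht => by
      rw [← cX]; congr 1; ext ω
      simp only [mem_setOf_eq, le_max_iff, or_iff_left (not_le.2 (show 0 < t from ht))]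
  have eY : ∀ t ∈ Ioi (0:ℝ), ν.real {ω | t ≤ max (Y ω) 0} = 1 - ν.real {ω | Y ω < t} :=
    fun t ht => by
      rw [← cY]; congr 1; ext ω
      simp only [mem_setOf_eq, le_max_iff, or_iff_left (not_le.2 (show 0 < t from ht))]
  have nX : ∀ t ∈ Ioi (0:ℝ), μ.real {ω | t < max (-X ω) 0} = μ.real {ω | X ω < -t} :=
    fun t ht => by
      congr 1; ext ω
      simp only [mem_setOf_eq, lt_max_iff, or_iff_left (not_lt.2 (show 0 ≤ t from le_of_lt ht))]
      exact lt_neg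
  have nY : ∀ t ∈ Ioi (0:ℝ), ν.real {ω | t < max (-Y ω) 0} = ν.real {ω | Y ω < -t} :=
    fun t ht => by
      congr 1; ext ω
      simp only [mem_setOf_eq, lt_max_iff, or_iff_left (not_lt.2 (show 0 ≤ t from le_of_lt ht))]
      exact lt_neg
  have hneg : ∫ ω, max (-X ω) 0 ∂μ ≤ ∫ ω, max (-Y ω) 0 ∂ν := by
    rw [hXn.integral_eq_integral_meas_lt (Filter.Eventually.of_forall fun ω => le_max_right _ _),
      hYn.integral_eq_integral_meas_lt (Filter.Eventually.of_forall fun ω => le_max_right _ _)]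
    refine setIntegral_mono_on (lms_meas_lt_int hXn fun ω => le_max_right _ _)
      (lms_meas_lt_int hYn fun ω => le_max_right _ _) measurableSet_Ioi fun t ht => ?_
    rw [nX t ht, nY t ht]
    exact h1 _
  have hpos : ∫ ω, max (Y ω) 0 ∂ν + δ ≤ ∫ ω, max (X ω) 0 ∂μ := by
    rw [hXp.integral_eq_integral_meas_le (Filter.Eventually.of_forall fun ω => le_max_right _ _),
      hYp.integral_eq_integral_meas_le (Filter.Eventually.of_forall fun ω => le_max_right _ _)]
    have hi : Integrable ((Icc (1:ℝ) 2).indicator (fun _ => δ)) :=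
      (integrable_indicator_iff measurableSet_Icc).2 (by simp)
    have hδ : ∫ t in Ioi (0:ℝ), (Icc (1:ℝ) 2).indicator (fun _ => δ) t = δ := by
      have hsub : Icc (1:ℝ) 2 ⊆ Ioi 0 := fun t ht => lt_of_lt_of_le one_pos ht.1
      rw [setIntegral_indicator measurableSet_Icc, inter_eq_self_of_subset_right hsub,
        setIntegral_const]
      norm_num [measureReal_def]
    conv_lhs => rw [← hδ]
    rw [← integral_add (lms_meas_le_int hYp fun ω => le_max_right _ _) hi.integrableOn]
    refine setIntegral_mono_on ((lms_meas_le_int hYp fun ω => le_max_right _ _).add hi.integrableOn)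
      (lms_meas_le_int hXp fun ω => le_max_right _ _) measurableSet_Ioi fun t ht => ?_
    rw [eX t ht, eY t ht]
    by_cases h : t ∈ Icc (1:ℝ) 2
    · rw [indicator_of_mem h]; linarith [h2 t h]
    · rw [indicator_of_notMem h]; linarith [h1 t]
  have dX : ∫ ω, X ω ∂μ = ∫ ω, max (X ω) 0 ∂μ - ∫ ω, max (-X ω) 0 ∂μ := by
    rw [← integral_sub hXp hXn]
    refine integral_congr_ae (Filter.Eventually.of_forall fun ω => ?_)
    simp only
    rcases le_total (X ω) 0 with h | h
    · rw [max_eq_right h, max_eq_left (by linarith)]; ring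
    · rw [max_eq_left h, max_eq_right (by linarith)]; ring
  have dY : ∫ ω, Y ω ∂ν = ∫ ω, max (Y ω) 0 ∂ν - ∫ ω, max (-Y ω) 0 ∂ν := by
    rw [← integral_sub hYp hYn]
    refine integral_congr_ae (Filter.Eventually.of_forall fun ω => ?_)
    simp only
    rcases le_total (Y ω) 0 with h | h
    · rw [max_eq_right h, max_eq_left (by linarith)]; ring
    · rw [max_eq_left h, max_eq_right (by linarith)]; ring
  rw [dX, dY]; linarith

section G
variable {E : Type*} [NormedAddCommGroup E] [InnerProductSpace ℝ E] [FiniteDimensional ℝ E]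
  [MeasurableSpace E] [BorelSpace E] {ι : Type*} [Fintype ι] [Nonempty ι]

set_option linter.unusedSectionVars false

/-- the maximum of finitely many linear functionals -/
def lM (v : ι → E) (x : E) : ℝ := Finset.univ.sup' Finset.univ_nonempty fun i => ⟪v i, x⟫

lemma lM_lt {v : ι → E} {x : E} {t : ℝ} : lM v x < t ↔ x ∈ lC v t := by
  simp [lM, lC]

lemma lM_le {v : ι → E} {x : E} {t : ℝ} : lM v x ≤ t ↔ ∀ i, ⟪v i, x⟫ ≤ t := by
  simp [lM]

lemma le_lM (v : ι → E) (x : E) (i : ι) : ⟪v i, x⟫ ≤ lM v x := lM_le.1 le_rfl i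

lemma lM_exists (v : ι → E) (x : E) : ∃ i, lM v x = ⟪v i, x⟫ := by
  obtain ⟨i, -, hi⟩ := Finset.exists_mem_eq_sup' (Finset.univ_nonempty (α := ι)) fun i => ⟪v i, x⟫
  exact ⟨i, hi⟩

lemma lM_meas (v : ι → E) : Measurable (lM v) := by
  apply measurable_of_Iio
  intro t
  have : lM v ⁻¹' Iio t = lC v t := by ext x; exact lM_lt
  rw [this]; exact lC_meas v t

lemma lM_abs {v : ι → E} (hv : ∀ i, ‖v i‖ = 1) (x : E) : |lM v x| ≤ ‖x‖ := by
  obtain ⟨i, hi⟩ := lM_exists v x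
  rw [hi]
  have := abs_real_inner_le_norm (v i) x
  rwa [hv, one_mul] at this

lemma lG_norm_int : Integrable (fun x : E => ‖x‖) (ProbabilityTheory.stdGaussian E) :=
  (ProbabilityTheory.IsGaussian.integrable_id).norm

lemma lM_int {v : ι → E} (hv : ∀ i, ‖v i‖ = 1) :
    Integrable (lM v) (ProbabilityTheory.stdGaussian E) :=
  lG_norm_int.mono' (lM_meas v).aestronglyMeasurable
    (Filter.Eventually.of_forall fun x => lM_abs hv x)

lemma lG_norm_le : ∫ x : E, ‖x‖ ∂(ProbabilityTheory.stdGaussian E)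
    ≤ Real.sqrt (Module.finrank ℝ E) := by
  have h2 : MemLp (fun x : E => ‖x‖) 2 (ProbabilityTheory.stdGaussian E) :=
    (ProbabilityTheory.IsGaussian.memLp_two_id).norm
  set b := stdOrthonormalBasis ℝ E
  have hL : ∀ y : E, MemLp (fun x : E => ⟪y, x⟫) 2 (ProbabilityTheory.stdGaussian E) := fun y =>
    (ProbabilityTheory.IsGaussian.memLp_two_id).continuousLinearMap_comp (innerSL ℝ y)
  have hsq : ∫ x : E, ‖x‖ ^ 2 ∂(ProbabilityTheory.stdGaussian E) = Module.finrank ℝ E := by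
    have : ∀ x : E, ‖x‖ ^ 2 = ∑ i, ⟪b i, x⟫ ^ 2 := fun x => (b.sum_sq_inner_right x).symm
    simp_rw [this]
    rw [integral_finsetSum _ fun i _ => (hL (b i)).integrable_sq]
    have : ∀ i, ∫ x : E, ⟪b i, x⟫ ^ 2 ∂(ProbabilityTheory.stdGaussian E) = 1 := by
      intro i
      have h := ProbabilityTheory.variance_dual_stdGaussian (innerSL ℝ (b i))
      rw [ProbabilityTheory.variance_of_integral_eq_zero
        (by exact (innerSL ℝ (b i)).continuous.aemeasurable)
        (ProbabilityTheory.integral_strongDual_stdGaussian _)] at h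
      simpa using h
    simp [this]
  have hv := ProbabilityTheory.variance_nonneg (fun x : E => ‖x‖) (ProbabilityTheory.stdGaussian E)
  rw [ProbabilityTheory.variance_eq_sub h2] at hv
  apply Real.le_sqrt_of_sq_le
  have e : ∫ x : E, ((fun x : E => ‖x‖) ^ 2) x ∂(ProbabilityTheory.stdGaussian E)
    = Module.finrank ℝ E := hsq
  linarith

lemma lG_orth {κ : Type*} [Fintype κ] (b : OrthonormalBasis κ ℝ E) (t : ℝ) :
    (ProbabilityTheory.stdGaussian E).real (lC (fun i => b i) t) = gPhi t ^ (Fintype.card κ) := by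
  rw [ProbabilityTheory.stdGaussian_eq_map_pi_orthonormalBasis b,
    map_measureReal_apply (by fun_prop) (lC_meas _ t)]
  have : (fun x : κ → ℝ => ∑ i, x i • b i) ⁻¹' (lC (fun i => b i) t) = Set.pi univ fun _ => Iio t := by
    ext x
    simp only [mem_preimage, lC, mem_setOf_eq, mem_univ_pi, mem_Iio]
    refine forall_congr' fun i => ?_
    rw [b.orthonormal.inner_right_fintype]
  rw [this, measureReal_def, Measure.pi_pi]
  simp only [gPhi_measure, Finset.prod_const, Finset.card_univ, ENNReal.toReal_pow]
  rw [ENNReal.toReal_ofReal (gPhi_pos t).le]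

lemma lM_compare {v : ι → E} {c : ι → ℝ} (hc : ∀ i, 0 ≤ c i) (hv : ∀ i, ‖v i‖ = 1)
    (hF : ∀ x, ∑ i, c i * ⟪v i, x⟫ ^ 2 = ‖x‖ ^ 2) {κ : Type*} [Fintype κ] [Nonempty κ]
    (b : OrthonormalBasis κ ℝ E) :
    ∫ x, lM (fun i => b i) x ∂(ProbabilityTheory.stdGaussian E) +
      (1 / 2) ^ (Module.finrank ℝ E) *
      (ldelta (Module.finrank ℝ E) (volume.real (ball (0 : E) ((1 / 1000) / 4))) *
        ∑ i, ∑ j, c i * c j * ⟪v i, v j⟫ ^ 2 * ‖v i - v j‖ ^ 2) ≤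
    ∫ x, lM v x ∂(ProbabilityTheory.stdGaussian E) := by
  have hcard : Fintype.card κ = Module.finrank ℝ E :=
    (Module.finrank_eq_card_basis b.toBasis).symm
  have e1 : ∀ t, {x | lM v x < t} = lC v t := fun t => by ext x; exact lM_lt
  have e2 : ∀ t, {x | lM (fun i => b i) x < t} = lC (fun i => b i) t := fun t => by
    ext x; exact lM_lt
  apply lms_layer (lM_meas v) (lM_meas _) (lM_int hv) (lM_int fun i => b.orthonormal.1 i)
  · intro t
    rw [e1, e2, lG_orth, hcard]
    exact lBL hc hv hF t
  · intro t ht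
    rw [e1, e2, lG_orth, hcard]
    have h := lBL_stab hc hv hF ht.1 ht.2
    set D := ldelta (Module.finrank ℝ E) (volume.real (ball (0 : E) ((1 / 1000) / 4))) *
        ∑ i, ∑ j, c i * c j * ⟪v i, v j⟫ ^ 2 * ‖v i - v j‖ ^ 2 with hD
    have hD0 : 0 ≤ D := by
      apply mul_nonneg
      · unfold ldelta; positivity
      · refine Finset.sum_nonneg fun i _ => Finset.sum_nonneg fun j _ => ?_
        have := hc i
        have := hc j
        positivity
    have hΦ : 1 / 2 ≤ gPhi t := by
      rw [← gPhi_zero]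
      exact gPhi_strictMono.monotone (by linarith [ht.1])
    have : (1 / 2 : ℝ) ^ (Module.finrank ℝ E) * D ≤ gPhi t ^ (Module.finrank ℝ E) * D := by
      gcongr
    linarith

end G

end Part5

section Part6

/-- the lift of a vector of `ℝ^n` to `ℝ^n × ℝ` -/
def lLift {n : ℕ} (u : EuclideanSpace ℝ (Fin n)) : WithLp 2 (EuclideanSpace ℝ (Fin n) × ℝ) :=
  WithLp.toLp 2 (Real.sqrt (n / (n + 1)) • u, Real.sqrt (1 / (n + 1)))

lemma lLift_inner {n : ℕ} (u : EuclideanSpace ℝ (Fin n))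
    (x : WithLp 2 (EuclideanSpace ℝ (Fin n) × ℝ)) :
    ⟪lLift u, x⟫ = Real.sqrt (n / (n + 1)) * ⟪u, x.fst⟫ + Real.sqrt (1 / (n + 1)) * x.snd := by
  rw [WithLp.prod_inner_apply]
  simp [lLift, real_inner_smul_left, mul_comm]

lemma lLift_inner_lift {n : ℕ} (u u' : EuclideanSpace ℝ (Fin n)) :
    ⟪lLift u, lLift u'⟫ = (n * ⟪u, u'⟫ + 1) / (n + 1) := by
  rw [lLift_inner]
  have e1 : (lLift u').fst = Real.sqrt (n / (n + 1)) • u' := rfl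
  have e2 : (lLift u').snd = Real.sqrt (1 / (n + 1)) := rfl
  rw [e1, e2, real_inner_smul_right, ← mul_assoc, Real.mul_self_sqrt (by positivity), Real.mul_self_sqrt (by positivity)]
  field_simp

lemma lLift_norm {n : ℕ} {u : EuclideanSpace ℝ (Fin n)} (hu : ‖u‖ = 1) : ‖lLift u‖ = 1 := by
  have h : ‖lLift u‖ ^ 2 = 1 := by
    rw [← real_inner_self_eq_norm_sq, lLift_inner_lift, real_inner_self_eq_norm_sq, hu]
    field_simp
  nlinarith [norm_nonneg (lLift u)]

lemma lLift_frame {n : ℕ} (hn : 1 ≤ n) {ι : Type*} [Fintype ι] {u : ι → EuclideanSpace ℝ (Fin n)}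
    {p : ι → ℝ} (hp1 : ∑ i, p i = 1) (hF : ∀ x, ∑ i, p i * ⟪u i, x⟫ ^ 2 = ‖x‖ ^ 2 / n)
    (h0 : ∑ i, p i • u i = 0) (x : WithLp 2 (EuclideanSpace ℝ (Fin n) × ℝ)) :
    ∑ i, ((n + 1) * p i) * ⟪lLift (u i), x⟫ ^ 2 = ‖x‖ ^ 2 := by
  have hz : ∑ i, p i * ⟪u i, x.fst⟫ = 0 := by
    have := congrArg (fun y => ⟪y, x.fst⟫) h0
    simpa [sum_inner, real_inner_smul_left] using this
  have hn0 : (n:ℝ) ≠ 0 := by positivity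
  set α := Real.sqrt (n / (n + 1)) with hα
  set β := Real.sqrt (1 / (n + 1)) with hβ
  have hα2 : α ^ 2 = n / (n + 1) := Real.sq_sqrt (by positivity)
  have hβ2 : β ^ 2 = 1 / (n + 1) := Real.sq_sqrt (by positivity)
  calc _ = ∑ i, ((n + 1) * α ^ 2 * (p i * ⟪u i, x.fst⟫ ^ 2)
        + 2 * (n + 1) * α * β * x.snd * (p i * ⟪u i, x.fst⟫)
        + (n + 1) * β ^ 2 * x.snd ^ 2 * p i) := by
        refine Finset.sum_congr rfl fun i _ => ?_
        rw [lLift_inner]; ring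
    _ = (n + 1) * α ^ 2 * (‖x.fst‖ ^ 2 / n) + (n + 1) * β ^ 2 * x.snd ^ 2 := by
        rw [Finset.sum_add_distrib, Finset.sum_add_distrib, ← Finset.mul_sum, ← Finset.mul_sum,
          ← Finset.mul_sum, hF, hz, hp1]; ring
    _ = ‖x.fst‖ ^ 2 + ‖x.snd‖ ^ 2 := by
        rw [hα2, hβ2, Real.norm_eq_abs, sq_abs]; field_simp
    _ = _ := (WithLp.prod_norm_sq_eq_of_L2 x).symm

lemma lLift_lM {n : ℕ} {ι : Type*} [Fintype ι] [Nonempty ι] (u : ι → EuclideanSpace ℝ (Fin n))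
    (x : WithLp 2 (EuclideanSpace ℝ (Fin n) × ℝ)) :
    lM (fun i => lLift (u i)) x
      = Real.sqrt (n / (n + 1)) * lM u x.fst + Real.sqrt (1 / (n + 1)) * x.snd := by
  apply le_antisymm
  · rw [lM_le]
    intro i
    rw [lLift_inner]
    gcongr
    exact le_lM u x.fst i
  · obtain ⟨i, hi⟩ := lM_exists u x.fst
    rw [hi, ← lLift_inner]
    exact le_lM (fun i => lLift (u i)) x i

lemma lG_map_fst (n : ℕ) :
    (ProbabilityTheory.stdGaussian (WithLp 2 (EuclideanSpace ℝ (Fin n) × ℝ))).map (fun x => x.fst)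
      = ProbabilityTheory.stdGaussian (EuclideanSpace ℝ (Fin n)) := by
  have hm : Measurable (fun x : WithLp 2 (EuclideanSpace ℝ (Fin n) × ℝ) => x.fst) := by
    have : Continuous (fun x : WithLp 2 (EuclideanSpace ℝ (Fin n) × ℝ) => x.fst) := by fun_prop
    exact this.measurable
  have := Measure.isProbabilityMeasure_map (μ := ProbabilityTheory.stdGaussian
    (WithLp 2 (EuclideanSpace ℝ (Fin n) × ℝ))) hm.aemeasurable
  apply Measure.ext_of_charFun
  ext t
  rw [ProbabilityTheory.charFun_stdGaussian, charFun_apply, integral_map hm.aemeasurable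
    (by
      have : Continuous fun y : EuclideanSpace ℝ (Fin n) => Complex.exp (⟪y, t⟫ * Complex.I) := by
        fun_prop
      exact this.aestronglyMeasurable)]
  have h := ProbabilityTheory.charFun_stdGaussian
    (WithLp.toLp 2 (t, (0:ℝ)) : WithLp 2 (EuclideanSpace ℝ (Fin n) × ℝ))
  rw [charFun_apply] at h
  have hnorm : ‖(WithLp.toLp 2 (t, (0:ℝ)) : WithLp 2 (EuclideanSpace ℝ (Fin n) × ℝ))‖ = ‖t‖ := by
    rw [WithLp.prod_norm_eq_of_L2]; simp
  rw [hnorm] at h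
  rw [← h]
  refine integral_congr_ae (Filter.Eventually.of_forall fun x => ?_)
  simp [WithLp.prod_inner_apply]

lemma lLift_integral {n : ℕ} {ι : Type*} [Fintype ι] [Nonempty ι] {u : ι → EuclideanSpace ℝ (Fin n)}
    (hu : ∀ i, ‖u i‖ = 1) :
    ∫ x, lM (fun i => lLift (u i)) x ∂(ProbabilityTheory.stdGaussian
      (WithLp 2 (EuclideanSpace ℝ (Fin n) × ℝ)))
    = Real.sqrt (n / (n + 1)) * ∫ x, lM u x ∂(ProbabilityTheory.stdGaussian
      (EuclideanSpace ℝ (Fin n))) := by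
  have hm : Measurable (fun x : WithLp 2 (EuclideanSpace ℝ (Fin n) × ℝ) => x.fst) := by
    have : Continuous (fun x : WithLp 2 (EuclideanSpace ℝ (Fin n) × ℝ) => x.fst) := by fun_prop
    exact this.measurable
  have h1 : ∫ x, lM u x ∂(ProbabilityTheory.stdGaussian (EuclideanSpace ℝ (Fin n)))
      = ∫ x, lM u x.fst ∂(ProbabilityTheory.stdGaussian
      (WithLp 2 (EuclideanSpace ℝ (Fin n) × ℝ))) := by
    rw [← lG_map_fst, integral_map hm.aemeasurable (lM_meas u).aestronglyMeasurable]
  have hi1 : Integrable (fun x => lM u x.fst) (ProbabilityTheory.stdGaussian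
      (WithLp 2 (EuclideanSpace ℝ (Fin n) × ℝ))) := by
    have := lM_int hu
    rw [← lG_map_fst] at this
    exact this.comp_measurable hm
  let L : WithLp 2 (EuclideanSpace ℝ (Fin n) × ℝ) →L[ℝ] ℝ :=
    innerSL ℝ (WithLp.toLp 2 (0, (1:ℝ)))
  have hL : ∀ x, L x = x.snd := fun x => by simp [L, WithLp.prod_inner_apply]
  have h2 : ∫ x, x.snd ∂(ProbabilityTheory.stdGaussian
      (WithLp 2 (EuclideanSpace ℝ (Fin n) × ℝ))) = 0 := by
    have := ProbabilityTheory.integral_strongDual_stdGaussian L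
    simpa only [hL] using this
  have hi2 : Integrable (fun x => x.snd) (ProbabilityTheory.stdGaussian
      (WithLp 2 (EuclideanSpace ℝ (Fin n) × ℝ))) := by
    have := L.integrable_comp (ProbabilityTheory.IsGaussian.integrable_id
      (μ := ProbabilityTheory.stdGaussian (WithLp 2 (EuclideanSpace ℝ (Fin n) × ℝ))))
    simpa only [hL, id] using this
  simp_rw [lLift_lM]
  rw [integral_add (hi1.const_mul _) (hi2.const_mul _), integral_const_mul, integral_const_mul,
    h2, h1]
  ring

lemma lLift_finrank (n : ℕ) :
    Module.finrank ℝ (WithLp 2 (EuclideanSpace ℝ (Fin n) × ℝ)) = n + 1 := by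
  rw [LinearEquiv.finrank_eq (WithLp.linearEquiv 2 ℝ (EuclideanSpace ℝ (Fin n) × ℝ))]
  simp

/-- the gap estimate -/
lemma lms_gap {n : ℕ} (hn : 1 ≤ n) {ι : Type*} [Fintype ι] [Nonempty ι]
    {u : ι → EuclideanSpace ℝ (Fin n)}
    {p : ι → ℝ} (hu : ∀ i, ‖u i‖ = 1) (hp : ∀ i, 0 ≤ p i)
    (hp1 : ∑ i, p i = 1) (hF : ∀ x, ∑ i, p i * ⟪u i, x⟫ ^ 2 = ‖x‖ ^ 2 / n)
    (h0 : ∑ i, p i • u i = 0) {w : Fin (n + 1) → EuclideanSpace ℝ (Fin n)} (hw : IsRegVerts w) :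
    (1 / 2) ^ (n + 1) * (ldelta (n + 1) (volume.real
        (ball (0 : WithLp 2 (EuclideanSpace ℝ (Fin n) × ℝ)) ((1 / 1000) / 4))) *
        (2 * ∑ i, ∑ j, ((n + 1) * p i) * ((n + 1) * p j) * ⟪lLift (u i), lLift (u j)⟫ ^ 2 *
          (1 - ⟪lLift (u i), lLift (u j)⟫))) ≤
    Real.sqrt (n / (n + 1)) * (∫ x, lM u x ∂(ProbabilityTheory.stdGaussian
      (EuclideanSpace ℝ (Fin n))) - ∫ x, lM w x ∂(ProbabilityTheory.stdGaussian
      (EuclideanSpace ℝ (Fin n)))) := by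
  have hn0 : (n:ℝ) ≠ 0 := by positivity
  have horth : Orthonormal ℝ fun i => lLift (w i) := by
    refine ⟨fun i => lLift_norm (hw.1 i), fun i j hij => ?_⟩
    change ⟪lLift (w i), lLift (w j)⟫ = 0
    rw [lLift_inner_lift, hw.2 i j hij]
    field_simp
    simp
  let b : OrthonormalBasis (Fin (n + 1)) ℝ (WithLp 2 (EuclideanSpace ℝ (Fin n) × ℝ)) :=
    (basisOfOrthonormalOfCardEqFinrank horth (by rw [lLift_finrank]; simp)).toOrthonormalBasis
      (by rw [coe_basisOfOrthonormalOfCardEqFinrank]; exact horth)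
  have hb : (fun i => b i) = fun i => lLift (w i) := by
    ext1 i; simp [b]
  have h := lM_compare (fun i => mul_nonneg (by positivity) (hp i))
    (fun i => lLift_norm (hu i)) (lLift_frame hn hp1 hF h0) b
  rw [hb, lLift_integral hu, lLift_integral hw.1, lLift_finrank] at h
  have e : ∑ i, ∑ j, ((n + 1) * p i) * ((n + 1) * p j) * ⟪lLift (u i), lLift (u j)⟫ ^ 2 *
      ‖lLift (u i) - lLift (u j)‖ ^ 2 = 2 * ∑ i, ∑ j, ((n + 1) * p i) * ((n + 1) * p j) *
      ⟪lLift (u i), lLift (u j)⟫ ^ 2 * (1 - ⟪lLift (u i), lLift (u j)⟫) := by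
    rw [Finset.mul_sum]
    refine Finset.sum_congr rfl fun i _ => ?_
    rw [Finset.mul_sum]
    refine Finset.sum_congr rfl fun j _ => ?_
    rw [norm_sub_sq_real, lLift_norm (hu i), lLift_norm (hu j)]
    ring
  rw [e] at h
  linarith

end Part6

section Part7

lemma lms_normalize_lip {F : Type*} [NormedAddCommGroup F] [NormedSpace ℝ F] :
    LipschitzOnWith 2 (fun x : F => ‖x‖⁻¹ • x) {x | 1 ≤ ‖x‖} := by
  apply LipschitzOnWith.of_dist_le_mul
  intro x hx y hy
  have hx : 1 ≤ ‖x‖ := hx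
  have hy : 1 ≤ ‖y‖ := hy
  rw [dist_eq_norm, dist_eq_norm]
  have e : ‖x‖⁻¹ • x - ‖y‖⁻¹ • y = ‖x‖⁻¹ • (x - y) + (‖x‖⁻¹ - ‖y‖⁻¹) • y := by
    rw [smul_sub, sub_smul]; abel
  rw [e]
  refine (norm_add_le _ _).trans ?_
  rw [norm_smul, norm_smul, norm_inv, norm_norm, Real.norm_eq_abs]
  have h1 : ‖x‖⁻¹ ≤ 1 := inv_le_one_of_one_le₀ hx
  have h2 : |‖x‖⁻¹ - ‖y‖⁻¹| * ‖y‖ ≤ ‖x - y‖ := by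
    have hx0 : 0 < ‖x‖ := by linarith
    have hy0 : 0 < ‖y‖ := by linarith
    have e2 : ‖x‖⁻¹ - ‖y‖⁻¹ = ‖x‖⁻¹ * (‖y‖ - ‖x‖) * ‖y‖⁻¹ := by field_simp
    rw [e2, abs_mul, abs_mul, abs_of_pos (inv_pos.2 hx0), abs_of_pos (inv_pos.2 hy0), mul_assoc,
      inv_mul_cancel₀ hy0.ne', mul_one]
    have h3 : |‖y‖ - ‖x‖| ≤ ‖x - y‖ := by
      rw [abs_sub_comm]; exact abs_norm_sub_norm_le x y
    nlinarith [abs_nonneg (‖y‖ - ‖x‖)]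
  have := norm_nonneg (x - y)
  push_cast
  nlinarith

/-- the affine parametrization of the face of a cube -/
def lFace (k : ℕ) (i : Fin (k + 1)) (s : ℝ) (y : Fin k → ℝ) : EuclideanSpace ℝ (Fin (k + 1)) :=
  WithLp.toLp 2 (i.insertNth s y)

lemma lFace_lip (k : ℕ) (i : Fin (k + 1)) (s : ℝ) :
    LipschitzWith (Real.toNNReal (Real.sqrt (k + 1))) (lFace k i s) := by
  apply LipschitzWith.of_dist_le_mul
  intro x y
  rw [EuclideanSpace.dist_eq, Real.coe_toNNReal _ (Real.sqrt_nonneg _),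
    ← Real.sqrt_sq (dist_nonneg (x := x) (y := y)), ← Real.sqrt_mul (by positivity)]
  apply Real.sqrt_le_sqrt
  calc _ ≤ ∑ j : Fin (k + 1), dist x y ^ 2 := by
        refine Finset.sum_le_sum fun j _ => ?_
        gcongr
        rcases Fin.eq_self_or_eq_succAbove i j with rfl | ⟨l, rfl⟩
        · simp [lFace]
        · simp only [lFace, Fin.insertNth_apply_succAbove]
          exact dist_le_pi_dist x y l
    _ = _ := by simp

lemma lFace_norm (k : ℕ) (i : Fin (k + 1)) (s : ℝ) (y : Fin k → ℝ) :
    |s| ≤ ‖lFace k i s y‖ := by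
  have := PiLp.norm_apply_le (lFace k i s y) i
  simpa [lFace] using this

lemma lms_sphere_finite (k : ℕ) :
    μH[(k:ℝ)] (sphere (0 : EuclideanSpace ℝ (Fin (k + 1))) 1) < ⊤ := by
  set N : EuclideanSpace ℝ (Fin (k + 1)) → EuclideanSpace ℝ (Fin (k + 1)) := fun x => ‖x‖⁻¹ • x
  set Q : Set (Fin k → ℝ) := closedBall 0 1
  have hsub : sphere (0 : EuclideanSpace ℝ (Fin (k + 1))) 1 ⊆
      ⋃ i : Fin (k + 1), ((fun y => N (lFace k i 1 y)) '' Q ∪ (fun y => N (lFace k i (-1) y)) '' Q) := by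
    intro u hu
    have hu : ‖u‖ = 1 := by simpa using hu
    obtain ⟨i, -, hi⟩ := Finset.exists_max_image Finset.univ (fun i => |u i|) Finset.univ_nonempty
    have hpos : 0 < |u i| := by
      rw [abs_pos]
      intro h0
      have : u = 0 := by
        ext j
        have := hi j (Finset.mem_univ j)
        rw [h0, abs_zero] at this
        simpa using this
      rw [this] at hu; simp at hu
    rw [mem_iUnion]
    refine ⟨i, ?_⟩
    set y : Fin k → ℝ := fun j => u (i.succAbove j) / |u i| with hy
    have hyQ : y ∈ Q := by
      simp only [Q, mem_closedBall_zero_iff]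
      rw [pi_norm_le_iff_of_nonneg zero_le_one]
      intro j
      rw [hy, Real.norm_eq_abs, abs_div, abs_abs, div_le_one hpos]
      exact hi _ (Finset.mem_univ _)
    have key : ∀ s : ℝ, u i = s * |u i| → N (lFace k i s y) = u := by
      intro s hs
      have e : lFace k i s y = |u i|⁻¹ • u := by
        ext j
        rcases Fin.eq_self_or_eq_succAbove i j with rfl | ⟨l, rfl⟩
        · simp only [lFace, Fin.insertNth_apply_same, PiLp.smul_apply, smul_eq_mul]
          rw [eq_comm, inv_mul_eq_div, div_eq_iff hpos.ne']; exact hs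
        · simp only [lFace, Fin.insertNth_apply_succAbove, PiLp.smul_apply, smul_eq_mul, hy]
          field_simp
      simp only [N]
      rw [e, norm_smul, hu, norm_inv, Real.norm_eq_abs, abs_abs, mul_one, inv_inv, smul_smul,
        mul_inv_cancel₀ hpos.ne', one_smul]
    rcases le_total 0 (u i) with h | h
    · left; exact ⟨y, hyQ, key 1 (by rw [abs_of_nonneg h, one_mul])⟩
    · right; exact ⟨y, hyQ, key (-1) (by rw [abs_of_nonpos h]; ring)⟩
  have hfin : ∀ i s, |s| = (1:ℝ) → μH[(k:ℝ)] ((fun y => N (lFace k i s y)) '' Q) < ⊤ := by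
    intro i s hs
    have hl : LipschitzOnWith (2 * Real.toNNReal (Real.sqrt (k + 1)))
        (fun y => N (lFace k i s y)) Q :=
      lms_normalize_lip.comp ((lFace_lip k i s).lipschitzOnWith) (fun y _ => by
        have := lFace_norm k i s y
        rwa [hs] at this)
    refine (hl.hausdorffMeasure_image_le (Nat.cast_nonneg k)).trans_lt ?_
    have hv : μH[(k:ℝ)] Q < ⊤ := by
      have := hausdorffMeasure_pi_real (ι := Fin k)
      rw [Fintype.card_fin] at this
      rw [this]
      exact measure_closedBall_lt_top
    exact ENNReal.mul_lt_top (ENNReal.rpow_lt_top_of_nonneg (Nat.cast_nonneg k) ENNReal.coe_ne_top) hv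
  refine (measure_mono hsub).trans_lt ?_
  refine (measure_iUnion_le _).trans_lt ?_
  rw [tsum_fintype]
  refine ENNReal.sum_lt_top.2 fun i _ => (measure_union_le _ _).trans_lt ?_
  exact ENNReal.add_lt_top.2 ⟨hfin i 1 (by simp), hfin i (-1) (by simp)⟩

lemma lms_sphere_pos (k : ℕ) :
    0 < μH[(k:ℝ)] (sphere (0 : EuclideanSpace ℝ (Fin (k + 1))) 1) := by
  let P : EuclideanSpace ℝ (Fin (k + 1)) → (Fin k → ℝ) := fun x j => x j.succ
  have hP : LipschitzWith 1 P := by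
    apply LipschitzWith.of_dist_le_mul
    intro x y
    rw [NNReal.coe_one, one_mul, dist_pi_le_iff dist_nonneg]
    intro j
    have := PiLp.norm_apply_le (x - y) j.succ
    rw [dist_eq_norm, dist_eq_norm]
    simpa [P] using this
  have hle := hP.hausdorffMeasure_image_le (Nat.cast_nonneg k)
    (sphere (0 : EuclideanSpace ℝ (Fin (k + 1))) 1)
  simp only [ENNReal.coe_one, ENNReal.one_rpow, one_mul] at hle
  refine lt_of_lt_of_le ?_ hle
  have hsub : closedBall (0 : Fin k → ℝ) (1 / (k + 1)) ⊆ P '' sphere 0 1 := by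
    intro y hy
    rw [mem_closedBall_zero_iff, pi_norm_le_iff_of_nonneg (by positivity)] at hy
    have hs : ∑ j, y j ^ 2 ≤ 1 := by
      calc ∑ j, y j ^ 2 ≤ ∑ j : Fin k, (1 / ((k:ℝ) + 1)) := by
            refine Finset.sum_le_sum fun j _ => ?_
            have h1 := hy j
            rw [Real.norm_eq_abs] at h1
            have h2 : (1 / ((k:ℝ) + 1)) ≤ 1 := by
              rw [div_le_one (by positivity)]; linarith [(Nat.cast_nonneg k : (0:ℝ) ≤ k)]
            rw [← sq_abs]
            nlinarith [abs_nonneg (y j)]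
        _ ≤ 1 := by
            simp only [Finset.sum_const, Finset.card_univ, Fintype.card_fin, nsmul_eq_mul]
            rw [mul_one_div, div_le_one (by positivity)]; linarith
    refine ⟨WithLp.toLp 2 (Fin.cons (Real.sqrt (1 - ∑ j, y j ^ 2)) y), ?_, ?_⟩
    · rw [mem_sphere_zero_iff_norm, EuclideanSpace.norm_eq, Fin.sum_univ_succ]
      simp only [Fin.cons_zero, Fin.cons_succ, Real.norm_eq_abs, sq_abs]
      rw [Real.sq_sqrt (by linarith)]
      simp
    · ext j; simp [P]
  refine lt_of_lt_of_le ?_ (measure_mono hsub)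
  have := hausdorffMeasure_pi_real (ι := Fin k)
  rw [Fintype.card_fin] at this
  rw [this]
  exact measure_closedBall_pos _ _ (by positivity)

end Part7

section Part8

section radial
variable {n : ℕ}

lemma lms_charFun_radial {ν : Measure (EuclideanSpace ℝ (Fin n))}
    (hinv : ∀ R : EuclideanSpace ℝ (Fin n) ≃ₗᵢ[ℝ] EuclideanSpace ℝ (Fin n), ν.map R = ν)
    {v w : EuclideanSpace ℝ (Fin n)} (h : ‖v‖ = ‖w‖) : charFun ν v = charFun ν w := by
  set R := Submodule.reflection (ℝ ∙ (v - w))ᗮ with hR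
  have hRv : R v = w := Submodule.reflection_sub h
  rw [← hRv]
  conv_rhs => rw [← hinv R]
  rw [charFun_apply, charFun_apply, integral_map R.continuous.measurable.aemeasurable
    (by fun_prop)]
  simp only [LinearIsometryEquiv.inner_map_map]

lemma lms_radial_map {ν : Measure (EuclideanSpace ℝ (Fin n))} [IsFiniteMeasure ν]
    (hinv : ∀ R : EuclideanSpace ℝ (Fin n) ≃ₗᵢ[ℝ] EuclideanSpace ℝ (Fin n), ν.map R = ν)
    (hS : ∀ᵐ u ∂ν, ‖u‖ = 1) :
    (ν.prod (ProbabilityTheory.stdGaussian (EuclideanSpace ℝ (Fin n)))).map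
      (fun p => ‖p.2‖ • p.1) =
    (ν univ) • ProbabilityTheory.stdGaussian (EuclideanSpace ℝ (Fin n)) := by
  set γ := ProbabilityTheory.stdGaussian (EuclideanSpace ℝ (Fin n)) with hγ
  have : IsFiniteMeasure ((ν univ) • γ) := Measure.smul_finite _ (measure_ne_top _ _)
  have hm : Measurable (fun p : EuclideanSpace ℝ (Fin n) × EuclideanSpace ℝ (Fin n) =>
    ‖p.2‖ • p.1) := by fun_prop
  have hIntgr : ∀ f : EuclideanSpace ℝ (Fin n) × EuclideanSpace ℝ (Fin n) → ℝ, Continuous f →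
      Integrable (fun p => Complex.exp (f p * Complex.I)) (ν.prod γ) := by
    intro f hf
    refine Integrable.of_bound (C := 1) (by fun_prop) ?_
    exact ae_of_all _ fun p => by rw [Complex.norm_exp_ofReal_mul_I]
  apply Measure.ext_of_charFun
  ext ξ
  rw [charFun_apply, integral_map hm.aemeasurable (by fun_prop), integral_prod_symm _ (hIntgr (fun p => ⟪‖p.2‖ • p.1, ξ⟫) (by fun_prop))]
  have e1 : ∀ x : EuclideanSpace ℝ (Fin n), ∫ u, Complex.exp (⟪‖x‖ • u, ξ⟫ * Complex.I) ∂ν =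
      ∫ u, Complex.exp (⟪u, ‖ξ‖ • x⟫ * Complex.I) ∂ν := by
    intro x
    have := lms_charFun_radial hinv (v := ‖x‖ • ξ) (w := ‖ξ‖ • x) (by
      rw [norm_smul, norm_smul, norm_norm, norm_norm, mul_comm])
    rw [charFun_apply, charFun_apply] at this
    rw [← this]
    simp only [real_inner_smul_left, real_inner_smul_right]
  simp only [e1]
  rw [← integral_prod_symm (fun p : EuclideanSpace ℝ (Fin n) × EuclideanSpace ℝ (Fin n) => Complex.exp (⟪p.1, ‖ξ‖ • p.2⟫ * Complex.I)) (hIntgr (fun p => ⟪p.1, ‖ξ‖ • p.2⟫) (by fun_prop)),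
    integral_prod _ (hIntgr (fun p => ⟪p.1, ‖ξ‖ • p.2⟫) (by fun_prop))]
  have e2 : ∀ᵐ u ∂ν, ∫ x, Complex.exp (⟪u, ‖ξ‖ • x⟫ * Complex.I) ∂γ =
      Complex.exp (-‖ξ‖ ^ 2 / 2) := by
    filter_upwards [hS] with u hu
    have := ProbabilityTheory.charFun_stdGaussian (‖ξ‖ • u)
    rw [charFun_apply, norm_smul, hu, norm_norm, mul_one] at this
    rw [← this]
    refine integral_congr_ae (ae_of_all _ fun x => ?_)
    simp only [real_inner_smul_left, real_inner_smul_right, real_inner_comm]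
  rw [integral_congr_ae e2, integral_const, charFun_apply, integral_smul_measure, ← charFun_apply,
    ProbabilityTheory.charFun_stdGaussian]
  rfl

lemma lms_radial_int {ν : Measure (EuclideanSpace ℝ (Fin n))} [IsFiniteMeasure ν]
    (hinv : ∀ R : EuclideanSpace ℝ (Fin n) ≃ₗᵢ[ℝ] EuclideanSpace ℝ (Fin n), ν.map R = ν)
    (hS : ∀ᵐ u ∂ν, ‖u‖ = 1) {h : EuclideanSpace ℝ (Fin n) → ℝ} (hc : Continuous h)
    (hh : ∀ t : ℝ, 0 ≤ t → ∀ x, h (t • x) = t * h x) :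
    (∫ u, h u ∂ν) * (∫ x, ‖x‖ ∂ProbabilityTheory.stdGaussian (EuclideanSpace ℝ (Fin n))) =
      ν.real univ * ∫ x, h x ∂ProbabilityTheory.stdGaussian (EuclideanSpace ℝ (Fin n)) := by
  have hm : Measurable (fun p : EuclideanSpace ℝ (Fin n) × EuclideanSpace ℝ (Fin n) =>
    ‖p.2‖ • p.1) := by fun_prop
  have h1 : ∫ x, h x ∂((ν univ) • ProbabilityTheory.stdGaussian (EuclideanSpace ℝ (Fin n))) =
      ν.real univ * ∫ x, h x ∂ProbabilityTheory.stdGaussian (EuclideanSpace ℝ (Fin n)) := by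
    rw [integral_smul_measure]; rfl
  rw [← h1, ← lms_radial_map hinv hS, integral_map hm.aemeasurable
    hc.aestronglyMeasurable, ← integral_prod_mul]
  refine integral_congr_ae (ae_of_all _ fun p => ?_)
  simp only
  rw [hh _ (norm_nonneg _), mul_comm]

end radial

/-! support functions -/
section supp
variable {n : ℕ} {K L : Set (EuclideanSpace ℝ (Fin n))}

lemma suppFn_bdd (hK : K ⊆ closedBall 0 1) (u : EuclideanSpace ℝ (Fin n)) :
    BddAbove ((fun y => ⟪u, y⟫) '' K) := by
  refine ⟨‖u‖, ?_⟩
  rintro _ ⟨y, hy, rfl⟩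
  have h1 : ‖y‖ ≤ 1 := by simpa using hK hy
  have := real_inner_le_norm u y
  simp only
  nlinarith [norm_nonneg u]

lemma le_suppFn (hK : K ⊆ closedBall 0 1) {y : EuclideanSpace ℝ (Fin n)} (hy : y ∈ K)
    (u : EuclideanSpace ℝ (Fin n)) : ⟪u, y⟫ ≤ suppFn K u :=
  le_csSup (suppFn_bdd hK u) ⟨y, hy, rfl⟩

lemma suppFn_le (hne : K.Nonempty) {u : EuclideanSpace ℝ (Fin n)} {a : ℝ}
    (h : ∀ y ∈ K, ⟪u, y⟫ ≤ a) : suppFn K u ≤ a := by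
  refine csSup_le (hne.image _) ?_
  rintro _ ⟨y, hy, rfl⟩
  exact h y hy

lemma suppFn_lip_aux (hK : K ⊆ closedBall 0 1) (hne : K.Nonempty)
    (u v : EuclideanSpace ℝ (Fin n)) : suppFn K u ≤ suppFn K v + ‖u - v‖ := by
  refine suppFn_le hne fun y hy => ?_
  have h1 := le_suppFn hK hy v
  have h2 : ‖y‖ ≤ 1 := by simpa using hK hy
  have h3 := real_inner_le_norm (u - v) y
  rw [inner_sub_left] at h3
  nlinarith [norm_nonneg (u - v)]

lemma suppFn_cont (hK : K ⊆ closedBall 0 1) (hne : K.Nonempty) :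
    Continuous (suppFn K) := by
  have : LipschitzWith 1 (suppFn K) := by
    apply LipschitzWith.of_le_add
    intro u v
    rw [dist_eq_norm]
    exact suppFn_lip_aux hK hne u v
  exact this.continuous

lemma suppFn_zero (hne : K.Nonempty) : suppFn K 0 = 0 := by
  unfold suppFn
  simp [hne.image_const]

lemma suppFn_smul (hK : K ⊆ closedBall 0 1) (hne : K.Nonempty) (t : ℝ) (ht : 0 ≤ t)
    (u : EuclideanSpace ℝ (Fin n)) : suppFn K (t • u) = t * suppFn K u := by
  unfold suppFn
  rw [← smul_eq_mul, ← Real.sSup_smul_of_nonneg ht]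
  congr 1
  ext x
  simp only [mem_image, mem_smul_set, real_inner_smul_left, smul_eq_mul]
  constructor
  · rintro ⟨y, hy, rfl⟩; exact ⟨_, ⟨y, hy, rfl⟩, rfl⟩
  · rintro ⟨_, ⟨y, hy, rfl⟩, rfl⟩; exact ⟨y, hy, rfl⟩

lemma suppFn_abs (hK : K ⊆ closedBall 0 1) (hne : K.Nonempty)
    (u : EuclideanSpace ℝ (Fin n)) : |suppFn K u| ≤ ‖u‖ := by
  have h1 := suppFn_lip_aux hK hne u 0
  have h2 := suppFn_lip_aux hK hne 0 u
  rw [suppFn_zero hne] at h1 h2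
  rw [abs_le]
  simp only [sub_zero, zero_sub, norm_neg] at h1 h2
  constructor <;> linarith

lemma suppFn_int (hK : K ⊆ closedBall 0 1) (hne : K.Nonempty) :
    Integrable (suppFn K) (ProbabilityTheory.stdGaussian (EuclideanSpace ℝ (Fin n))) := by
  refine lG_norm_int.mono' (suppFn_cont hK hne).aestronglyMeasurable ?_
  exact ae_of_all _ fun x => by rw [Real.norm_eq_abs]; exact suppFn_abs hK hne x

lemma suppFn_lM {ι : Type*} [Fintype ι] [Nonempty ι] {w : ι → EuclideanSpace ℝ (Fin n)}
    (hw : ∀ i, ‖w i‖ = 1) (u : EuclideanSpace ℝ (Fin n)) :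
    suppFn (convexHull ℝ (range w)) u = lM w u := by
  have hsub : convexHull ℝ (range w) ⊆ closedBall 0 1 :=
    convexHull_min (by rintro _ ⟨i, rfl⟩; simp [hw i]) (convex_closedBall _ _)
  have hne : (convexHull ℝ (range w)).Nonempty := (range_nonempty w).convexHull
  apply le_antisymm
  · refine suppFn_le hne fun y hy => ?_
    have hc : Convex ℝ {y : EuclideanSpace ℝ (Fin n) | ⟪u, y⟫ ≤ lM w u} :=
      convex_halfSpace_le (IsLinearMap.mk (fun x y => inner_add_right _ _ _)
        (fun c x => by rw [real_inner_smul_right, smul_eq_mul])) _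
    refine (convexHull_min ?_ hc) hy
    rintro _ ⟨i, rfl⟩
    change ⟪u, w i⟫ ≤ lM w u
    rw [real_inner_comm]
    exact le_lM w u i
  · obtain ⟨i, hi⟩ := lM_exists (v := w) (x := u)
    rw [hi, real_inner_comm]
    exact le_suppFn hsub (subset_convexHull _ _ ⟨i, rfl⟩) u

lemma lms_meanWidth (k : ℕ) : ∃ C : ℝ, 0 < C ∧ ∀ K : Set (EuclideanSpace ℝ (Fin (k + 1))),
    K ⊆ closedBall 0 1 → K.Nonempty → meanWidth (k + 1) K =
      C * ∫ x, suppFn K x ∂ProbabilityTheory.stdGaussian (EuclideanSpace ℝ (Fin (k + 1))) := by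
  set S := sphere (0 : EuclideanSpace ℝ (Fin (k + 1))) 1 with hSdef
  set ν : Measure (EuclideanSpace ℝ (Fin (k + 1))) := (μH[(k:ℝ)]).restrict S with hν
  set γ := ProbabilityTheory.stdGaussian (EuclideanSpace ℝ (Fin (k + 1))) with hγ
  have hfin : IsFiniteMeasure ν := ⟨by
    rw [hν, Measure.restrict_apply_univ]; exact lms_sphere_finite k⟩
  have hmS : MeasurableSet S := isClosed_sphere.measurableSet
  have hSae : ∀ᵐ u ∂ν, ‖u‖ = 1 := by
    filter_upwards [ae_restrict_mem hmS] with u hu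
    simpa [hSdef] using hu
  have hinv : ∀ R : EuclideanSpace ℝ (Fin (k + 1)) ≃ₗᵢ[ℝ] EuclideanSpace ℝ (Fin (k + 1)),
      ν.map R = ν := by
    intro R
    have h1 := (R.toIsometryEquiv.measurePreserving_hausdorffMeasure (k:ℝ)).restrict_preimage hmS
    have h2 : (R.toIsometryEquiv ⁻¹' S) = S := by
      ext x; simp [hSdef]
    rw [h2] at h1
    exact h1.map_eq
  have hnu : 0 < ν.real univ := by
    rw [measureReal_def, hν, Measure.restrict_apply_univ]
    exact ENNReal.toReal_pos (lms_sphere_pos k).ne' (lms_sphere_finite k).ne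
  have hG : 0 < ∫ x, ‖x‖ ∂γ := by
    have h := lms_radial_int hinv hSae (h := fun x => ‖x‖) continuous_norm
      (fun t ht x => by rw [norm_smul, Real.norm_eq_abs, abs_of_nonneg ht])
    have h1 : ∫ u, ‖u‖ ∂ν = ν.real univ := by
      rw [integral_congr_ae (g := fun _ => (1:ℝ)) hSae]; simp
    have h2 : 0 ≤ ∫ x, ‖x‖ ∂γ := integral_nonneg fun x => norm_nonneg x
    refine lt_of_le_of_ne h2 fun h3 => ?_
    -- use the support of the Gaussian density
    have h4 : (fun x : EuclideanSpace ℝ (Fin (k + 1)) => ‖x‖) =ᵐ[γ] 0 :=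
      (integral_eq_zero_iff_of_nonneg (fun x => norm_nonneg x) lG_norm_int).1 h3.symm
    have h5 : γ = Measure.dirac 0 := by
      have h6 : (id : EuclideanSpace ℝ (Fin (k + 1)) → _) =ᵐ[γ] fun _ => 0 := by
        filter_upwards [h4] with x hx
        simpa using hx
      calc γ = γ.map id := Measure.map_id.symm
        _ = γ.map (fun _ => 0) := Measure.map_congr h6
        _ = Measure.dirac 0 := by rw [Measure.map_const]; simp
    have h7 := ProbabilityTheory.charFun_stdGaussian
      (EuclideanSpace.single (0 : Fin (k + 1)) (1:ℝ))
    rw [← hγ, h5, charFun_dirac] at h7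
    simp only [inner_zero_left, Complex.ofReal_zero, zero_mul, Complex.exp_zero,
      EuclideanSpace.norm_single, norm_one, Complex.ofReal_one, one_pow] at h7
    have h8 := congrArg Complex.re h7
    have h9 : Complex.exp (-1 / 2) = ((Real.exp (-1 / 2) : ℝ) : ℂ) := by
      push_cast; rfl
    rw [h9, Complex.one_re, Complex.ofReal_re] at h8
    have : Real.exp (-1 / 2) < 1 := by rw [Real.exp_lt_one_iff]; norm_num
    linarith
  have hV : 0 < (volume (closedBall (0 : EuclideanSpace ℝ (Fin (k + 1))) 1)).toReal :=
    ENNReal.toReal_pos (measure_closedBall_pos _ _ one_pos).ne' measure_closedBall_lt_top.ne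
  refine ⟨(1 / ((k + 1 : ℕ) * (volume (closedBall (0 : EuclideanSpace ℝ (Fin (k + 1))) 1)).toReal)) *
    (2 * (ν.real univ / ∫ x, ‖x‖ ∂γ)), by positivity, ?_⟩
  intro K hK hne
  have hh := lms_radial_int hinv hSae (suppFn_cont hK hne) (fun t ht x => suppFn_smul hK hne t ht x)
  have hIntgr : Integrable (suppFn K) ν := by
    refine Integrable.of_bound (C := 1) (suppFn_cont hK hne).aestronglyMeasurable ?_
    filter_upwards [hSae] with u hu
    rw [Real.norm_eq_abs, ← hu]; exact suppFn_abs hK hne u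
  have hneg : Integrable (fun u => suppFn K (-u)) ν := by
    refine Integrable.of_bound (C := 1)
      ((suppFn_cont hK hne).comp continuous_neg).aestronglyMeasurable ?_
    filter_upwards [hSae] with u hu
    rw [Real.norm_eq_abs, ← hu, ← norm_neg]; exact suppFn_abs hK hne (-u)
  have hnegint : ∫ u, suppFn K (-u) ∂ν = ∫ u, suppFn K u ∂ν := by
    conv_rhs => rw [← hinv (LinearIsometryEquiv.neg ℝ)]
    rw [integral_map (by fun_prop) (suppFn_cont hK hne).aestronglyMeasurable]
    rfl
  unfold meanWidth
  have hk : (((k + 1 : ℕ) : ℝ) - 1) = (k:ℝ) := by push_cast; ring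
  rw [hk, mul_assoc]
  congr 1
  change ∫ u, (suppFn K u + suppFn K (-u)) ∂ν = _
  rw [integral_add hIntgr hneg, hnegint]
  have : ∫ u, suppFn K u ∂ν = ν.real univ * (∫ x, suppFn K x ∂γ) / ∫ x, ‖x‖ ∂γ := by
    rw [eq_div_iff hG.ne']; exact hh
  rw [this]; ring

end supp

end Part8

section Part9

lemma lms_select_step {ι : Type*} [Fintype ι] {c : ι → ℝ} {θ : ι → ι → ℝ} (hc : ∀ i, 0 ≤ c i)
    (h1 : ∀ i j, |θ i j| ≤ 1) (hF : ∀ i, ∑ j, c j * θ i j ^ 2 = 1) {m : ℕ} (hm : ∑ i, c i = m)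
    {Δ : ℝ} (hΔ0 : 0 < Δ) (hD : ∑ i, c i * ∑ j, c j * (θ i j ^ 2 * (1 - θ i j)) ≤ Δ)
    (hΔ : 128 * m * Δ ≤ 1) {k : ℕ} (hk : k < m) (f : Fin k → ι)
    (hf : ∀ a, ∑ j, c j * (θ (f a) j ^ 2 * (1 - θ (f a) j)) ≤ 8 * Δ) :
    ∃ j, ∑ l, c l * (θ j l ^ 2 * (1 - θ j l)) ≤ 8 * Δ ∧ ∑ a, θ (f a) j ^ 2 ≤ 64 * m * Δ := by
  classical
  by_contra! hcon
  have hm0 : (0:ℝ) < m := by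
    have : 0 < m := by omega
    exact_mod_cast this
  have hkm : (k:ℝ) + 1 ≤ m := by exact_mod_cast hk
  have hle : ∀ i j, θ i j ≤ 1 := fun i j => (abs_le.1 (h1 i j)).2
  have hge : ∀ i j, -1 ≤ θ i j := fun i j => (abs_le.1 (h1 i j)).1
  set Dd : ι → ℝ := fun i => ∑ j, c j * (θ i j ^ 2 * (1 - θ i j)) with hDd
  have hDd0 : ∀ i, 0 ≤ Dd i := fun i => Finset.sum_nonneg fun j _ =>
    mul_nonneg (hc j) (mul_nonneg (sq_nonneg _) (by linarith [hle i j]))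
  -- pointwise inequality
  have hpt : ∀ j, 1 ≤ Dd j / (8 * Δ) + (∑ a, (θ (f a) j ^ 2 * (1 - θ (f a) j)) / (32 * m * Δ)) +
      ∑ a, (θ (f a) j ^ 2 + 8 * (θ (f a) j ^ 2 * (1 - θ (f a) j))) := by
    intro j
    have hn2 : ∀ a, 0 ≤ (θ (f a) j ^ 2 * (1 - θ (f a) j)) := fun a =>
      mul_nonneg (sq_nonneg _) (by linarith [hle (f a) j])
    by_cases hg : ∃ a, 1 / 2 ≤ θ (f a) j
    · obtain ⟨a, ha⟩ := hg
      have t1 : 0 ≤ Dd j / (8 * Δ) := div_nonneg (hDd0 j) (by positivity)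
      have t2 : 0 ≤ ∑ a, (θ (f a) j ^ 2 * (1 - θ (f a) j)) / (32 * m * Δ) :=
        Finset.sum_nonneg fun a _ => div_nonneg (hn2 a) (by positivity)
      have t3 : θ (f a) j ^ 2 + 8 * (θ (f a) j ^ 2 * (1 - θ (f a) j)) ≤
          ∑ a, (θ (f a) j ^ 2 + 8 * (θ (f a) j ^ 2 * (1 - θ (f a) j))) :=
        Finset.single_le_sum (f := fun a => θ (f a) j ^ 2 + 8 * (θ (f a) j ^ 2 * (1 - θ (f a) j)))
          (fun a _ => by have := hn2 a; positivity) (Finset.mem_univ a)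
      have t4 : 1 ≤ θ (f a) j ^ 2 + 8 * (θ (f a) j ^ 2 * (1 - θ (f a) j)) := by
        set t := θ (f a) j
        have hb : t ≤ 1 := hle _ _
        have : 0 ≤ (1 - t) * (8 * t ^ 2 - 1 - t) := mul_nonneg (by linarith) (by nlinarith)
        nlinarith
      linarith
    · push Not at hg
      have t3 : 0 ≤ ∑ a, (θ (f a) j ^ 2 + 8 * (θ (f a) j ^ 2 * (1 - θ (f a) j))) :=
        Finset.sum_nonneg fun a _ => by have := hn2 a; positivity
      by_cases hj : Dd j ≤ 8 * Δ
      · have := hcon j hj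
        have t1 : 0 ≤ Dd j / (8 * Δ) := div_nonneg (hDd0 j) (by positivity)
        have t2 : 1 ≤ ∑ a, (θ (f a) j ^ 2 * (1 - θ (f a) j)) / (32 * m * Δ) := by
          rw [← Finset.sum_div, le_div_iff₀ (by positivity)]
          have : ∑ a, θ (f a) j ^ 2 ≤ ∑ a, 2 * (θ (f a) j ^ 2 * (1 - θ (f a) j)) :=
            Finset.sum_le_sum fun a _ => by nlinarith [hg a, sq_nonneg (θ (f a) j)]
          rw [← Finset.mul_sum] at this
          linarith
        linarith
      · push Not at hj
        have t1 : 1 ≤ Dd j / (8 * Δ) := by rw [le_div_iff₀ (by positivity)]; linarith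
        have t2 : 0 ≤ ∑ a, (θ (f a) j ^ 2 * (1 - θ (f a) j)) / (32 * m * Δ) :=
          Finset.sum_nonneg fun a _ => div_nonneg (hn2 a) (by positivity)
        linarith
  have hsum : (m:ℝ) ≤ ∑ j, c j * (Dd j / (8 * Δ) +
      (∑ a, (θ (f a) j ^ 2 * (1 - θ (f a) j)) / (32 * m * Δ)) +
      ∑ a, (θ (f a) j ^ 2 + 8 * (θ (f a) j ^ 2 * (1 - θ (f a) j)))) := by
    refine hm.symm.le.trans ?_
    refine Finset.sum_le_sum fun j _ => ?_
    exact le_mul_of_one_le_right (hc j) (hpt j)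
  have heq : ∑ j, c j * (Dd j / (8 * Δ) +
      (∑ a, (θ (f a) j ^ 2 * (1 - θ (f a) j)) / (32 * m * Δ)) +
      ∑ a, (θ (f a) j ^ 2 + 8 * (θ (f a) j ^ 2 * (1 - θ (f a) j)))) =
      (∑ j, c j * Dd j) / (8 * Δ) + (∑ a, Dd (f a)) / (32 * m * Δ) + (k + 8 * ∑ a, Dd (f a)) := by
    have e1 : (k:ℝ) = ∑ a : Fin k, ∑ j, c j * θ (f a) j ^ 2 := by simp [hF]
    simp only [mul_add, Finset.sum_add_distrib]
    congr 1
    congr 1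
    · rw [Finset.sum_div]; refine Finset.sum_congr rfl fun j _ => by ring
    · rw [Finset.sum_div]
      simp only [Finset.mul_sum]
      rw [Finset.sum_comm]
      refine Finset.sum_congr rfl fun a _ => ?_
      rw [hDd, Finset.sum_div]
      refine Finset.sum_congr rfl fun j _ => by ring
    · rw [e1]
      congr 1
      · simp only [Finset.mul_sum]; rw [Finset.sum_comm]
      · simp only [Finset.mul_sum, hDd]; rw [Finset.sum_comm]
        refine Finset.sum_congr rfl fun a _ => Finset.sum_congr rfl fun j _ => by ring
  rw [heq] at hsum
  have b1 : (∑ j, c j * Dd j) / (8 * Δ) ≤ 1 / 8 := by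
    rw [div_le_div_iff₀ (by positivity) (by positivity)]; linarith
  have b2 : ∑ a, Dd (f a) ≤ k * (8 * Δ) := by
    have := Finset.sum_le_sum fun a (_ : a ∈ Finset.univ) => hf a
    simpa using this
  have b2' : ∑ a, Dd (f a) ≤ m * (8 * Δ) := by nlinarith
  have b3 : (∑ a, Dd (f a)) / (32 * m * Δ) ≤ 1 / 4 := by
    rw [div_le_div_iff₀ (by positivity) (by positivity)]; linarith
  nlinarith

lemma lms_select {ι : Type*} [Fintype ι] {c : ι → ℝ} {θ : ι → ι → ℝ} (hc : ∀ i, 0 ≤ c i)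
    (hsym : ∀ i j, θ i j = θ j i)
    (h1 : ∀ i j, |θ i j| ≤ 1) (hF : ∀ i, ∑ j, c j * θ i j ^ 2 = 1) {m : ℕ} (hm : ∑ i, c i = m)
    {Δ : ℝ} (hΔ0 : 0 < Δ) (hD : ∑ i, c i * ∑ j, c j * (θ i j ^ 2 * (1 - θ i j)) ≤ Δ)
    (hΔ : 128 * m * Δ ≤ 1) :
    ∃ f : Fin m → ι, ∀ a b, a ≠ b → θ (f a) (f b) ^ 2 ≤ 64 * m * Δ := by
  have main : ∀ k : ℕ, k ≤ m → ∃ f : Fin k → ι,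
      (∀ a, ∑ j, c j * (θ (f a) j ^ 2 * (1 - θ (f a) j)) ≤ 8 * Δ) ∧
      ∀ a b, a ≠ b → θ (f a) (f b) ^ 2 ≤ 64 * m * Δ := by
    intro k
    induction k with
    | zero => intro _; exact ⟨fun a => a.elim0, fun a => a.elim0, fun a => a.elim0⟩
    | succ k ih =>
      intro hk
      obtain ⟨f, hf, hff⟩ := ih (by omega)
      obtain ⟨j, hj, hjj⟩ := lms_select_step hc h1 hF hm hΔ0 hD hΔ (by omega) f hf
      have hja : ∀ a, θ (f a) j ^ 2 ≤ 64 * m * Δ := fun a =>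
        (Finset.single_le_sum (f := fun a => θ (f a) j ^ 2) (fun a _ => sq_nonneg _)
          (Finset.mem_univ a)).trans hjj
      refine ⟨Fin.cons j f, ?_, ?_⟩
      · intro a
        refine Fin.cases ?_ (fun a => ?_) a
        · simpa using hj
        · simpa using hf a
      · intro a b
        refine Fin.cases ?_ (fun a => ?_) a <;> refine Fin.cases ?_ (fun b => ?_) b
        · intro h; exact absurd rfl h
        · intro _; simpa [hsym j] using hja b
        · intro _; simpa using hja a
        · intro h; simpa using hff a b (fun h' => h (by rw [h']))
  obtain ⟨f, -, hf⟩ := main m le_rfl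
  exact ⟨f, hf⟩

end Part9

section Part10

lemma lms_sqrt_sub_one {l δ : ℝ} (hl0 : 0 ≤ l) (h : |l - 1| ≤ δ) : |Real.sqrt l - 1| ≤ δ := by
  refine le_trans ?_ h
  have h1 : l - 1 = (Real.sqrt l - 1) * (Real.sqrt l + 1) := by
    have := Real.mul_self_sqrt hl0
    linarith
  rw [h1, abs_mul]
  have h2 : 1 ≤ |Real.sqrt l + 1| := by
    rw [abs_of_nonneg (by positivity)]; linarith [Real.sqrt_nonneg l]
  exact le_mul_of_one_le_right (abs_nonneg _) h2

lemma lms_polar {n : ℕ} (hn : 1 ≤ n) (A : EuclideanSpace ℝ (Fin n) →ₗ[ℝ] EuclideanSpace ℝ (Fin n)) {δ : ℝ}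
    (hδ : δ < 1) (hA : ∀ x, |‖A x‖ ^ 2 - ‖x‖ ^ 2| ≤ δ * ‖x‖ ^ 2) :
    ∃ T : EuclideanSpace ℝ (Fin n) ≃ₗᵢ[ℝ] EuclideanSpace ℝ (Fin n),
      ∀ x, ‖A x - T x‖ ≤ δ * ‖x‖ := by
  have hne : Nonempty (Fin n) := ⟨⟨0, hn⟩⟩
  have hS : (LinearMap.adjoint A * A).IsSymmetric := by
    intro x y
    simp [LinearMap.adjoint_inner_left, LinearMap.adjoint_inner_right]
  have hfr : Module.finrank ℝ (EuclideanSpace ℝ (Fin n)) = n := by simp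
  set e := hS.eigenvectorBasis hfr with he
  set l := hS.eigenvalues hfr with hl
  have hee : ∀ i j, ⟪A (e i), A (e j)⟫ = l j * ⟪e i, e j⟫ := by
    intro i j
    have h1 := hS.apply_eigenvectorBasis hfr j
    rw [← LinearMap.adjoint_inner_right]
    change ⟪e i, (LinearMap.adjoint A * A) (e j)⟫ = _
    rw [he, h1, inner_smul_right]
    rfl
  have hnorm : ∀ i, ‖A (e i)‖ ^ 2 = l i := by
    intro i
    rw [← real_inner_self_eq_norm_sq, hee, real_inner_self_eq_norm_sq, e.norm_eq_one]; simp
  have hl1 : ∀ i, |l i - 1| ≤ δ := by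
    intro i
    have := hA (e i)
    rw [hnorm, e.norm_eq_one] at this
    simpa using this
  have hlpos : ∀ i, 0 < l i := by
    intro i
    have := (abs_le.1 (hl1 i)).1
    linarith
  have horth : Orthonormal ℝ fun i => (Real.sqrt (l i))⁻¹ • A (e i) := by
    refine ⟨fun i => ?_, fun i j hij => ?_⟩
    · have h1 : ‖A (e i)‖ = Real.sqrt (l i) := by
        rw [← hnorm i, Real.sqrt_sq (norm_nonneg _)]
      rw [norm_smul, norm_inv, Real.norm_eq_abs, abs_of_nonneg (Real.sqrt_nonneg _), h1,
        inv_mul_cancel₀ (Real.sqrt_pos.2 (hlpos i)).ne']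
    · change ⟪(Real.sqrt (l i))⁻¹ • A (e i), (Real.sqrt (l j))⁻¹ • A (e j)⟫ = 0
      rw [real_inner_smul_left, real_inner_smul_right, hee, e.orthonormal.2 hij]
      simp
  let g : OrthonormalBasis (Fin n) ℝ (EuclideanSpace ℝ (Fin n)) :=
    (basisOfOrthonormalOfCardEqFinrank horth (by simp)).toOrthonormalBasis
      (by rw [coe_basisOfOrthonormalOfCardEqFinrank]; exact horth)
  have hg : ∀ i, g i = (Real.sqrt (l i))⁻¹ • A (e i) := by
    intro i; simp [g]
  refine ⟨e.equiv g (Equiv.refl _), fun x => ?_⟩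
  have hx : A x - e.equiv g (Equiv.refl _) x =
      ∑ i, (⟪e i, x⟫ * (Real.sqrt (l i) - 1)) • g i := by
    rw [OrthonormalBasis.equiv_apply]
    conv_lhs => rw [← e.sum_repr x]
    rw [map_sum, e.sum_repr x, ← Finset.sum_sub_distrib]
    refine Finset.sum_congr rfl fun i _ => ?_
    rw [map_smul, e.repr_apply_apply, Equiv.refl_apply, mul_sub, sub_smul, mul_one, mul_smul]
    congr 2
    rw [hg, smul_smul, mul_inv_cancel₀ (Real.sqrt_pos.2 (hlpos i)).ne', one_smul]
  have hcoef : ∀ i, ⟪g i, A x - e.equiv g (Equiv.refl _) x⟫ = ⟪e i, x⟫ * (Real.sqrt (l i) - 1) := by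
    intro i
    rw [hx]
    have := g.orthonormal.inner_right_fintype (fun i => ⟪e i, x⟫ * (Real.sqrt (l i) - 1)) i
    simpa using this
  have hsq : ‖A x - e.equiv g (Equiv.refl _) x‖ ^ 2 ≤ (δ * ‖x‖) ^ 2 := by
    rw [← g.sum_sq_inner_right, mul_pow, ← e.sum_sq_inner_right, Finset.mul_sum]
    refine Finset.sum_le_sum fun i _ => ?_
    rw [hcoef, mul_pow, mul_comm]
    refine mul_le_mul_of_nonneg_right ?_ (sq_nonneg _)
    exact sq_le_sq' (abs_le.1 (lms_sqrt_sub_one (hlpos i).le (hl1 i))).1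
      (abs_le.1 (lms_sqrt_sub_one (hlpos i).le (hl1 i))).2
  have hδ0 : 0 ≤ δ := (abs_nonneg _).trans (hl1 ⟨0, hn⟩)
  exact (sq_le_sq₀ (norm_nonneg _) (by positivity)).1 hsq

lemma lms_reg_frame {n : ℕ} (hn : 1 ≤ n) {w : Fin (n + 1) → EuclideanSpace ℝ (Fin n)}
    (hw : IsRegVerts w) (x : EuclideanSpace ℝ (Fin n)) :
    ∑ a, ⟪w a, x⟫ ^ 2 = (n + 1) / n * ‖x‖ ^ 2 := by
  have hn0 : (n:ℝ) ≠ 0 := by positivity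
  have horth : Orthonormal ℝ fun i => lLift (w i) := by
    refine ⟨fun i => lLift_norm (hw.1 i), fun i j hij => ?_⟩
    change ⟪lLift (w i), lLift (w j)⟫ = 0
    rw [lLift_inner_lift, hw.2 i j hij]
    field_simp
    simp
  let b : OrthonormalBasis (Fin (n + 1)) ℝ (WithLp 2 (EuclideanSpace ℝ (Fin n) × ℝ)) :=
    (basisOfOrthonormalOfCardEqFinrank horth (by rw [lLift_finrank]; simp)).toOrthonormalBasis
      (by rw [coe_basisOfOrthonormalOfCardEqFinrank]; exact horth)
  have hb : ∀ i, b i = lLift (w i) := by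
    intro i; simp [b]
  have h := b.sum_sq_inner_right (WithLp.toLp 2 (x, (0:ℝ)))
  have hnm : ‖(WithLp.toLp 2 (x, (0:ℝ)) : WithLp 2 (EuclideanSpace ℝ (Fin n) × ℝ))‖ ^ 2 = ‖x‖ ^ 2 := by
    rw [WithLp.prod_norm_sq_eq_of_L2]; simp
  rw [hnm] at h
  have hb2 : ∀ i, ⟪b i, (WithLp.toLp 2 (x, (0:ℝ)) : WithLp 2 (EuclideanSpace ℝ (Fin n) × ℝ))⟫ =
      Real.sqrt (n / (n + 1)) * ⟪w i, x⟫ := by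
    intro i; rw [hb, lLift_inner]; simp
  simp only [hb2, mul_pow] at h
  rw [← Finset.mul_sum, Real.sq_sqrt (by positivity)] at h
  rw [← h]
  field_simp

lemma lms_reg_sum {n : ℕ} (hn : 1 ≤ n) {w : Fin (n + 1) → EuclideanSpace ℝ (Fin n)}
    (hw : IsRegVerts w) : ∑ a, w a = 0 := by
  have hn0 : (n:ℝ) ≠ 0 := by positivity
  have : ⟪∑ a, w a, ∑ a, w a⟫ = 0 := by
    rw [sum_inner]
    refine Finset.sum_eq_zero fun a _ => ?_
    rw [inner_sum, ← Finset.add_sum_erase _ _ (Finset.mem_univ a)]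
    rw [Finset.sum_congr rfl (g := fun _ => (-1 / n : ℝ))
      (fun j hj => hw.2 a j (Finset.ne_of_mem_erase hj).symm), real_inner_self_eq_norm_sq, hw.1]
    simp
    field_simp
    simp
  exact inner_self_eq_zero.1 this

lemma lms_isometry {n : ℕ} (hn : 1 ≤ n) {w : Fin (n + 1) → EuclideanSpace ℝ (Fin n)}
    (hw : IsRegVerts w) {u : Fin (n + 1) → EuclideanSpace ℝ (Fin n)} (hu : ∀ i, ‖u i‖ = 1)
    {τ : ℝ} (hτ0 : 0 ≤ τ) (hτ : (n + 1) * τ ≤ 1 / 2)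
    (huu : ∀ a b, a ≠ b → |⟪lLift (u a), lLift (u b)⟫| ≤ τ) :
    ∃ T : EuclideanSpace ℝ (Fin n) ≃ₗᵢ[ℝ] EuclideanSpace ℝ (Fin n),
      ∀ b, ‖u b - T (w b)‖ ≤ 3 * (n + 1) * τ := by
  classical
  have hn0 : (0:ℝ) < n := by exact_mod_cast hn
  have hn1 : (1:ℝ) ≤ n := by exact_mod_cast hn
  set m : ℝ := (n:ℝ) + 1 with hm
  have hm0 : 0 < m := by positivity
  set e : Fin (n + 1) → Fin (n + 1) → ℝ := fun a b =>
    ⟪u a, u b⟫ - (if a = b then m / n else 0) + 1 / n with he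
  have hE : ∀ a b, |e a b| ≤ m * τ / n := by
    intro a b
    by_cases hab : a = b
    · subst hab
      simp only [he, if_true, real_inner_self_eq_norm_sq, hu]
      have : (1:ℝ) ^ 2 - m / n + 1 / n = 0 := by rw [hm]; field_simp; ring
      rw [this]; simp; positivity
    · have h1 := huu a b hab
      rw [lLift_inner_lift, ← hm, abs_div, abs_of_pos hm0, div_le_iff₀ hm0] at h1
      simp only [he, if_neg hab]
      have : ⟪u a, u b⟫ - 0 + 1 / n = (n * ⟪u a, u b⟫ + 1) / n := by field_simp; ring
      rw [this, abs_div, abs_of_pos hn0]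
      gcongr
      linarith
  have hin : ∀ a b, ⟪u a, u b⟫ = (if a = b then m / n else 0) - 1 / n + e a b := by
    intro a b; simp only [he]; ring
  let A : EuclideanSpace ℝ (Fin n) →ₗ[ℝ] EuclideanSpace ℝ (Fin n) :=
    (n / m) • ∑ a, ((innerSL ℝ (w a)).toLinearMap).smulRight (u a)
  have hAx : ∀ x, A x = (n / m) • ∑ a, ⟪w a, x⟫ • u a := by
    intro x; simp [A]
  have hfr := lms_reg_frame hn hw
  have hs0 := lms_reg_sum hn hw
  have hx0 : ∀ x, ∑ a, ⟪w a, x⟫ = 0 := by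
    intro x; rw [← sum_inner, hs0, inner_zero_left]
  have hl1 : ∀ x, (∑ a, |⟪w a, x⟫|) ^ 2 ≤ m * (m / n * ‖x‖ ^ 2) := by
    intro x
    have := sq_sum_le_card_mul_sum_sq (s := Finset.univ) (f := fun a => |⟪w a, x⟫|)
    simp only [sq_abs, hfr, Finset.card_univ, Fintype.card_fin] at this
    push_cast at this
    exact this
  -- inner product expansions
  have hquad : ∀ x : Fin (n + 1) → ℝ, ∑ a, x a = 0 → ∀ b,
      ⟪∑ a, x a • u a, u b⟫ = m / n * x b + ∑ a, x a * e a b := by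
    intro x hx b
    rw [sum_inner]
    simp only [real_inner_smul_left, hin, mul_add, mul_sub, Finset.sum_add_distrib,
      Finset.sum_sub_distrib, mul_ite, mul_zero, Finset.sum_ite_eq', Finset.mem_univ, if_true,
      ← Finset.sum_mul, hx]
    ring
  have hA : ∀ x, |‖A x‖ ^ 2 - ‖x‖ ^ 2| ≤ (m * τ) * ‖x‖ ^ 2 := by
    intro x
    have h1 : ‖A x‖ ^ 2 = (n / m) ^ 2 * (m / n * (m / n * ‖x‖ ^ 2) +
        ∑ b, ∑ a, ⟪w b, x⟫ * ⟪w a, x⟫ * e a b) := by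
      rw [hAx, norm_smul, mul_pow, Real.norm_eq_abs, sq_abs]
      congr 1
      rw [← real_inner_self_eq_norm_sq, inner_sum, ← hfr x, Finset.mul_sum,
        ← Finset.sum_add_distrib]
      refine Finset.sum_congr rfl fun b _ => ?_
      rw [real_inner_smul_right, hquad _ (hx0 x), mul_add, Finset.mul_sum]
      congr 1
      · ring
      · exact Finset.sum_congr rfl fun a _ => by ring
    have h2 : |∑ b, ∑ a, ⟪w b, x⟫ * ⟪w a, x⟫ * e a b| ≤ (m * τ / n) * (∑ a, |⟪w a, x⟫|) ^ 2 := by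
      rw [pow_two, Finset.sum_mul_sum, Finset.mul_sum]
      refine (Finset.abs_sum_le_sum_abs _ _).trans (Finset.sum_le_sum fun b _ => ?_)
      rw [Finset.mul_sum]
      refine (Finset.abs_sum_le_sum_abs _ _).trans (Finset.sum_le_sum fun a _ => ?_)
      rw [abs_mul, abs_mul, mul_comm]
      exact mul_le_mul_of_nonneg_right (hE a b) (by positivity)
    have h3 : ‖A x‖ ^ 2 - ‖x‖ ^ 2 = (n / m) ^ 2 * ∑ b, ∑ a, ⟪w b, x⟫ * ⟪w a, x⟫ * e a b := by
      rw [h1]; field_simp; ring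
    rw [h3, abs_mul, abs_of_nonneg (by positivity)]
    calc (n / m) ^ 2 * |∑ b, ∑ a, ⟪w b, x⟫ * ⟪w a, x⟫ * e a b|
        ≤ (n / m) ^ 2 * ((m * τ / n) * (m * (m / n * ‖x‖ ^ 2))) := by
          gcongr
          exact h2.trans (by gcongr; exact hl1 x)
      _ = _ := by field_simp
  obtain ⟨T, hT⟩ := lms_polar hn A (by linarith) hA
  refine ⟨T, fun b => ?_⟩
  set s := ∑ a, u a with hs
  -- A w_b
  have hAw : A (w b) = u b - (1 / m) • s := by
    have h1 : ∑ a, ⟪w a, w b⟫ • u a = (m / n) • u b - (1 / n : ℝ) • s := by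
      rw [hs, Finset.smul_sum, sub_eq_iff_eq_add.2]
      have : ∀ a, ⟪w a, w b⟫ • u a + (1 / n : ℝ) • u a = if a = b then (m / n) • u b else 0 := by
        intro a
        rw [← add_smul]
        split_ifs with hab
        · subst hab
          rw [real_inner_self_eq_norm_sq, hw.1]
          congr 1; rw [hm]; field_simp
        · rw [hw.2 a b hab]
          have : (-1 / n + 1 / n : ℝ) = 0 := by ring
          rw [this, zero_smul]
      rw [← Finset.sum_add_distrib, Finset.sum_congr rfl fun a _ => this a]
      simp
    rw [hAx, h1, smul_sub, smul_smul, smul_smul]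
    have e1 : (n / m) * (m / n) = 1 := by field_simp
    have e2 : (n / m) * (1 / n) = 1 / m := by field_simp
    rw [e1, e2, one_smul]
  -- bound on s
  have hsb : ‖s‖ ≤ 2 * m ^ 2 * τ := by
    have hinj : Function.Injective A := by
      rw [← LinearMap.ker_eq_bot, LinearMap.ker_eq_bot']
      intro x hx
      have := hA x
      rw [hx] at this
      simp only [norm_zero] at this
      have h2 := (abs_le.1 this).1
      have h3 : ‖x‖ ^ 2 ≤ 0 := by nlinarith [sq_nonneg ‖x‖]
      have h4 : ‖x‖ = 0 := by nlinarith [norm_nonneg x]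
      simpa using h4
    obtain ⟨x, hx⟩ := (LinearMap.injective_iff_surjective.1 hinj) s
    have hxs : ‖x‖ ≤ 2 * ‖s‖ := by
      have := (abs_le.1 (hA x)).1
      rw [hx] at this
      have : ‖x‖ ^ 2 ≤ (2 * ‖s‖) ^ 2 := by nlinarith [sq_nonneg ‖x‖, sq_nonneg ‖s‖]
      exact (sq_le_sq₀ (norm_nonneg _) (by positivity)).1 this
    have hsu : ∀ a, |⟪s, u a⟫| ≤ m * (m * τ / n) := by
      intro a
      have h1 : ⟪s, u a⟫ = ∑ c, e c a := by
        rw [hs, sum_inner]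
        simp only [hin, Finset.sum_add_distrib, Finset.sum_sub_distrib, Finset.sum_ite_eq',
          Finset.mem_univ, if_true, Finset.sum_const, Finset.card_univ, Fintype.card_fin,
          nsmul_eq_mul]
        push_cast
        rw [hm]; ring
      rw [h1]
      refine (Finset.abs_sum_le_sum_abs _ _).trans ?_
      refine (Finset.sum_le_sum fun c _ => hE c a).trans ?_
      simp [hm]
    have h3 : ‖s‖ ^ 2 ≤ m * τ * ∑ a, |⟪w a, x⟫| := by
      have : ‖s‖ ^ 2 = (n / m) * ∑ a, ⟪w a, x⟫ * ⟪s, u a⟫ := by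
        rw [← real_inner_self_eq_norm_sq]
        nth_rw 2 [← hx]
        rw [hAx, real_inner_smul_right, inner_sum]
        simp only [real_inner_smul_right]
      rw [this]
      calc (n / m) * ∑ a, ⟪w a, x⟫ * ⟪s, u a⟫ ≤ (n / m) * ∑ a, |⟪w a, x⟫| * (m * (m * τ / n)) := by
            refine mul_le_mul_of_nonneg_left (Finset.sum_le_sum fun a _ => ?_) (by positivity)
            refine (le_abs_self _).trans ?_
            rw [abs_mul]
            exact mul_le_mul_of_nonneg_left (hsu a) (abs_nonneg _)
        _ = _ := by rw [← Finset.sum_mul]; field_simp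
    have h4 : ∑ a, |⟪w a, x⟫| ≤ m * ‖x‖ := by
      have h5 := hl1 x
      have h6 : m * (m / n * ‖x‖ ^ 2) ≤ (m * ‖x‖) ^ 2 := by
        have : m / n ≤ m := div_le_self hm0.le hn1
        calc m * (m / n * ‖x‖ ^ 2) ≤ m * (m * ‖x‖ ^ 2) := by gcongr
          _ = _ := by ring
      exact (sq_le_sq₀ (Finset.sum_nonneg fun a _ => abs_nonneg _) (by positivity)).1 (h5.trans h6)
    rcases eq_or_lt_of_le (norm_nonneg s) with h0 | h0
    · rw [← h0]; positivity
    · have : ‖s‖ * ‖s‖ ≤ (2 * m ^ 2 * τ) * ‖s‖ := by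
        calc ‖s‖ * ‖s‖ = ‖s‖ ^ 2 := by ring
          _ ≤ m * τ * (m * (2 * ‖s‖)) := h3.trans (by gcongr; exact h4.trans (by gcongr))
          _ = _ := by ring
      exact le_of_mul_le_mul_right this h0
  have e3 : u b - T (w b) = (1 / m) • s + (A (w b) - T (w b)) := by rw [hAw]; abel
  rw [e3]
  refine (norm_add_le _ _).trans ?_
  have h5 := hT (w b)
  rw [hw.1, mul_one] at h5
  have h6 : ‖(1 / m) • s‖ ≤ 2 * m * τ := by
    rw [norm_smul, Real.norm_eq_abs, abs_of_pos (by positivity), one_div, inv_mul_le_iff₀ hm0]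
    nlinarith
  linarith

end Part10

section Part11

lemma lms_volume_ball {E : Type*} [NormedAddCommGroup E] [InnerProductSpace ℝ E]
    [FiniteDimensional ℝ E] [MeasurableSpace E] [BorelSpace E] {N : ℕ}
    (hN : Module.finrank ℝ E = N) (hN2 : 2 ≤ N) (x : E) {r : ℝ} (hr : 0 ≤ r) :
    (r / N) ^ N ≤ volume.real (ball x r) := by
  have : Nontrivial E := Module.nontrivial_of_finrank_pos (R := ℝ) (by omega)
  rw [measureReal_def, InnerProductSpace.volume_ball, hN, ENNReal.toReal_mul, ENNReal.toReal_pow,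
    ENNReal.toReal_ofReal hr]
  have hN0 : (0:ℝ) < N := by exact_mod_cast (by omega : 0 < N)
  have hG0 : 0 < Real.Gamma ((N:ℝ) / 2 + 1) := Real.Gamma_pos_of_pos (by positivity)
  rw [ENNReal.toReal_ofReal (by positivity), div_pow, div_eq_mul_inv]
  refine mul_le_mul_of_nonneg_left ?_ (by positivity)
  have hN2' : (2:ℝ) ≤ N := by exact_mod_cast hN2
  have h1 : Real.Gamma ((N:ℝ) / 2 + 1) ≤ (N:ℝ) ^ N := by
    have h2 : Real.Gamma ((N:ℝ) / 2 + 1) ≤ Real.Gamma ((N:ℝ) + 1) :=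
      Real.Gamma_strictMonoOn_Ici.monotoneOn (by simp; linarith) (by simp; linarith) (by linarith)
    rw [Real.Gamma_nat_eq_factorial] at h2
    refine h2.trans ?_
    exact_mod_cast Nat.factorial_le_pow N
  have h3 : 1 ≤ Real.sqrt Real.pi ^ N := by
    apply one_le_pow₀
    rw [Real.one_le_sqrt]
    linarith [Real.pi_gt_three]
  rw [inv_eq_one_div]
  exact div_le_div₀ (by positivity) h3 hG0 h1

lemma lms_gauss_ball {n : ℕ} (hn : 2 ≤ n) {ν : EuclideanSpace ℝ (Fin n)} (hν : ‖ν‖ = 1) {r : ℝ}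
    (hr : 0 ≤ r) (hr2 : r ≤ 1 / 2) :
    (2 * Real.pi) ^ (-(n:ℝ) / 2) * Real.exp (-9 / 8) * (r / n) ^ n ≤
      (ProbabilityTheory.stdGaussian (EuclideanSpace ℝ (Fin n))).real (ball ν r) := by
  rw [stdGaussian_real_apply measurableSet_ball]
  set c := (2 * Real.pi) ^ (-(n:ℝ) / 2) * Real.exp (-9 / 8) with hc
  have hc0 : 0 ≤ c := by positivity
  calc c * (r / n) ^ n ≤ c * volume.real (ball ν r) :=
        mul_le_mul_of_nonneg_left (lms_volume_ball (by simp) hn ν hr) hc0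
    _ = ∫ _ in ball ν r, c := by simp [mul_comm]
    _ ≤ _ := by
        refine setIntegral_mono_on (by simp [measure_ball_lt_top]) gd_integrable.integrableOn
          measurableSet_ball fun x hx => ?_
        have hx' : ‖x - ν‖ < r := by simpa [dist_eq_norm] using hx
        have hxn : ‖x‖ ≤ 3 / 2 := by
          calc ‖x‖ = ‖(x - ν) + ν‖ := by simp
            _ ≤ ‖x - ν‖ + ‖ν‖ := norm_add_le _ _
            _ ≤ _ := by linarith
        unfold gd
        rw [hc, finrank_euclideanSpace, Fintype.card_fin]
        refine mul_le_mul_of_nonneg_left ?_ (by positivity)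
        rw [Real.exp_le_exp]
        nlinarith [norm_nonneg x]

lemma lms_lM_iso {n : ℕ} {ι : Type*} [Fintype ι] [Nonempty ι] (w : ι → EuclideanSpace ℝ (Fin n))
    (T : EuclideanSpace ℝ (Fin n) ≃ₗᵢ[ℝ] EuclideanSpace ℝ (Fin n)) :
    ∫ x, lM (fun i => T (w i)) x ∂ProbabilityTheory.stdGaussian (EuclideanSpace ℝ (Fin n)) =
    ∫ x, lM w x ∂ProbabilityTheory.stdGaussian (EuclideanSpace ℝ (Fin n)) := by
  have h : ∀ x, lM (fun i => T (w i)) (T x) = lM w x := by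
    intro x; simp [lM]
  conv_lhs => rw [← ProbabilityTheory.stdGaussian_map T]
  rw [integral_map (by fun_prop) (lM_meas _).aestronglyMeasurable]
  simp only [h]

lemma lms_finish {n : ℕ} (hn : 2 ≤ n) {K : Set (EuclideanSpace ℝ (Fin n))}
    (hK : K ⊆ closedBall 0 1)
    {v : Fin (n + 1) → EuclideanSpace ℝ (Fin n)} (hv : ∀ i, ‖v i‖ = 1)
    {u : Fin (n + 1) → EuclideanSpace ℝ (Fin n)} (huK : ∀ i, u i ∈ K)
    {σ ε : ℝ} (hε : 0 ≤ ε) (huv : ∀ b, ‖u b - v b‖ ≤ σ)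
    (hW : ∫ x, suppFn K x ∂ProbabilityTheory.stdGaussian (EuclideanSpace ℝ (Fin n)) ≤
      (1 + ε) * ∫ x, lM v x ∂ProbabilityTheory.stdGaussian (EuclideanSpace ℝ (Fin n)))
    {x : EuclideanSpace ℝ (Fin n)} (hx : x ∈ K) {d : ℝ}
    (hd : d = infDist x (convexHull ℝ (range v))) (hd0 : 0 < d) :
    (d / 2) * ((2 * Real.pi) ^ (-(n:ℝ) / 2) * Real.exp (-9 / 8) * (d / 4 / n) ^ n) ≤
      (ε + σ) * Real.sqrt n := by
  set γ := ProbabilityTheory.stdGaussian (EuclideanSpace ℝ (Fin n)) with hγ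
  set S := convexHull ℝ (range v) with hSdef
  have hSc : IsCompact S := lms_convexHull_compact (finite_range v).isCompact
  have hSne : S.Nonempty := (range_nonempty v).convexHull
  have hSb : S ⊆ closedBall 0 1 :=
    convexHull_min (by rintro _ ⟨i, rfl⟩; simp [hv i]) (convex_closedBall _ _)
  have hKne : K.Nonempty := ⟨x, hx⟩
  have hxn : ‖x‖ ≤ 1 := by simpa using hK hx
  obtain ⟨p, hpS, hp⟩ := hSc.exists_infDist_eq_dist hSne x
  have hpd : ‖x - p‖ = d := by rw [hd, hp, dist_eq_norm]
  have hsep : ∀ y ∈ S, ⟪x - p, y - p⟫ ≤ 0 := by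
    rw [← norm_eq_iInf_iff_real_inner_le_zero (convex_convexHull ℝ _) hpS]
    rw [← dist_eq_norm, ← hp, infDist_eq_iInf]
    simp only [dist_eq_norm]
    rfl
  have hpn : ‖p‖ ≤ 1 := by simpa using hSb hpS
  have hd2 : d ≤ 2 := by
    rw [← hpd]; exact (norm_sub_le _ _).trans (by linarith)
  set ν := d⁻¹ • (x - p) with hν
  have hν1 : ‖ν‖ = 1 := by
    rw [hν, norm_smul, norm_inv, Real.norm_eq_abs, abs_of_pos hd0, hpd, inv_mul_cancel₀ hd0.ne']
  -- the two lower bounds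
  have hσ0 : 0 ≤ σ := (norm_nonneg _).trans (huv 0)
  have hl1 : ∀ G, lM v G - σ * ‖G‖ ≤ suppFn K G := by
    intro G
    obtain ⟨i, hi⟩ := lM_exists v G
    rw [hi]
    have h1 := le_suppFn hK (huK i) G
    have h2 := real_inner_le_norm (v i - u i) G
    rw [inner_sub_left, norm_sub_rev] at h2
    rw [real_inner_comm] at h1
    nlinarith [huv i, norm_nonneg G]
  have hl2 : ∀ G ∈ ball ν (d / 4), lM v G + d / 2 ≤ suppFn K G := by
    intro G hG
    have hG' : ‖G - ν‖ < d / 4 := by simpa [dist_eq_norm] using hG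
    obtain ⟨i, hi⟩ := lM_exists v G
    rw [hi]
    have h1 := le_suppFn hK hx G
    have hy := hsep (v i) (subset_convexHull _ _ ⟨i, rfl⟩)
    have h3 : d ≤ ⟪ν, x - v i⟫ := by
      have : ⟪ν, x - v i⟫ = d⁻¹ * (⟪x - p, x - p⟫ - ⟪x - p, v i - p⟫) := by
        rw [hν, real_inner_smul_left, ← inner_sub_right]; congr 2; abel
      rw [this, real_inner_self_eq_norm_sq, hpd]
      rw [le_inv_mul_iff₀ hd0]
      nlinarith
    have h4 := abs_real_inner_le_norm (G - ν) (x - v i)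
    have h5 : ‖x - v i‖ ≤ 2 := (norm_sub_le _ _).trans (by rw [hv]; linarith)
    have h6 : ‖G - ν‖ * ‖x - v i‖ ≤ (d / 4) * 2 := by gcongr
    have h7 := (abs_le.1 (h4.trans h6)).1
    rw [inner_sub_left, inner_sub_right, inner_sub_right] at h7
    rw [inner_sub_right] at h3
    rw [real_inner_comm] at h1
    rw [real_inner_comm (v i) G, real_inner_comm x G] at h7
    linarith [real_inner_comm G x, real_inner_comm G (v i)]
  have hl3 : ∀ G, lM v G - σ * ‖G‖ + (ball ν (d / 4)).indicator (fun _ => d / 2) G ≤ suppFn K G := by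
    intro G
    by_cases hG : G ∈ ball ν (d / 4)
    · rw [indicator_of_mem hG]
      have := hl2 G hG
      nlinarith [norm_nonneg G]
    · rw [indicator_of_notMem hG]
      linarith [hl1 G]
  have hi1 : Integrable (fun G => lM v G) γ := lM_int hv
  have hi2 : Integrable (fun G : EuclideanSpace ℝ (Fin n) => σ * ‖G‖) γ := lG_norm_int.const_mul σ
  have hi3 : Integrable ((ball ν (d / 4)).indicator (fun _ => d / 2)) γ :=
    (integrable_const _).indicator measurableSet_ball
  have hIntgr := integral_mono ((hi1.sub hi2).add hi3) (suppFn_int hK hKne) hl3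
  have he : ∫ G, (lM v G - σ * ‖G‖ + (ball ν (d / 4)).indicator (fun _ => d / 2) G) ∂γ =
      ∫ G, lM v G ∂γ - σ * ∫ G, ‖G‖ ∂γ + γ.real (ball ν (d / 4)) * (d / 2) := by
    have hi12 : Integrable (fun G => lM v G - σ * ‖G‖) γ := hi1.sub hi2
    rw [integral_add hi12 hi3, integral_sub hi1 hi2, integral_const_mul,
      integral_indicator measurableSet_ball]
    simp
  have hIntgr' : ∫ G, lM v G ∂γ - σ * ∫ G, ‖G‖ ∂γ + γ.real (ball ν (d / 4)) * (d / 2) ≤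
      ∫ G, suppFn K G ∂γ := he ▸ hIntgr
  have hG := lG_norm_le (E := EuclideanSpace ℝ (Fin n))
  rw [finrank_euclideanSpace, Fintype.card_fin] at hG
  have hM : ∫ G, lM v G ∂γ ≤ Real.sqrt n := by
    refine (integral_mono hi1 lG_norm_int fun G => (le_abs_self _).trans (lM_abs hv G)).trans hG
  have hb := lms_gauss_ball hn hν1 (r := d / 4) (by positivity) (by linarith)
  have hb2 : (d / 2) * ((2 * Real.pi) ^ (-(n:ℝ) / 2) * Real.exp (-9 / 8) * (d / 4 / n) ^ n) ≤
      (d / 2) * γ.real (ball ν (d / 4)) := by gcongr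
  have h8 : σ * ∫ G, ‖G‖ ∂γ ≤ σ * Real.sqrt n := by gcongr
  have h9 : ε * ∫ G, lM v G ∂γ ≤ ε * Real.sqrt n := by gcongr
  linarith

lemma lms_hausdorff {n : ℕ} {K S : Set (EuclideanSpace ℝ (Fin n))}
    (hK : K ⊆ closedBall 0 1) (hS : S ⊆ closedBall 0 1) (hKne : K.Nonempty)
    (hSne : S.Nonempty) : hausdorffDist K S ≤ 2 := by
  refine hausdorffDist_le_of_mem_dist (by norm_num) ?_ ?_
  · intro x hx
    obtain ⟨y, hy⟩ := hSne
    refine ⟨y, hy, ?_⟩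
    have h1 : ‖x‖ ≤ 1 := by simpa using hK hx
    have h2 : ‖y‖ ≤ 1 := by simpa using hS hy
    rw [dist_eq_norm]; exact (norm_sub_le _ _).trans (by linarith)
  · intro x hx
    obtain ⟨y, hy⟩ := hKne
    refine ⟨y, hy, ?_⟩
    have h1 : ‖x‖ ≤ 1 := by simpa using hS hx
    have h2 : ‖y‖ ≤ 1 := by simpa using hK hy
    rw [dist_eq_norm]; exact (norm_sub_le _ _).trans (by linarith)

/-- points of the simplex are close to `K` -/
lemma lms_simplex_near {n : ℕ} {K : Set (EuclideanSpace ℝ (Fin n))} (hconv : Convex ℝ K)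
    {ι : Type*} {u v : ι → EuclideanSpace ℝ (Fin n)} (huK : ∀ i, u i ∈ K) {σ : ℝ}
    (huv : ∀ b, ‖u b - v b‖ ≤ σ) {y : EuclideanSpace ℝ (Fin n)}
    (hy : y ∈ convexHull ℝ (range v)) : ∃ z ∈ K, dist y z ≤ σ := by
  have hc : Convex ℝ {y | ∃ z ∈ K, dist y z ≤ σ} := by
    rintro y₁ ⟨z₁, hz₁, h₁⟩ y₂ ⟨z₂, hz₂, h₂⟩ a b ha hb hab
    refine ⟨a • z₁ + b • z₂, hconv hz₁ hz₂ ha hb hab, ?_⟩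
    rw [dist_eq_norm] at h₁ h₂ ⊢
    have : a • y₁ + b • y₂ - (a • z₁ + b • z₂) = a • (y₁ - z₁) + b • (y₂ - z₂) := by
      rw [smul_sub, smul_sub]; abel
    rw [this]
    refine (norm_add_le _ _).trans ?_
    rw [norm_smul, norm_smul, Real.norm_eq_abs, Real.norm_eq_abs, abs_of_nonneg ha,
      abs_of_nonneg hb]
    calc a * ‖y₁ - z₁‖ + b * ‖y₂ - z₂‖ ≤ a * σ + b * σ := by gcongr
      _ = σ := by rw [← add_mul, hab, one_mul]
  refine (convexHull_min ?_ hc) hy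
  rintro _ ⟨i, rfl⟩
  refine ⟨u i, huK i, ?_⟩
  rw [dist_eq_norm, norm_sub_rev]; exact huv i

end Part11

section Part12

lemma lms_num_ldelta {n : ℕ} (hn : 2 ≤ n) {V : ℝ}
    (hV : ((1 / 1000 / 4) / ((n + 1 : ℕ) : ℝ)) ^ (n + 1) ≤ V) :
    1 / (n:ℝ) ^ (19 * (n + 1) + 49) ≤ ldelta (n + 1) V := by
  have hN : (2:ℝ) ≤ n := by exact_mod_cast hn
  have hN0 : (0:ℝ) < n := by linarith
  have hp : ∀ k : ℕ, (2:ℝ) ^ k ≤ (n:ℝ) ^ k := fun k => pow_le_pow_left₀ (by norm_num) hN k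
  have hm : (n:ℝ) + 1 ≤ (n:ℝ) ^ 2 := by nlinarith
  have h1 : (1 / (n:ℝ) ^ 3) ^ (n + 1) ≤ (2 * Real.pi) ^ (-((n + 1 : ℕ) : ℝ) / 2) := by
    have : (1 / (8:ℝ)) ^ (n + 1) ≤ (2 * Real.pi) ^ (-((n + 1 : ℕ) : ℝ) / 2) := by
      rw [neg_div, Real.rpow_neg (by positivity), one_div, inv_pow]
      apply inv_anti₀ (by positivity)
      rw [← Real.rpow_natCast]
      calc (2 * Real.pi) ^ (((n + 1 : ℕ) : ℝ) / 2) ≤ (2 * Real.pi) ^ (((n + 1 : ℕ) : ℝ)) := by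
            apply Real.rpow_le_rpow_of_exponent_le
            · linarith [Real.pi_gt_three]
            · have : (0:ℝ) ≤ ((n + 1 : ℕ) : ℝ) := by positivity
              linarith
        _ ≤ 8 ^ (((n + 1 : ℕ) : ℝ)) := by
            apply Real.rpow_le_rpow (by positivity) _ (by positivity)
            linarith [Real.pi_lt_four]
    refine le_trans ?_ this
    gcongr
    have := hp 3
    norm_num at this
    exact this
  have h2 : (1 / (n:ℝ) ^ 2) ^ (n + 1) ≤ Real.exp (-((n + 1 : ℕ) : ℝ) / 2) := by
    have : (1 / (4:ℝ)) ^ (n + 1) ≤ Real.exp (-((n + 1 : ℕ) : ℝ) / 2) := by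
      have e : Real.exp (-((n + 1 : ℕ) : ℝ) / 2) = Real.exp (-(1/2)) ^ (n + 1) := by
        rw [← Real.exp_nat_mul]; congr 1; push_cast; ring
      rw [e]
      gcongr
      have := Real.add_one_le_exp (-(1/2) : ℝ)
      linarith
    refine le_trans ?_ this
    gcongr
    have := hp 2
    norm_num at this
    exact this
  have h3 : 1 / (n:ℝ) ^ 25 ≤ 1 / (8000000 * (1 + ((n + 1 : ℕ) : ℝ))) := by
    apply one_div_le_one_div_of_le (by positivity)
    push_cast
    have := hp 23
    have h23 : (8000000:ℝ) ≤ 2 ^ 23 := by norm_num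
    calc 8000000 * (1 + ((n:ℝ) + 1)) ≤ (n:ℝ) ^ 23 * (n:ℝ) ^ 2 := by
          apply mul_le_mul (h23.trans this) (by nlinarith) (by positivity) (by positivity)
      _ = _ := by ring
  have h4 : 1 / (n:ℝ) ^ 24 ≤ ((1 / 1000 : ℝ) / 4) ^ 2 := by
    have : ((1 / 1000 : ℝ) / 4) ^ 2 = 1 / 16000000 := by norm_num
    rw [this]
    apply one_div_le_one_div_of_le (by positivity)
    refine le_trans (by norm_num) (hp 24)
  have h5 : (1 / (n:ℝ) ^ 14) ^ (n + 1) ≤ V := by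
    refine le_trans ?_ hV
    refine pow_le_pow_left₀ (by positivity) ?_ _
    push_cast
    rw [div_div, div_div, div_le_div_iff₀ (by positivity) (by positivity)]
    have := hp 12
    have h12 : (1000 * 4:ℝ) ≤ 2 ^ 12 := by norm_num
    calc 1 * (1000 * (4 * ((n:ℝ) + 1))) = (1000 * 4) * ((n:ℝ) + 1) := by ring
      _ ≤ (n:ℝ) ^ 12 * (n:ℝ) ^ 2 := mul_le_mul (h12.trans this) hm (by positivity) (by positivity)
      _ = _ := by ring
  unfold ldelta
  calc 1 / (n:ℝ) ^ (19 * (n + 1) + 49) = ((1 / (n:ℝ) ^ 3) ^ (n + 1) * (1 / (n:ℝ) ^ 2) ^ (n + 1)) *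
        (1 / (n:ℝ) ^ 25 * (1 / (n:ℝ) ^ 24) * (1 / (n:ℝ) ^ 14) ^ (n + 1)) := by
        simp only [one_div, inv_pow, ← pow_mul, ← mul_inv, ← pow_add]
        congr 2; ring
    _ ≤ _ := by gcongr

/-- the numerical bound for the deficit -/
lemma lms_num_D {n : ℕ} (hn : 2 ≤ n) {δ D ε : ℝ} (hε : 0 ≤ ε)
    (hδ : 1 / (n:ℝ) ^ (19 * (n + 1) + 49) ≤ δ) (hD0 : 0 ≤ D)
    (h : (1 / 2) ^ (n + 1) * (δ * (2 * D)) ≤ ε * Real.sqrt n) :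
    D ≤ (n:ℝ) ^ (20 * n + 70) * ε := by
  have hN : (2:ℝ) ≤ n := by exact_mod_cast hn
  have hN0 : (0:ℝ) < n := by linarith
  have hs : Real.sqrt n ≤ n := by
    rw [Real.sqrt_le_left hN0.le]; nlinarith
  have h1 : (1 / (n:ℝ)) ^ (n + 1) ≤ (1 / 2) ^ (n + 1) := by gcongr
  have h2 : (1 / (n:ℝ)) ^ (n + 1) * (1 / (n:ℝ) ^ (19 * (n + 1) + 49) * (2 * D)) ≤ ε * n := by
    refine le_trans ?_ (h.trans (by gcongr))
    gcongr
  have e : (1 / (n:ℝ)) ^ (n + 1) * (1 / (n:ℝ) ^ (19 * (n + 1) + 49) * (2 * D)) =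
      2 * D / (n:ℝ) ^ (20 * n + 69) := by
    have : (n:ℝ) ^ (20 * n + 69) = (n:ℝ) ^ (n + 1) * (n:ℝ) ^ (19 * (n + 1) + 49) := by
      rw [← pow_add]; congr 1; ring
    rw [this, one_div, one_div, inv_pow]
    field_simp
  rw [e, div_le_iff₀ (by positivity)] at h2
  have : (n:ℝ) ^ (20 * n + 70) * ε = ε * n * (n:ℝ) ^ (20 * n + 69) := by
    rw [show 20 * n + 70 = (20 * n + 69) + 1 by ring, pow_succ]; ring
  linarith

/-- a power comparison -/
lemma lms_num_pow {n : ℕ} (hn : 2 ≤ n) {t : ℝ} (ht0 : 0 ≤ t) (ht : (n:ℝ) ^ 29 * t ≤ 2) {A k : ℕ}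
    (hA : A ≤ 28 * k) : (n:ℝ) ^ A * t ^ k ≤ 1 := by
  have hN : (2:ℝ) ≤ n := by exact_mod_cast hn
  have hN0 : (0:ℝ) < n := by linarith
  have h1 : (n:ℝ) ^ 28 * t ≤ 1 := by
    have : (n:ℝ) * ((n:ℝ) ^ 28 * t) ≤ n * 1 := by
      calc (n:ℝ) * ((n:ℝ) ^ 28 * t) = (n:ℝ) ^ 29 * t := by ring
        _ ≤ (n:ℝ) * 1 := by linarith
    exact le_of_mul_le_mul_left this hN0
  calc (n:ℝ) ^ A * t ^ k ≤ (n:ℝ) ^ (28 * k) * t ^ k := by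
        gcongr
        linarith
    _ = ((n:ℝ) ^ 28 * t) ^ k := by rw [pow_mul, mul_pow]
    _ ≤ 1 := pow_le_one₀ (by positivity) h1

/-- final numerical contradiction -/
lemma lms_num_d {n : ℕ} (hn : 2 ≤ n) {t d σ : ℝ} (ht0 : 0 < t) (ht : (n:ℝ) ^ 29 * t ≤ 2)
    (hd0 : 0 < d) (hσ : σ ≤ (n:ℝ) ^ (10 * n + 43) * t ^ (2 * n))
    (h : (d / 2) * ((2 * Real.pi) ^ (-(n:ℝ) / 2) * Real.exp (-9 / 8) * (d / 4 / n) ^ n) ≤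
      (t ^ (4 * n) + σ) * Real.sqrt n) : d ≤ (n:ℝ) ^ 29 * t := by
  have hN : (2:ℝ) ≤ n := by exact_mod_cast hn
  have hN0 : (0:ℝ) < n := by linarith
  have hN1 : (1:ℝ) ≤ n := by linarith
  have hp : ∀ k : ℕ, (2:ℝ) ^ k ≤ (n:ℝ) ^ k := fun k => pow_le_pow_left₀ (by norm_num) hN k
  have hs : Real.sqrt n ≤ n := by
    rw [Real.sqrt_le_left hN0.le]; nlinarith
  have ht1 : t ≤ 1 := by
    have := lms_num_pow hn ht0.le ht (A := 0) (k := 1) (by norm_num)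
    simpa using this
  have h1 : (1 / (n:ℝ) ^ 3) ^ n ≤ (2 * Real.pi) ^ (-(n : ℝ) / 2) := by
    have : (1 / (8:ℝ)) ^ n ≤ (2 * Real.pi) ^ (-(n : ℝ) / 2) := by
      rw [neg_div, Real.rpow_neg (by positivity), one_div, inv_pow]
      apply inv_anti₀ (by positivity)
      rw [← Real.rpow_natCast]
      calc (2 * Real.pi) ^ ((n : ℝ) / 2) ≤ (2 * Real.pi) ^ (n : ℝ) := by
            apply Real.rpow_le_rpow_of_exponent_le
            · linarith [Real.pi_gt_three]
            · linarith
        _ ≤ 8 ^ (n : ℝ) := by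
            apply Real.rpow_le_rpow (by positivity) _ (by positivity)
            linarith [Real.pi_lt_four]
    refine le_trans ?_ this
    gcongr
    have := hp 3
    norm_num at this
    exact this
  have h2 : 1 / (n:ℝ) ^ 2 ≤ Real.exp (-9 / 8) := by
    have h3 : 1 / (n:ℝ) ^ 2 ≤ 1 / 4 := by
      apply one_div_le_one_div_of_le (by norm_num)
      have := hp 2
      norm_num at this
      exact this
    have h4 : (1:ℝ) / 4 ≤ Real.exp (-9 / 8) := by
      have : Real.exp (-9 / 8) = Real.exp (-9 / 16) ^ 2 := by
        rw [← Real.exp_nat_mul]; congr 1; norm_num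
      have h5 : Real.exp (-9 / 16) = Real.exp (-9 / 32) ^ 2 := by
        rw [← Real.exp_nat_mul]; congr 1; norm_num
      have h6 := Real.add_one_le_exp (-9 / 32 : ℝ)
      have h7 : (1:ℝ) / 2 ≤ Real.exp (-9 / 16) := by rw [h5]; nlinarith
      rw [this]; nlinarith
    linarith
  have h3 : (d / (n:ℝ) ^ 3) ^ n ≤ (d / 4 / n) ^ n := by
    apply pow_le_pow_left₀ (by positivity)
    rw [div_div]
    apply div_le_div_of_nonneg_left hd0.le (by positivity)
    nlinarith
  have h4 : d / n ≤ d / 2 := div_le_div_of_nonneg_left hd0.le (by norm_num) hN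
  have hlow : d ^ (n + 1) / (n:ℝ) ^ (6 * n + 3) ≤
      (d / 2) * ((2 * Real.pi) ^ (-(n:ℝ) / 2) * Real.exp (-9 / 8) * (d / 4 / n) ^ n) := by
    calc d ^ (n + 1) / (n:ℝ) ^ (6 * n + 3) = (d / n) * ((1 / (n:ℝ) ^ 3) ^ n * (1 / (n:ℝ) ^ 2) *
          (d / (n:ℝ) ^ 3) ^ n) := by
          have : (n:ℝ) ^ (6 * n + 3) = n * (((n:ℝ) ^ 3) ^ n * (n:ℝ) ^ 2 * ((n:ℝ) ^ 3) ^ n) := by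
            rw [← pow_mul]; ring
          rw [this, div_pow, div_pow, one_pow, pow_succ]
          field_simp
      _ ≤ _ := by gcongr
  have hup : (t ^ (4 * n) + σ) * Real.sqrt n ≤ (n:ℝ) ^ (10 * n + 45) * t ^ (2 * n) := by
    have h5 : t ^ (4 * n) ≤ (n:ℝ) ^ (10 * n + 43) * t ^ (2 * n) := by
      calc t ^ (4 * n) ≤ t ^ (2 * n) := pow_le_pow_of_le_one ht0.le ht1 (by omega)
        _ = 1 * t ^ (2 * n) := by ring
        _ ≤ _ := by
          gcongr
          exact one_le_pow₀ hN1
    calc (t ^ (4 * n) + σ) * Real.sqrt n ≤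
        (n * ((n:ℝ) ^ (10 * n + 43) * t ^ (2 * n))) * n := by
          have h6 : t ^ (4 * n) + σ ≤ n * ((n:ℝ) ^ (10 * n + 43) * t ^ (2 * n)) := by
            have : 0 ≤ (n:ℝ) ^ (10 * n + 43) * t ^ (2 * n) := by positivity
            nlinarith
          exact mul_le_mul h6 hs (Real.sqrt_nonneg _) (by positivity)
      _ = _ := by ring
  have hfin : d ^ (n + 1) ≤ ((n:ℝ) ^ 29 * t) ^ (n + 1) := by
    have h5 := hlow.trans (h.trans hup)
    rw [div_le_iff₀ (by positivity)] at h5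
    refine h5.trans ?_
    calc (n:ℝ) ^ (10 * n + 45) * t ^ (2 * n) * (n:ℝ) ^ (6 * n + 3) =
          (n:ℝ) ^ (16 * n + 48) * t ^ (2 * n) := by
          rw [show 16 * n + 48 = (10 * n + 45) + (6 * n + 3) by ring, pow_add]; ring
      _ ≤ (n:ℝ) ^ (29 * (n + 1)) * t ^ (n + 1) :=
          mul_le_mul (pow_le_pow_right₀ hN1 (by omega))
            (pow_le_pow_of_le_one ht0.le ht1 (by omega)) (by positivity) (by positivity)
      _ = _ := by rw [mul_pow, pow_mul]
  exact le_of_pow_le_pow_left₀ (by omega) (by positivity) hfin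

end Part12

/-- the one-dimensional case -/
lemma lms_one {K : Set (EuclideanSpace ℝ (Fin 1))}
    (hKcomp : IsCompact K) (hKconv : Convex ℝ K) (hne : K.Nonempty)
    (hL : IsLoewnerEllipsoid (closedBall (0 : EuclideanSpace ℝ (Fin 1)) 1) K)
    {w : Fin (1 + 1) → EuclideanSpace ℝ (Fin 1)} (hw : IsRegVerts w) :
    K = convexHull ℝ (Set.range w) := by
  have hs := lms_reg_sum le_rfl hw
  rw [Fin.sum_univ_two] at hs
  have hw1 : w 1 = -w 0 := (neg_eq_of_add_eq_zero_right hs).symm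
  have hn0 := hw.1 0
  have hfr : ∀ x, ⟪w 0, x⟫ ^ 2 = ‖x‖ ^ 2 := by
    intro x
    have h := lms_reg_frame le_rfl hw x
    rw [Fin.sum_univ_two, hw1, inner_neg_left] at h
    push_cast at h
    linarith
  have hrep : ∀ x, x = ⟪w 0, x⟫ • w 0 := by
    intro x
    rw [← sub_eq_zero, ← norm_eq_zero, ← sq_eq_zero_iff]
    rw [← hfr, inner_sub_right, inner_smul_right, real_inner_self_eq_norm_sq, hn0]
    ring
  obtain ⟨ι, _, u, p, huK, hu, hp, hp1, -, h0⟩ := lms_john le_rfl K hKcomp hL hne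
  have hz : ∑ i, p i * ⟪w 0, u i⟫ = 0 := by
    have := congrArg (fun y => ⟪w 0, y⟫) h0
    simpa [inner_sum, inner_smul_right] using this
  have hpm : ∀ i, ⟪w 0, u i⟫ = 1 ∨ ⟪w 0, u i⟫ = -1 := by
    intro i
    have := hfr (u i)
    rw [hu i] at this
    exact sq_eq_sq_iff_eq_or_eq_neg.1 this
  have hA : w 0 ∈ K := by
    by_contra hcon
    have : ∀ i, ⟪w 0, u i⟫ = -1 := by
      intro i
      refine (hpm i).resolve_left fun h => hcon ?_
      have h2 := hrep (u i)
      rw [h, one_smul] at h2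
      rw [← h2]; exact huK i
    simp only [this, mul_neg, mul_one, Finset.sum_neg_distrib, hp1] at hz
    norm_num at hz
  have hB : w 1 ∈ K := by
    by_contra hcon
    have : ∀ i, ⟪w 0, u i⟫ = 1 := by
      intro i
      refine (hpm i).resolve_right fun h => hcon ?_
      have h2 := hrep (u i)
      rw [h, neg_one_smul, ← hw1] at h2
      rw [← h2]; exact huK i
    simp only [this, mul_one, hp1] at hz
    norm_num at hz
  apply Subset.antisymm
  · intro x hx
    have hx1 : ‖x‖ ≤ 1 := by simpa using hL.2.1 hx
    have h1 : |⟪w 0, x⟫| ≤ 1 := by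
      have := abs_real_inner_le_norm (w 0) x
      rw [hn0, one_mul] at this
      exact this.trans hx1
    rw [abs_le] at h1
    have e : x = ((1 + ⟪w 0, x⟫) / 2) • w 0 + ((1 - ⟪w 0, x⟫) / 2) • w 1 := by
      rw [hw1, smul_neg, ← sub_eq_add_neg, ← sub_smul]
      conv_lhs => rw [hrep x]
      congr 1; ring
    rw [e]
    exact convex_convexHull ℝ _ (subset_convexHull ℝ _ (mem_range_self 0))
      (subset_convexHull ℝ _ (mem_range_self 1)) (by linarith) (by linarith) (by ring)
  · refine convexHull_min ?_ hKconv
    rintro _ ⟨i, rfl⟩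
    fin_cases i
    · exact hA
    · exact hB

/-- existence of the isometry moving the simplex close to contact points -/
lemma lms_contact {n : ℕ} (hn : 2 ≤ n) {K : Set (EuclideanSpace ℝ (Fin n))}
    (hKcomp : IsCompact K) (hne : K.Nonempty)
    (hL : IsLoewnerEllipsoid (closedBall (0 : EuclideanSpace ℝ (Fin n)) 1) K)
    {w : Fin (n + 1) → EuclideanSpace ℝ (Fin n)} (hw : IsRegVerts w)
    {t : ℝ} (ht0 : 0 < t) (ht : (n:ℝ) ^ 29 * t ≤ 2)
    (hW : ∫ x, suppFn K x ∂ProbabilityTheory.stdGaussian (EuclideanSpace ℝ (Fin n)) ≤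
      (1 + t ^ (4 * n)) *
        ∫ x, lM w x ∂ProbabilityTheory.stdGaussian (EuclideanSpace ℝ (Fin n))) :
    ∃ (u : Fin (n + 1) → EuclideanSpace ℝ (Fin n))
      (T : EuclideanSpace ℝ (Fin n) ≃ₗᵢ[ℝ] EuclideanSpace ℝ (Fin n)),
      (∀ b, u b ∈ K) ∧
      ∀ b, ‖u b - T (w b)‖ ≤ (n:ℝ) ^ (10 * n + 43) * t ^ (2 * n) := by
  have hN : (2:ℝ) ≤ n := by exact_mod_cast hn
  have hN0 : (0:ℝ) < n := by linarith
  have hp2 : ∀ k : ℕ, (2:ℝ) ^ k ≤ (n:ℝ) ^ k := fun k => pow_le_pow_left₀ (by norm_num) hN k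
  have hm : (n:ℝ) + 1 ≤ (n:ℝ) ^ 2 := by nlinarith
  have hn1 : 1 ≤ n := by omega
  have hKB := hL.2.1
  obtain ⟨ι, _, u, p, huK, hu, hp, hp1, hF, h0⟩ := lms_john hn1 K hKcomp hL hne
  have : Nonempty ι := by
    by_contra h
    rw [not_nonempty_iff] at h
    simp at hp1
  set ε := t ^ (4 * n) with hε
  have hε0 : 0 < ε := by positivity
  have hI1 : ∫ x, lM u x ∂ProbabilityTheory.stdGaussian (EuclideanSpace ℝ (Fin n)) ≤
      ∫ x, suppFn K x ∂ProbabilityTheory.stdGaussian (EuclideanSpace ℝ (Fin n)) := by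
    refine integral_mono (lM_int hu) (suppFn_int hKB hne) fun x => ?_
    refine lM_le.2 fun i => ?_
    rw [real_inner_comm]
    exact le_suppFn hKB (huK i) x
  have hI2 : ∫ x, lM w x ∂ProbabilityTheory.stdGaussian (EuclideanSpace ℝ (Fin n)) ≤
      Real.sqrt n := by
    refine le_trans (integral_mono (lM_int hw.1) lG_norm_int fun x =>
      (le_abs_self _).trans (lM_abs hw.1 x)) ?_
    refine lG_norm_le.trans ?_
    simp
  have hgap := lms_gap hn1 hu hp hp1 hF h0 hw
  set θ : ι → ι → ℝ := fun i j => ⟪lLift (u i), lLift (u j)⟫ with hθ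
  have hθ1 : ∀ i j, |θ i j| ≤ 1 := by
    intro i j
    have := abs_real_inner_le_norm (lLift (u i)) (lLift (u j))
    rwa [lLift_norm (hu i), lLift_norm (hu j), one_mul] at this
  set D := ∑ i, ∑ j, ((n + 1) * p i) * ((n + 1) * p j) * ⟪lLift (u i), lLift (u j)⟫ ^ 2 *
    (1 - ⟪lLift (u i), lLift (u j)⟫) with hD
  have hD0 : 0 ≤ D := by
    refine Finset.sum_nonneg fun i _ => Finset.sum_nonneg fun j _ => ?_
    have h1 := hp i
    have h2 := hp j
    have h3 : 0 ≤ 1 - ⟪lLift (u i), lLift (u j)⟫ := by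
      have := (abs_le.1 (hθ1 i j)).2
      simp only [hθ] at this
      linarith
    positivity
  have hs1 : Real.sqrt ((n:ℝ) / (n + 1)) ≤ 1 := by
    rw [Real.sqrt_le_left zero_le_one, one_pow, div_le_one (by positivity)]
    linarith
  have hDle : D ≤ (n:ℝ) ^ (20 * n + 70) * ε := by
    refine lms_num_D hn hε0.le (lms_num_ldelta hn ?_) hD0 (hgap.trans ?_)
    · exact lms_volume_ball (lLift_finrank n) (by omega) _ (by norm_num)
    · calc _ ≤ Real.sqrt ((n:ℝ) / (n + 1)) * (ε * Real.sqrt n) := by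
            refine mul_le_mul_of_nonneg_left ?_ (Real.sqrt_nonneg _)
            have := mul_le_mul_of_nonneg_left hI2 hε0.le
            linarith
        _ ≤ 1 * (ε * Real.sqrt n) := by gcongr
        _ = ε * Real.sqrt n := one_mul _
  set Δ := (n:ℝ) ^ (20 * n + 70) * ε with hΔ
  have hΔ0 : 0 < Δ := by positivity
  have hsel := lms_select (ι := ι) (c := fun i => ((n:ℝ) + 1) * p i) (θ := θ) (m := n + 1) (Δ := Δ)
    (fun i => mul_nonneg (by positivity) (hp i)) (fun i j => real_inner_comm _ _) hθ1
    (fun i => by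
      have := lLift_frame hn1 hp1 hF h0 (lLift (u i))
      rw [lLift_norm (hu i)] at this
      simp only [hθ]
      refine Eq.trans ?_ (this.trans (one_pow 2))
      refine Finset.sum_congr rfl fun j _ => ?_
      rw [real_inner_comm])
    (by rw [← Finset.mul_sum, hp1]; push_cast; ring) hΔ0
    (by
      refine le_trans (le_of_eq ?_) hDle
      rw [hD]
      refine Finset.sum_congr rfl fun i _ => ?_
      rw [Finset.mul_sum]
      refine Finset.sum_congr rfl fun j _ => ?_
      simp only [hθ]
      ring)
    (by
      have h1 := lms_num_pow hn ht0.le ht (A := 20 * n + 79) (k := 4 * n) (by omega)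
      refine le_trans ?_ h1
      have h7 := hp2 7
      push_cast
      calc 128 * ((n:ℝ) + 1) * Δ ≤ (n:ℝ) ^ 7 * (n:ℝ) ^ 2 * Δ := by
            gcongr
            linarith
        _ = (n:ℝ) ^ (20 * n + 79) * t ^ (4 * n) := by rw [hΔ, hε]; ring)
  obtain ⟨f, hf⟩ := hsel
  set τ := (n:ℝ) ^ (10 * n + 39) * t ^ (2 * n) with hτ
  have hτ0 : 0 ≤ τ := by positivity
  obtain ⟨T, hT⟩ := lms_isometry hn1 hw (u := fun a => u (f a)) (fun a => hu _) hτ0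
    (by
      have h1 := lms_num_pow hn ht0.le ht (A := 10 * n + 42) (k := 2 * n) (by omega)
      have h2 : (n:ℝ) * (((n:ℝ) + 1) * τ) ≤ 1 := by
        refine le_trans ?_ h1
        calc (n:ℝ) * (((n:ℝ) + 1) * τ) ≤ n * ((n:ℝ) ^ 2 * τ) := by gcongr
          _ = (n:ℝ) ^ (10 * n + 42) * t ^ (2 * n) := by rw [hτ]; ring
      have h3 : 0 ≤ ((n:ℝ) + 1) * τ := by positivity
      nlinarith)
    (fun a b hab => by
      refine abs_le_of_sq_le_sq ?_ hτ0
      have h1 := hf a b hab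
      simp only [hθ] at h1
      refine h1.trans ?_
      push_cast
      have h6 := hp2 6
      calc 64 * ((n:ℝ) + 1) * Δ ≤ (n:ℝ) ^ 6 * (n:ℝ) ^ 2 * Δ := by
            gcongr
            linarith
        _ = τ ^ 2 := by rw [hΔ, hε, hτ]; ring)
  refine ⟨fun a => u (f a), T, fun b => huK _, fun b => (hT b).trans ?_⟩
  have h2 := hp2 2
  calc 3 * ((n:ℝ) + 1) * τ ≤ (n:ℝ) ^ 2 * (n:ℝ) ^ 2 * τ := by
        gcongr
        linarith
    _ = (n:ℝ) ^ (10 * n + 43) * t ^ (2 * n) := by rw [hτ]; ring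

/-- from mean width to Gaussian integrals -/
lemma lms_gaussW {n : ℕ} (hn : 1 ≤ n) {K : Set (EuclideanSpace ℝ (Fin n))}
    (hKB : K ⊆ closedBall 0 1) (hne : K.Nonempty)
    {w : Fin (n + 1) → EuclideanSpace ℝ (Fin n)} (hw : ∀ i, ‖w i‖ = 1)
    {ε : ℝ} (hW : meanWidth n K ≤ (1 + ε) * meanWidth n (convexHull ℝ (Set.range w))) :
    ∫ x, suppFn K x ∂ProbabilityTheory.stdGaussian (EuclideanSpace ℝ (Fin n)) ≤
      (1 + ε) * ∫ x, lM w x ∂ProbabilityTheory.stdGaussian (EuclideanSpace ℝ (Fin n)) := by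
  obtain ⟨k, rfl⟩ : ∃ k, n = k + 1 := ⟨n - 1, by omega⟩
  obtain ⟨C, hC, h⟩ := lms_meanWidth k
  have hsub : convexHull ℝ (range w) ⊆ closedBall 0 1 :=
    convexHull_min (by rintro _ ⟨i, rfl⟩; simp [hw i]) (convex_closedBall _ _)
  rw [h K hKB hne, h _ hsub ((range_nonempty w).convexHull)] at hW
  have e : (fun x => suppFn (convexHull ℝ (range w)) x) = lM w := funext fun x => suppFn_lM hw x
  rw [e] at hW
  refine le_of_mul_le_mul_left ?_ hC
  linarith

/-- the case `n ≥ 2` -/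
lemma lms_main {n : ℕ} (hn : 2 ≤ n) {K : Set (EuclideanSpace ℝ (Fin n))}
    (hKcomp : IsCompact K) (hKconv : Convex ℝ K) (hne : K.Nonempty)
    (hL : IsLoewnerEllipsoid (closedBall (0 : EuclideanSpace ℝ (Fin n)) 1) K)
    {w : Fin (n + 1) → EuclideanSpace ℝ (Fin n)} (hw : IsRegVerts w)
    {t : ℝ} (ht0 : 0 < t) (ht : (n:ℝ) ^ 29 * t ≤ 2)
    (hW : ∫ x, suppFn K x ∂ProbabilityTheory.stdGaussian (EuclideanSpace ℝ (Fin n)) ≤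
      (1 + t ^ (4 * n)) *
        ∫ x, lM w x ∂ProbabilityTheory.stdGaussian (EuclideanSpace ℝ (Fin n))) :
    ∃ T : EuclideanSpace ℝ (Fin n) ≃ₗᵢ[ℝ] EuclideanSpace ℝ (Fin n),
      hausdorffDist K (T '' convexHull ℝ (Set.range w)) ≤ (n : ℝ) ^ 29 * t := by
  have hN : (2:ℝ) ≤ n := by exact_mod_cast hn
  obtain ⟨u, T, huK, hT⟩ := lms_contact hn hKcomp hne hL hw ht0 ht hW
  set v : Fin (n + 1) → EuclideanSpace ℝ (Fin n) := fun b => T (w b) with hv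
  set σ := (n:ℝ) ^ (10 * n + 43) * t ^ (2 * n) with hσ
  have hv1 : ∀ b, ‖v b‖ = 1 := fun b => by simp [hv, hw.1 b]
  have hS : T '' convexHull ℝ (range w) = convexHull ℝ (range v) := by
    have := LinearMap.image_convexHull T.toLinearEquiv.toLinearMap
      (range w)
    have e : range v = T '' range w := by rw [← range_comp]; rfl
    rw [e]
    exact this
  refine ⟨T, ?_⟩
  rw [hS]
  have hcomp : IsCompact (convexHull ℝ (range v)) := by
    exact (finite_range v).isCompact_convexHull (𝕜 := ℝ)
  have hSne : (convexHull ℝ (range v)).Nonempty := (range_nonempty v).convexHull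
  have hσt : σ ≤ (n:ℝ) ^ 29 * t := by
    have h1 := lms_num_pow hn ht0.le ht (A := 10 * n + 43) (k := 2 * n - 1) (by omega)
    have e : σ = (n:ℝ) ^ (10 * n + 43) * t ^ (2 * n - 1) * t := by
      rw [hσ, mul_assoc, ← pow_succ]
      congr 2
      omega
    rw [e]
    gcongr
    exact h1.trans (one_le_pow₀ (by linarith))
  rw [← lms_lM_iso w T] at hW
  refine hausdorffDist_le_of_mem_dist (by positivity) (fun x hx => ?_) (fun y hy => ?_)
  · obtain ⟨y, hy, hd⟩ := hcomp.exists_infDist_eq_dist hSne x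
    refine ⟨y, hy, ?_⟩
    rw [← hd]
    rcases (infDist_nonneg (x := x) (s := convexHull ℝ (range v))).eq_or_lt with h | h
    · rw [← h]; positivity
    · exact lms_num_d hn ht0 ht h le_rfl
        (lms_finish hn hL.2.1 hv1 huK (by positivity) hT hW hx rfl h)
  · obtain ⟨z, hz, hyz⟩ := lms_simplex_near hKconv huK hT hy
    exact ⟨z, hz, hyz.trans hσt⟩

theorem loewner_mean_width_stability
    (n : ℕ) (hn : 1 ≤ n) (K : Set (EuclideanSpace ℝ (Fin n)))
    (hKcomp : IsCompact K) (hKconv : Convex ℝ K) (hKint : (interior K).Nonempty)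
    (hLoewner : IsLoewnerEllipsoid (closedBall (0 : EuclideanSpace ℝ (Fin n)) 1) K)
    (w : Fin (n + 1) → EuclideanSpace ℝ (Fin n)) (hw : IsRegVerts w)
    (ε : ℝ) (hε0 : 0 < ε)
    (hW : meanWidth n K ≤ (1 + ε) * meanWidth n (convexHull ℝ (Set.range w))) :
    ∃ T : EuclideanSpace ℝ (Fin n) ≃ₗᵢ[ℝ] EuclideanSpace ℝ (Fin n),
      hausdorffDist K (T '' convexHull ℝ (Set.range w)) ≤
        (n : ℝ) ^ 29 * ε ^ (1 / (4 * (n : ℝ))) := by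
  have hne : K.Nonempty := hKint.mono interior_subset
  rcases hn.eq_or_lt with h1 | h2
  · subst h1
    refine ⟨LinearIsometryEquiv.refl ℝ _, ?_⟩
    have h := lms_one hKcomp hKconv hne hLoewner hw
    have e : (LinearIsometryEquiv.refl ℝ (EuclideanSpace ℝ (Fin 1))) ''
        convexHull ℝ (Set.range w) = K := by
      rw [← h]; simp
    rw [e, hausdorffDist_self_zero]
    positivity
  · have hn0 : (n:ℝ) ≠ 0 := by positivity
    set t := ε ^ (1 / (4 * (n : ℝ))) with ht
    have ht0 : 0 < t := by positivity
    have hεt : t ^ (4 * n) = ε := by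
      rw [ht, ← Real.rpow_natCast, ← Real.rpow_mul hε0.le]
      push_cast
      rw [one_div, inv_mul_cancel₀ (by positivity), Real.rpow_one]
    rcases le_total ((n:ℝ) ^ 29 * t) 2 with hle | hge
    · exact lms_main h2 hKcomp hKconv hne hLoewner hw ht0 hle
        (by rw [hεt]; exact lms_gaussW hn hLoewner.2.1 hne hw.1 hW)
    · refine ⟨LinearIsometryEquiv.refl ℝ _, le_trans ?_ hge⟩
      have e : (LinearIsometryEquiv.refl ℝ (EuclideanSpace ℝ (Fin n))) ''
        convexHull ℝ (Set.range w) = convexHull ℝ (Set.range w) := by simp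
      rw [e]
      exact lms_hausdorff hLoewner.2.1
        (convexHull_min (by rintro _ ⟨i, rfl⟩; simp [hw.1 i]) (convex_closedBall _ _)) hne
        (range_nonempty w).convexHull

end
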